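/- Fix an algebraic closure ℚ̄ of ℚ and a totally real number field F ⊆ ℚ̄. For every real C > 0, there are only finitely many totally imaginary quadratic extensions K of F inside ℚ̄ whose class number h(K) is at most C. In particular, as K ranges over any infinite set of CM quadratic extensions of F inside ℚ̄, the class numbers h(K) tend to infinity. -/

import Mathlib

open NumberField Module

/-- A field is totally real if all of its complex embeddings are real. -/
def IsTotallyRealField (K : Type*) [Field K] : Prop :=
  ∀ φ : K →+* ℂ, ComplexEmbedding.IsReal φ

/-- A field is totally imaginary if none of its complex embeddings is real. -/
def IsTotallyImaginaryField (K : Type*) [Field K] : Prop :=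
  ∀ φ : K →+* ℂ, ¬ ComplexEmbedding.IsReal φ

/-- `φ (2 - x)` is the sum of the power series with nonnegative coefficients `b` on `[0, 1)`. -/
def AbsMono (b : ℕ → ℝ) (φ : ℝ → ℝ) : Prop :=
  (∀ m, 0 ≤ b m) ∧ ∀ x ∈ Set.Ico (0 : ℝ) 1, HasSum (fun m ↦ b m * x ^ m) (φ (2 - x))

namespace AbsMono

open Metric Filter Topology

variable {b : ℕ → ℝ} {φ : ℝ → ℝ} {G : ℂ → ℂ} {r B l : ℝ}

/-- The Taylor coefficients at `2` of `φ s - l / (s - 1)`, where `l` is the residue of `φ` at `1`,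
decay geometrically when `(s - 1) φ s` continues to a disc containing `1` in its interior. -/
theorem taylor_bound (hb : AbsMono b φ) (hr : 1 < r)
    (hG : DifferentiableOn ℂ G (closedBall 2 r)) (hB : ∀ z ∈ closedBall (2 : ℂ) r, ‖G z‖ ≤ B)
    (hl : G 1 = l) (hφ : ∀ s : ℝ, 1 < s → s ≤ 2 → G s = ((s - 1) * φ s : ℝ)) :
    (∀ m, |b m - l| ≤ 2 * B / (r - 1) * r⁻¹ ^ m) ∧
      ∀ x : ℝ, 1 < x → x < r →
        HasSum (fun m ↦ (b m - l) * x ^ m) (((G (2 - x)).re - l) / (1 - x)) := by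
  have hr0 : 0 < r := by linarith
  have h1mem : (1 : ℂ) ∈ ball (2 : ℂ) r := by
    simp only [mem_ball, Complex.dist_eq]; norm_num; exact hr
  set f : ℂ → ℂ := fun w ↦ dslope G 1 (2 - w) with hf
  have hmaps : Set.MapsTo (fun w : ℂ ↦ 2 - w) (closedBall 0 r) (closedBall 2 r) := by
    intro w hw; simpa [Complex.dist_eq] using hw
  have hds : DifferentiableOn ℂ (dslope G 1) (closedBall 2 r) :=
    (Complex.differentiableOn_dslope
      (mem_of_superset (isOpen_ball.mem_nhds h1mem) ball_subset_closedBall)).2 hG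
  have hfd : DifferentiableOn ℂ f (closedBall 0 r) :=
    hds.comp ((differentiable_const _).sub differentiable_id).differentiableOn hmaps
  lift r to NNReal using hr0.le
  have hps := hfd.hasFPowerSeriesOnBall (by exact_mod_cast hr0)
  set p := cauchyPowerSeries f 0 r with hp
  have hfval : ∀ w : ℂ, w ≠ 1 → f w = (G (2 - w) - l) / (1 - w) := by
    intro w hw
    have : (2 : ℂ) - w ≠ 1 := fun h ↦ hw (by linear_combination -h)
    simp only [hf]
    rw [dslope_of_ne _ this, slope_def_field, hl]
    congr 1; ring
  have hq : HasFPowerSeriesAt (fun w : ℂ ↦ ∑' m, ((b m - l : ℝ) : ℂ) * w ^ m)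
      (FormalMultilinearSeries.ofScalars ℂ (fun m ↦ ((b m - l : ℝ) : ℂ))) 0 := by
    rw [hasFPowerSeriesAt_iff]
    filter_upwards [ball_mem_nhds (0 : ℂ) one_pos] with z hz
    simp only [FormalMultilinearSeries.coeff_ofScalars, zero_add, smul_eq_mul]
    have hz' : ‖z‖ < 1 := by simpa using hz
    have : Summable fun m ↦ ((b m - l : ℝ) : ℂ) * z ^ m := by
      apply Summable.of_norm
      have h1 := (hb.2 ‖z‖ ⟨norm_nonneg _, hz'⟩).summable
      have h2 := (summable_geometric_of_lt_one (norm_nonneg _) hz').mul_left |l|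
      refine (h1.add h2).of_nonneg_of_le (fun _ ↦ norm_nonneg _) fun m ↦ ?_
      rw [norm_mul, norm_pow, Complex.norm_real, ← add_mul]
      gcongr
      rw [Real.norm_eq_abs]
      exact (abs_sub _ _).trans_eq (by rw [abs_of_nonneg (hb.1 m)])
    simpa only [mul_comm] using this.hasSum
  have hev : ∀ᶠ z in 𝓝 (0 : ℂ), f z = ∑' m, ((b m - l : ℝ) : ℂ) * z ^ m := by
    have ha : AnalyticAt ℂ f 0 := hps.analyticAt
    rw [← ha.frequently_eq_iff_eventually_eq hq.analyticAt]
    have hreal : ∀ x : ℝ, 0 < x → x < 1 → f x = ∑' m, ((b m - l : ℝ) : ℂ) * (x : ℂ) ^ m := by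
      intro x hx0 hx1
      have h1 := hb.2 x ⟨hx0.le, hx1⟩
      have h2 := (hasSum_geometric_of_lt_one hx0.le hx1).mul_left l
      have h3 := h1.sub h2
      have hne : (1 : ℂ) - x ≠ 0 := by
        norm_cast; exact ne_of_gt (by linarith)
      rw [hfval _ (by norm_cast; exact hx1.ne)]
      have h4 := hφ (2 - x) (by linarith) (by linarith)
      push_cast at h4
      rw [h4]
      have h5 : HasSum (fun m ↦ ((b m - l : ℝ) : ℂ) * (x : ℂ) ^ m)
          ((φ (2 - x) - l * (1 - x)⁻¹ : ℝ) : ℂ) := by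
        have := Complex.hasSum_ofReal.2 h3
        convert this using 1
        ext m; push_cast; ring
      rw [h5.tsum_eq]
      push_cast
      field_simp
      ring
    have htend : Tendsto (fun n : ℕ ↦ (((1 : ℝ) / ((n : ℝ) + 2) : ℝ) : ℂ)) atTop (𝓝[≠] 0) := by
      rw [tendsto_nhdsWithin_iff]
      constructor
      · rw [show (0 : ℂ) = ((0 : ℝ) : ℂ) by simp]
        refine (Complex.continuous_ofReal.tendsto 0).comp ?_
        exact tendsto_const_nhds.div_atTop
          (tendsto_atTop_add_const_right _ _ tendsto_natCast_atTop_atTop)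
      · refine Eventually.of_forall fun n ↦ ?_
        simp only [Set.mem_compl_iff, Set.mem_singleton_iff]
        norm_cast
        positivity
    refine htend.frequently (Eventually.frequently (Eventually.of_forall fun n ↦ ?_))
    apply hreal
    · positivity
    · rw [div_lt_one (by positivity)]; linarith [n.cast_nonneg (α := ℝ)]
  have hpq : p = FormalMultilinearSeries.ofScalars ℂ (fun m ↦ ((b m - l : ℝ) : ℂ)) :=
    hps.hasFPowerSeriesAt.eq_formalMultilinearSeries (hq.congr (hev.mono fun z hz ↦ hz.symm))
  have hcoef : ∀ m, p.coeff m = ((b m - l : ℝ) : ℂ) := by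
    intro m; rw [hpq, FormalMultilinearSeries.coeff_ofScalars]
  refine ⟨fun m ↦ ?_, fun x hx1 hxr ↦ ?_⟩
  · have hcircle : ∀ θ : ℝ, ‖f (circleMap 0 r θ)‖ ≤ 2 * B / (r - 1) := by
      intro θ
      have hn : ‖circleMap 0 (r : ℝ) θ‖ = r := by
        simp [circleMap]
      have hne : circleMap 0 (r : ℝ) θ ≠ 1 := by
        intro h; rw [h] at hn; simp at hn; linarith
      rw [hfval _ hne, norm_div]
      have hlB : ‖(l : ℂ)‖ ≤ B := by
        rw [← hl]; exact hB _ (ball_subset_closedBall h1mem)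
      have hb1 : ‖G (2 - circleMap 0 (r : ℝ) θ) - l‖ ≤ 2 * B := by
        refine (norm_sub_le _ _).trans ?_
        have := hB (2 - circleMap 0 (r : ℝ) θ) (hmaps (by simp))
        linarith
      have hb2 : (r : ℝ) - 1 ≤ ‖1 - circleMap 0 (r : ℝ) θ‖ := by
        have := norm_sub_norm_le (circleMap 0 (r : ℝ) θ) 1
        rw [hn, norm_one, norm_sub_rev] at this
        exact this
      exact div_le_div₀ ((norm_nonneg _).trans hb1) hb1 (by linarith) hb2
    have h1 := norm_cauchyPowerSeries_le f 0 r m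
    rw [← hp] at h1
    have h2 : ‖p m‖ = |b m - l| := by
      rw [FormalMultilinearSeries.norm_apply_eq_norm_coef, hcoef, Complex.norm_real,
        Real.norm_eq_abs]
    rw [h2] at h1
    refine h1.trans ?_
    rw [abs_of_pos hr0]
    gcongr
    have h3 : ∫ θ in (0 : ℝ)..2 * Real.pi, ‖f (circleMap 0 r θ)‖ ≤
        ∫ θ in (0 : ℝ)..2 * Real.pi, 2 * B / (r - 1) := by
      apply intervalIntegral.integral_mono_on (by positivity)
      · apply Continuous.intervalIntegrable
        apply Continuous.norm
        apply hfd.continuousOn.comp_continuous (continuous_circleMap 0 r)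
        intro θ; simp
      · simp
      · intro θ _; exact hcircle θ
    rw [intervalIntegral.integral_const, smul_eq_mul, sub_zero] at h3
    calc _ ≤ (2 * Real.pi)⁻¹ * (2 * Real.pi * (2 * B / (r - 1))) := by gcongr
      _ = _ := by field_simp
  · have hxmem : (x : ℂ) ∈ Metric.eball (0 : ℂ) r := by
      rw [Metric.eball_coe]; simp [abs_of_pos (by linarith : 0 < x), hxr]
    have h1 := hps.hasSum hxmem
    rw [zero_add] at h1
    rw [hfval _ (by norm_cast; exact hx1.ne')] at h1
    have h2 : HasSum (fun m ↦ (((b m - l) * x ^ m : ℝ) : ℂ)) ((G (2 - x) - l) / (1 - x)) := by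
      refine h1.congr_fun fun m ↦ ?_
      rw [FormalMultilinearSeries.apply_eq_pow_smul_coeff, smul_eq_mul, hcoef]; push_cast; ring
    have h3 := Complex.hasSum_re h2
    simp only [Complex.ofReal_re] at h3
    convert h3 using 1
    rw [show (1 : ℂ) - x = ((1 - x : ℝ) : ℂ) by push_cast; rfl, Complex.div_ofReal_re]
    simp

/-- Estermann's lower bound for the residue of `φ` when `(s - 1) φ s` continues and is nonnegative
at a point slightly to the left of `1`. -/
theorem residue_lower_bound (hb : AbsMono b φ) (hb0 : 1 ≤ b 0) (hr : 1 < r) (hr2 : r ≤ 2)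
    (hG : DifferentiableOn ℂ G (closedBall 2 r)) (hB : ∀ z ∈ closedBall (2 : ℂ) r, ‖G z‖ ≤ B)
    (hB1 : 1 ≤ B) (hl : G 1 = l) (hl0 : 0 ≤ l)
    (hφ : ∀ s : ℝ, 1 < s → s ≤ 2 → G s = ((s - 1) * φ s : ℝ))
    {x x₀ θ : ℝ} (hx : 1 < x) (hx0 : x ≤ x₀) (hx0r : x₀ < r) (hθ : 0 < θ)
    (hxθ : x₀ ≤ (r / x₀) ^ θ) (hGx : 0 ≤ (G (2 - x)).re) :
    (x - 1) / 2 ≤ l * (8 * B / ((r - 1) * (1 - x₀ / r))) ^ θ := by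
  obtain ⟨hcoef, hsum⟩ := hb.taylor_bound hr hG hB hl hφ
  have hr0 : 0 < r := by linarith
  have hx00 : 0 < x₀ := by linarith
  have hxr : x < r := by linarith
  have hxpos : 0 < x := by linarith
  have hq1 : x₀ / r < 1 := (div_lt_one hr0).2 hx0r
  set B' := 2 * B / (r - 1) with hB'
  have hB'0 : 0 < B' := by apply div_pos <;> linarith
  set K := 2 * B' / (1 - x₀ / r) with hK
  have hK1 : 1 < K := by
    rw [hK, lt_div_iff₀ (by linarith)]
    have : 2 ≤ B' := by rw [hB', le_div_iff₀ (by linarith)]; linarith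
    have : 0 < x₀ / r := by positivity
    linarith
  have hρ : 1 < r / x₀ := (one_lt_div hx00).2 hx0r
  obtain ⟨N, hN1, hN2⟩ : ∃ N : ℕ, (r / x₀) ^ N ≤ K ∧ K < (r / x₀) ^ (N + 1) :=
    exists_nat_pow_near hK1.le hρ
  have hpart : 1 - l * ((x ^ (N + 1) - 1) / (x - 1)) ≤
      ∑ m ∈ Finset.range (N + 1), (b m - l) * x ^ m := by
    rw [← geom_sum_eq hx.ne', Finset.mul_sum]
    simp only [sub_mul, Finset.sum_sub_distrib]
    have : b 0 * x ^ 0 ≤ ∑ m ∈ Finset.range (N + 1), b m * x ^ m :=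
      Finset.single_le_sum (f := fun m ↦ b m * x ^ m)
        (fun m _ ↦ mul_nonneg (hb.1 m) (by positivity)) (by simp)
    simp only [pow_zero, mul_one] at this
    linarith
  have hgeo : HasSum (fun m ↦ -(B' * (x₀ / r) ^ (N + 1)) * (x₀ / r) ^ m)
      (-(B' * (x₀ / r) ^ (N + 1)) * (1 - x₀ / r)⁻¹) :=
    (hasSum_geometric_of_lt_one (by positivity) hq1).mul_left _
  have htail := (hasSum_nat_add_iff' (N + 1)).2 (hsum x hx hxr)
  have h1 : -(B' * (x₀ / r) ^ (N + 1)) * (1 - x₀ / r)⁻¹ ≤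
      ((G (2 - x)).re - l) / (1 - x) - ∑ m ∈ Finset.range (N + 1), (b m - l) * x ^ m := by
    refine hasSum_le (fun m ↦ ?_) hgeo htail
    have h2 := neg_le_of_abs_le (hcoef (m + (N + 1)))
    have h3 : (x₀ / r) ^ (N + 1) * (x₀ / r) ^ m = r⁻¹ ^ (m + (N + 1)) * x₀ ^ (m + (N + 1)) := by
      rw [← pow_add, div_eq_inv_mul, mul_pow, add_comm]
    have h4 : x ^ (m + (N + 1)) ≤ x₀ ^ (m + (N + 1)) := by gcongr
    have h5 : 0 ≤ B' * r⁻¹ ^ (m + (N + 1)) := by positivity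
    calc _ = -(B' * r⁻¹ ^ (m + (N + 1))) * x₀ ^ (m + (N + 1)) := by
            rw [neg_mul, neg_mul, mul_assoc, h3]; ring
      _ ≤ -(B' * r⁻¹ ^ (m + (N + 1))) * x ^ (m + (N + 1)) := by nlinarith
      _ ≤ _ := by gcongr
  have h6 : B' * (x₀ / r) ^ (N + 1) * (1 - x₀ / r)⁻¹ ≤ 1 / 2 := by
    have h7 : K * (x₀ / r) ^ (N + 1) ≤ 1 := by
      calc _ ≤ (r / x₀) ^ (N + 1) * (x₀ / r) ^ (N + 1) := by gcongr
        _ = 1 := by rw [← mul_pow, div_mul_div_cancel₀ hx00.ne', div_self hr0.ne', one_pow]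
    have : B' * (x₀ / r) ^ (N + 1) * (1 - x₀ / r)⁻¹ = K * (x₀ / r) ^ (N + 1) / 2 := by
      rw [hK, div_eq_mul_inv]; ring
    rw [this]; linarith
  have h8 : ((G (2 - x)).re - l) / (1 - x) ≤ l / (x - 1) := by
    rw [show ((G (2 - x)).re - l) / (1 - x) = (l - (G (2 - x)).re) / (x - 1) by
      rw [← neg_div_neg_eq]; ring_nf]
    gcongr
    · linarith
  have h9 : 1 / 2 ≤ l * x ^ (N + 1) / (x - 1) := by
    have : l * x ^ (N + 1) / (x - 1) = l / (x - 1) + l * ((x ^ (N + 1) - 1) / (x - 1)) := by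
      ring
    rw [this]
    linarith
  have h10 : x ^ (N + 1) ≤ (2 * K) ^ θ := by
    calc x ^ (N + 1) ≤ ((r / x₀) ^ θ) ^ (N + 1) := by gcongr; exact hx0.trans hxθ
      _ = ((r / x₀) ^ (N + 1)) ^ θ := by
        rw [← Real.rpow_natCast, ← Real.rpow_mul (by positivity), mul_comm, Real.rpow_mul
          (by positivity), Real.rpow_natCast]
      _ ≤ (2 * K) ^ θ := by
        gcongr
        rw [pow_succ, mul_comm]
        gcongr
        rw [div_le_iff₀ hx00]; linarith
  have h11 : 2 * K = 8 * B / ((r - 1) * (1 - x₀ / r)) := by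
    rw [hK, hB', ← div_div]; ring
  rw [← h11]
  rw [le_div_iff₀ (by linarith)] at h9
  calc _ = 1 / 2 * (x - 1) := by ring
    _ ≤ _ := h9
    _ ≤ _ := by gcongr

/-- An upper bound for the residue of `φ` in terms of a single value of `φ`. -/
theorem residue_upper_bound (hb : AbsMono b φ) (hr : 1 < r) (hr2 : r ≤ 2)
    (hG : DifferentiableOn ℂ G (closedBall 2 r)) (hB : ∀ z ∈ closedBall (2 : ℂ) r, ‖G z‖ ≤ B)
    (hB1 : 1 ≤ B) (hl : G 1 = l)
    (hφ : ∀ s : ℝ, 1 < s → s ≤ 2 → G s = ((s - 1) * φ s : ℝ))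
    {x θ : ℝ} (hx0 : 0 < x) (hx : x < 1) (hθ : 0 < θ) (hxθ : x⁻¹ ≤ r ^ θ) :
    l ≤ 1 + φ (2 - x) * (4 * B / (r - 1)) ^ θ := by
  obtain ⟨hcoef, -⟩ := hb.taylor_bound hr hG hB hl hφ
  have hr0 : 0 < r := by linarith
  set B' := 2 * B / (r - 1) with hB'
  have hB'1 : 1 ≤ B' := by rw [hB', le_div_iff₀ (by linarith)]; linarith
  obtain ⟨N, hN1, hN2⟩ : ∃ N : ℕ, r ^ N ≤ B' ∧ B' < r ^ (N + 1) := exists_nat_pow_near hB'1 hr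
  have h1 := neg_le_of_abs_le (hcoef (N + 1))
  have h2 : B' * r⁻¹ ^ (N + 1) ≤ 1 := by
    rw [inv_pow, ← div_eq_mul_inv, div_le_one (by positivity)]; exact hN2.le
  have h3 : b (N + 1) * x ^ (N + 1) ≤ φ (2 - x) :=
    le_hasSum (hb.2 x ⟨hx0.le, hx⟩) _ fun m _ ↦ mul_nonneg (hb.1 m) (by positivity)
  have h4 : x⁻¹ ^ (N + 1) ≤ (4 * B / (r - 1)) ^ θ := by
    calc x⁻¹ ^ (N + 1) ≤ (r ^ θ) ^ (N + 1) := by gcongr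
      _ = (r ^ (N + 1)) ^ θ := by
        rw [← Real.rpow_natCast, ← Real.rpow_mul hr0.le, mul_comm, Real.rpow_mul hr0.le,
          Real.rpow_natCast]
      _ ≤ (4 * B / (r - 1)) ^ θ := by
        gcongr
        rw [show 4 * B / (r - 1) = B' * 2 by rw [hB']; ring, pow_succ]
        gcongr
  have hφ0 : 0 ≤ φ (2 - x) := (mul_nonneg (hb.1 _) (by positivity)).trans h3
  have h5 : b (N + 1) ≤ φ (2 - x) * x⁻¹ ^ (N + 1) := by
    rw [inv_pow, ← div_eq_mul_inv, le_div_iff₀ (by positivity)]; exact h3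
  calc l ≤ 1 + b (N + 1) := by linarith
    _ ≤ 1 + φ (2 - x) * x⁻¹ ^ (N + 1) := by gcongr
    _ ≤ _ := by gcongr

end AbsMono

namespace AbsMono

open Filter Topology

variable {b b' : ℕ → ℝ} {φ φ' : ℝ → ℝ}

theorem congr (h : AbsMono b φ) (hφ : ∀ s, 1 < s → s ≤ 2 → φ s = φ' s) : AbsMono b φ' :=
  ⟨h.1, fun x hx ↦ hφ (2 - x) (by linarith [hx.2]) (by linarith [hx.1]) ▸ h.2 x hx⟩

theorem nonneg (h : AbsMono b φ) {s : ℝ} (hs : 1 < s) (hs2 : s ≤ 2) : 0 ≤ φ s := by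
  have := h.2 (2 - s) ⟨by linarith, by linarith⟩
  rw [sub_sub_cancel] at this
  exact this.nonneg fun m ↦ mul_nonneg (h.1 m) (pow_nonneg (by linarith) _)

theorem apply_two (h : AbsMono b φ) : φ 2 = b 0 := by
  have := h.2 0 (by simp)
  rw [sub_zero] at this
  refine this.unique ?_
  convert hasSum_single 0 fun m hm ↦ ?_
  · simp
  · simp [hm]

theorem one : AbsMono (fun m ↦ if m = 0 then 1 else 0) (fun _ ↦ 1) := by
  refine ⟨fun m ↦ by dsimp only; split_ifs <;> norm_num, fun x _ ↦ ?_⟩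
  convert hasSum_single 0 fun m hm ↦ ?_
  · simp
  · simp [hm]

theorem mul (h : AbsMono b φ) (h' : AbsMono b' φ') :
    AbsMono (fun n ↦ ∑ kl ∈ Finset.HasAntidiagonal.antidiagonal n, b kl.1 * b' kl.2)
      (fun s ↦ φ s * φ' s) := by
  refine ⟨fun m ↦ Finset.sum_nonneg fun _ _ ↦ mul_nonneg (h.1 _) (h'.1 _), fun x hx ↦ ?_⟩
  have h1 := h.2 x hx
  have h2 := h'.2 x hx
  have hs : Summable fun p : ℕ × ℕ ↦ (b p.1 * x ^ p.1) * (b' p.2 * x ^ p.2) :=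
    h1.summable.mul_of_nonneg (f := fun m ↦ b m * x ^ m) (g := fun m ↦ b' m * x ^ m) h2.summable
      (fun m ↦ mul_nonneg (h.1 m) (pow_nonneg hx.1 _))
      (fun m ↦ mul_nonneg (h'.1 m) (pow_nonneg hx.1 _))
  have h3 := (summable_sum_mul_antidiagonal_of_summable_mul
    (f := fun m ↦ b m * x ^ m) (g := fun m ↦ b' m * x ^ m) hs).hasSum
  rw [← h1.summable.tsum_mul_tsum_eq_tsum_sum_antidiagonal h2.summable hs,
    h1.tsum_eq, h2.tsum_eq] at h3
  have h4 : (fun n ↦ (∑ kl ∈ Finset.HasAntidiagonal.antidiagonal n, b kl.1 * b' kl.2) * x ^ n) =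
      fun n ↦ ∑ kl ∈ Finset.HasAntidiagonal.antidiagonal n,
        (b kl.1 * x ^ kl.1) * (b' kl.2 * x ^ kl.2) := by
    funext n
    rw [Finset.sum_mul]
    refine Finset.sum_congr rfl fun p hp ↦ ?_
    rw [← Finset.HasAntidiagonal.mem_antidiagonal.1 hp, pow_add]
    ring
  dsimp only
  rw [h4]
  exact h3

theorem pow (h : AbsMono b φ) (k : ℕ) : ∃ c, AbsMono c (fun s ↦ φ s ^ k) := by
  induction k with
  | zero => exact ⟨_, by simpa using one⟩
  | succ k ih =>
    obtain ⟨c, hc⟩ := ih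
    exact ⟨_, by simpa only [pow_succ] using hc.mul h⟩

theorem const_mul (h : AbsMono b φ) {a : ℝ} (ha : 0 ≤ a) :
    AbsMono (fun m ↦ a * b m) (fun s ↦ a * φ s) :=
  ⟨fun m ↦ mul_nonneg ha (h.1 m), fun x hx ↦ by
    simpa only [mul_assoc] using (h.2 x hx).mul_left a⟩

theorem hasSum {ι : Type*} {b : ι → ℕ → ℝ} {φ : ι → ℝ → ℝ} (h : ∀ i, AbsMono (b i) (φ i))
    {ψ : ℝ → ℝ} (hψ : ∀ s, 1 < s → s ≤ 2 → HasSum (fun i ↦ φ i s) (ψ s)) :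
    AbsMono (fun m ↦ ∑' i, b i m) ψ := by
  refine ⟨fun m ↦ tsum_nonneg fun i ↦ (h i).1 m, fun x hx ↦ ?_⟩
  have hpos : ∀ y ∈ Set.Ico (0 : ℝ) 1, ∀ p : ι × ℕ, 0 ≤ b p.1 p.2 * y ^ p.2 := fun y hy p ↦
    mul_nonneg ((h p.1).1 p.2) (pow_nonneg hy.1 _)
  have hs : ∀ y ∈ Set.Ico (0 : ℝ) 1, Summable fun p : ι × ℕ ↦ b p.1 p.2 * y ^ p.2 := by
    intro y hy
    rw [summable_prod_of_nonneg (hpos y hy)]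
    refine ⟨fun i ↦ ((h i).2 y hy).summable, ?_⟩
    simp only [((h _).2 y hy).tsum_eq]
    exact (hψ (2 - y) (by linarith [hy.2]) (by linarith [hy.1])).summable
  have hsm : ∀ m, Summable fun i ↦ b i m := by
    intro m
    have h1 := ((hs 2⁻¹ ⟨by norm_num, by norm_num⟩).prod_symm.prod_factor m).mul_right (2 ^ m)
    refine h1.congr fun i ↦ ?_
    simp only [Prod.swap]
    rw [mul_assoc, ← mul_pow]; norm_num
  have h2 := (hs x hx).hasSum.prod_fiberwise fun i ↦ (h i).2 x hx
  have h3 := h2.unique (hψ (2 - x) (by linarith [hx.2]) (by linarith [hx.1]))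
  have h4 := (hs x hx).prod_symm.hasSum
  have h5 := h4.prod_fiberwise fun m ↦ (hsm m).hasSum.mul_right (x ^ m)
  have h6 : ∑' p : ℕ × ι, b p.swap.1 p.swap.2 * x ^ p.swap.2 = ψ (2 - x) := by
    rw [← h3]
    exact (Equiv.prodComm ℕ ι).tsum_eq fun p : ι × ℕ ↦ b p.1 p.2 * x ^ p.2
  rwa [h6] at h5

theorem exp (h : AbsMono b φ) : ∃ c, AbsMono c (fun s ↦ Real.exp (φ s)) ∧ 1 ≤ c 0 := by
  choose c hc using fun k ↦ h.pow k
  have h1 := hasSum (ψ := fun s ↦ Real.exp (φ s))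
    (fun k : ℕ ↦ (hc k).const_mul (a := ((k.factorial : ℝ))⁻¹) (by positivity)) (fun s _ _ ↦ by
      have := NormedSpace.expSeries_div_hasSum_exp (𝔸 := ℝ) (φ s)
      rw [← Real.exp_eq_exp_ℝ] at this
      simpa only [div_eq_inv_mul] using this)
  refine ⟨_, h1, ?_⟩
  rw [← h1.apply_two]
  exact Real.one_le_exp (h.nonneg (by norm_num) le_rfl)

theorem rpow {q : ℝ} (hq : 1 ≤ q) :
    AbsMono (fun m ↦ q ^ (-2 : ℝ) * (Real.log q ^ m / m.factorial)) (fun s ↦ q ^ (-s)) := by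
  have hq0 : 0 < q := by linarith
  refine ⟨fun m ↦ ?_, fun x _ ↦ ?_⟩
  · have := Real.log_nonneg hq
    positivity
  · have := (NormedSpace.expSeries_div_hasSum_exp (𝔸 := ℝ) (Real.log q * x)).mul_left
      (q ^ (-2 : ℝ))
    rw [← Real.exp_eq_exp_ℝ, ← Real.rpow_def_of_pos hq0, ← Real.rpow_add hq0] at this
    change HasSum _ (q ^ (-(2 - x)))
    rw [neg_sub, sub_eq_neg_add]
    refine this.congr_fun fun m ↦ ?_
    rw [mul_pow]; ring

/-- The exponential of a generalized Dirichlet series with nonnegative coefficients. -/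
theorem exp_dirichlet {ι : Type*} {c q : ι → ℝ} (hc : ∀ i, 0 ≤ c i) (hq : ∀ i, 1 ≤ q i)
    {ψ : ℝ → ℝ} (hψ : ∀ s, 1 < s → s ≤ 2 → HasSum (fun i ↦ c i * q i ^ (-s)) (ψ s)) :
    ∃ b, AbsMono b (fun s ↦ Real.exp (ψ s)) ∧ 1 ≤ b 0 :=
  (hasSum (fun i ↦ (rpow (hq i)).const_mul (hc i)) hψ).exp

end AbsMono

section Averaging

open MeasureTheory

variable {E : Type*} [AddCommGroup E] [MeasurableSpace E] [MeasurableAdd E]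
  {μ : Measure E} [μ.IsAddLeftInvariant] {Λ : Submodule ℤ E} [Countable Λ] {D : Set E}

theorem lintegral_tsum_indicator_lattice (hD : IsAddFundamentalDomain Λ D μ) {S : Set E}
    (hS : MeasurableSet S) :
    ∫⁻ x in D, ∑' v : Λ, S.indicator 1 ((v : E) + x) ∂μ = μ S := by
  have : MeasurableConstVAdd Λ E := ⟨fun c ↦ measurable_const_add (c : E)⟩
  have : VAddInvariantMeasure Λ E μ :=
    ⟨fun c s _ ↦ measure_preimage_add μ (c : E) s⟩
  rw [← lintegral_indicator_one hS, hD.lintegral_eq_tsum'', lintegral_tsum]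
  · rfl
  · intro v
    exact ((measurable_one.indicator hS).comp (measurable_const_add (v : E))).aemeasurable

variable {U A A' : Set E}

theorem tsum_indicator_lattice_mul_le (hD : IsAddFundamentalDomain Λ D μ)
    (hU : ∀ x : E, ∃ v ∈ Λ, x - v ∈ U) (hA' : MeasurableSet A')
    (hA : ∀ a ∈ A, ∀ u ∈ U, a + u ∈ A') :
    (∑' v : Λ, A.indicator 1 (v : E)) * μ D ≤ μ A' := by
  rw [← lintegral_tsum_indicator_lattice hD hA', ← Measure.restrict_apply_univ D, ← lintegral_const]
  refine lintegral_mono fun x ↦ ?_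
  obtain ⟨l, hl, hlU⟩ := hU x
  refine le_of_le_of_eq ?_ ((Equiv.subRight (⟨l, hl⟩ : Λ)).tsum_eq
    (fun v : Λ ↦ A'.indicator 1 ((v : E) + x)))
  refine ENNReal.tsum_le_tsum fun v ↦ ?_
  by_cases hv : (v : E) ∈ A
  · have : (v : E) - l + x ∈ A' := by
      convert hA _ hv _ hlU using 1; abel
    simp [hv, this]
  · simp [hv]

theorem le_tsum_indicator_lattice_mul (hD : IsAddFundamentalDomain Λ D μ)
    (hU : ∀ x : E, ∃ v ∈ Λ, x - v ∈ U) (hA' : MeasurableSet A')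
    (hA : ∀ a ∈ A', ∀ u ∈ U, a - u ∈ A) :
    μ A' ≤ (∑' v : Λ, A.indicator 1 (v : E)) * μ D := by
  rw [← lintegral_tsum_indicator_lattice hD hA', ← Measure.restrict_apply_univ D, ← lintegral_const]
  refine lintegral_mono fun x ↦ ?_
  obtain ⟨l, hl, hlU⟩ := hU x
  refine le_of_le_of_eq ?_ ((Equiv.addRight (⟨l, hl⟩ : Λ)).tsum_eq
    (fun v : Λ ↦ A.indicator 1 (v : E)))
  refine ENNReal.tsum_le_tsum fun v ↦ ?_
  by_cases hv : (v : E) + x ∈ A'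
  · have : (v : E) + l ∈ A := by
      convert hA _ hv _ hlU using 1; abel
    simp [hv, this]
  · simp [hv]

end Averaging

open NumberField NumberField.InfinitePlace

namespace NumberField

open mixedEmbedding MeasureTheory Module
open scoped Classical
open scoped nonZeroDivisors NNReal ENNReal

variable (L : Type*) [Field L] [NumberField L]

/-- Every point of the mixed space is within distance `Θ` of the lattice of integers, at all
places. -/
def IsCoveringBound (Θ : ℝ) : Prop :=
  1 ≤ Θ ∧ ∀ x : mixedSpace L, ∃ a : 𝓞 L, ∀ w, normAtPlace w (x - mixedEmbedding L a) < Θ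

/-- The box of points with `w`-coordinate less than `g w` for all places `w`. -/
def placeBox (g : InfinitePlace L → ℝ) : Set (mixedSpace L) := {x | ∀ w, normAtPlace w x < g w}

/-- The inverse covolume of the lattice of integers times the volume of the unit box. -/
noncomputable def boxDensity : ℝ :=
  2 ^ nrRealPlaces L * (2 * Real.pi) ^ nrComplexPlaces L / √|discr L|

theorem boxDensity_pos : 0 < boxDensity L := by
  have : 0 < |(discr L : ℝ)| := abs_pos.2 (by exact_mod_cast discr_ne_zero L)
  unfold boxDensity
  positivity

variable {L}

theorem placeBox_eq {K : Type*} [Field K] (g : InfinitePlace K → ℝ) (hg : ∀ w, 0 ≤ g w) :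
    placeBox K g = convexBodyLT K (fun w ↦ (g w).toNNReal) := by
  ext x
  simp only [placeBox, Set.mem_ofPred_eq, Set.mem_prod, Set.mem_pi, Set.mem_univ,
    forall_true_left, mem_ball_zero_iff, Subtype.forall, Real.coe_toNNReal _ (hg _)]
  constructor
  · intro h
    exact ⟨fun w hw ↦ by rw [← normAtPlace_apply_of_isReal hw]; exact h w,
      fun w hw ↦ by rw [← normAtPlace_apply_of_isComplex hw]; exact h w⟩
  · rintro ⟨h1, h2⟩ w
    obtain hw | hw := w.isReal_or_isComplex
    · rw [normAtPlace_apply_of_isReal hw]; exact h1 w hw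
    · rw [normAtPlace_apply_of_isComplex hw]; exact h2 w hw

theorem measurableSet_placeBox (g : InfinitePlace L → ℝ) : MeasurableSet (placeBox L g) := by
  have : placeBox L g = ⋂ w, {x | normAtPlace w x < g w} := by ext; simp [placeBox]
  rw [this]
  exact MeasurableSet.iInter fun w ↦
    (isOpen_lt (continuous_normAtPlace w) continuous_const).measurableSet

theorem volume_placeBox (g : InfinitePlace L → ℝ) (hg : ∀ w, 0 ≤ g w) :
    volume (placeBox L g) =
      ENNReal.ofReal (2 ^ nrRealPlaces L * Real.pi ^ nrComplexPlaces L * ∏ w, g w ^ mult w) := by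
  rw [placeBox_eq g hg, convexBodyLT_volume, ENNReal.ofReal_mul (by positivity),
    ENNReal.ofReal_prod_of_nonneg (fun w _ ↦ pow_nonneg (hg w) _),
    ENNReal.ofReal_mul (by positivity)]
  simp only [ENNReal.ofReal_pow (hg _)]
  rw [ENNReal.ofReal_pow (by norm_num), ENNReal.ofReal_pow Real.pi_pos.le]
  push_cast
  simp [ENNReal.ofReal, NNReal.pi, Real.toNNReal_of_nonneg Real.pi_pos.le]
  rfl

theorem volume_idealLattice (J : (Ideal (𝓞 L))⁰) :
    volume (ZSpan.fundamentalDomain (fractionalIdealLatticeBasis L (FractionalIdeal.mk0 L J))) =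
      ENNReal.ofReal (2 ^ nrRealPlaces L * Real.pi ^ nrComplexPlaces L *
        (Ideal.absNorm (J : Ideal (𝓞 L)) / boxDensity L)) := by
  rw [volume_fundamentalDomain_fractionalIdealLatticeBasis, volume_fundamentalDomain_latticeBasis,
    FractionalIdeal.coe_mk0, FractionalIdeal.coeIdeal_absNorm]
  have h1 : (2⁻¹ : ℝ≥0∞) ^ nrComplexPlaces L * (NNReal.sqrt ‖discr L‖₊ : ℝ≥0) =
      ENNReal.ofReal (2⁻¹ ^ nrComplexPlaces L * √|discr L|) := by
    rw [ENNReal.ofReal_mul (by positivity), ENNReal.ofReal_pow (by norm_num),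
      ENNReal.ofReal_inv_of_pos (by norm_num)]
    congr 2
    · simp
    · rw [← NNReal.coe_inj, Real.coe_toNNReal _ (Real.sqrt_nonneg _)]
      simp [Int.norm_eq_abs]
  rw [h1, ← ENNReal.ofReal_mul (by positivity)]
  congr 1
  have : 0 < |(discr L : ℝ)| := abs_pos.2 (by exact_mod_cast discr_ne_zero L)
  have := Real.sqrt_pos.2 this
  have := Real.pi_pos
  unfold boxDensity
  rw [mul_pow]
  field_simp
  simp

/-- `u ↦ α₀ u` transports the covering property of integers to an ideal containing `α₀`. -/
theorem IsCoveringBound.exists_mem_ideal {Θ : ℝ} (h : IsCoveringBound L Θ) (J : (Ideal (𝓞 L))⁰)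
    {a₀ : L} (ha₀ : a₀ ≠ 0) (hJ : a₀ ∈ (FractionalIdeal.mk0 L J : FractionalIdeal (𝓞 L)⁰ L))
    {g : InfinitePlace L → ℝ} (hg : ∀ w, w a₀ * Θ ≤ g w) (x : mixedSpace L) :
    ∃ v ∈ idealLattice L (FractionalIdeal.mk0 L J), x - v ∈ placeBox L g := by
  obtain ⟨a, ha⟩ := h.2 (mixedEmbedding L a₀⁻¹ * x)
  refine ⟨mixedEmbedding L (a₀ * a), ?_, fun w ↦ ?_⟩
  · rw [mem_idealLattice]
    refine ⟨_, ?_, rfl⟩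
    have := Submodule.smul_mem
      ((FractionalIdeal.mk0 L J : FractionalIdeal (𝓞 L)⁰ L) : Submodule (𝓞 L) L) a hJ
    rwa [Algebra.smul_def, mul_comm] at this
  · have h1 : x - mixedEmbedding L (a₀ * a) =
        mixedEmbedding L a₀ * (mixedEmbedding L a₀⁻¹ * x - mixedEmbedding L a) := by
      rw [mul_sub, ← mul_assoc, ← map_mul, mul_inv_cancel₀ ha₀, map_one, one_mul, map_mul]
    rw [h1, map_mul, normAtPlace_apply]
    refine lt_of_lt_of_le ?_ (hg w)
    have : 0 < w a₀ := pos_iff.2 ha₀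
    gcongr
    exact ha w

theorem prod_pow_mult_const (c : ℝ) : ∏ w : InfinitePlace L, c ^ mult w = c ^ finrank ℚ L := by
  rw [Finset.prod_pow_eq_pow_sum, sum_mult_eq]

/-- Number of lattice points of an ideal in a box, zero included. -/
theorem tsum_placeBox_bounds {Θ : ℝ} (h : IsCoveringBound L Θ) (J : (Ideal (𝓞 L))⁰)
    {g : InfinitePlace L → ℝ} (hg : ∀ w, 0 < g w) {a₀ : L} (ha₀ : a₀ ≠ 0)
    (hJ : a₀ ∈ (FractionalIdeal.mk0 L J : FractionalIdeal (𝓞 L)⁰ L)) {ε : ℝ} (hε : 0 ≤ ε)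
    (hε' : ∀ w, w a₀ * Θ ≤ ε * g w) :
    (∑' v : idealLattice L (FractionalIdeal.mk0 L J),
        (placeBox L g).indicator (1 : mixedSpace L → ℝ≥0∞) v) ≤
      ENNReal.ofReal (boxDensity L * ((∏ w, g w ^ mult w) / Ideal.absNorm (J : Ideal (𝓞 L))) *
        (1 + ε) ^ finrank ℚ L) ∧
    ENNReal.ofReal (boxDensity L * ((∏ w, g w ^ mult w) / Ideal.absNorm (J : Ideal (𝓞 L))) *
        (max (1 - ε) 0) ^ finrank ℚ L) ≤ ∑' v : idealLattice L (FractionalIdeal.mk0 L J),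
          (placeBox L g).indicator (1 : mixedSpace L → ℝ≥0∞) v := by
  have hD := fundamentalDomain_idealLattice L (FractionalIdeal.mk0 L J)
  have hU := h.exists_mem_ideal J ha₀ hJ hε'
  have hvol := volume_idealLattice J
  have hN : 0 < (Ideal.absNorm (J : Ideal (𝓞 L)) : ℝ) := by
    exact_mod_cast Ideal.absNorm_pos_of_nonZeroDivisors J
  have hd := boxDensity_pos L
  have hpi := Real.pi_pos
  set V : ℝ := 2 ^ nrRealPlaces L * Real.pi ^ nrComplexPlaces L *
        (Ideal.absNorm (J : Ideal (𝓞 L)) / boxDensity L) with hV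
  have hV0 : 0 < V := by positivity
  have hV1 : ENNReal.ofReal V ≠ 0 := by simpa using hV0
  have key : ∀ c : ℝ, 0 ≤ c → volume (placeBox L (fun w ↦ c * g w)) / ENNReal.ofReal V =
      ENNReal.ofReal (boxDensity L * ((∏ w, g w ^ mult w) / Ideal.absNorm (J : Ideal (𝓞 L))) *
        c ^ finrank ℚ L) := by
    intro c hc
    rw [volume_placeBox _ (fun w ↦ mul_nonneg hc (hg w).le), ← ENNReal.ofReal_div_of_pos hV0]
    congr 1
    simp only [mul_pow, Finset.prod_mul_distrib, prod_pow_mult_const]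
    rw [hV]
    field_simp
  constructor
  · rw [← key _ (by positivity), ENNReal.le_div_iff_mul_le (Or.inl hV1)
        (Or.inl ENNReal.ofReal_ne_top),
      ← hvol]
    refine tsum_indicator_lattice_mul_le hD hU (measurableSet_placeBox _) fun a ha u hu w ↦ ?_
    have h1 := normAtPlace_add_le w a u
    have h2 := ha w
    have h3 := hu w
    linarith
  · rw [← key _ (le_max_right _ _)]
    refine ENNReal.div_le_of_le_mul ?_
    rw [← hvol]
    refine le_tsum_indicator_lattice_mul hD hU (measurableSet_placeBox _) fun a ha u hu w ↦ ?_
    have h1 := normAtPlace_add_le w a (-u)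
    rw [normAtPlace_neg, ← sub_eq_add_neg] at h1
    have h2 := ha w
    have h3 := hu w
    rcases le_total (1 - ε) 0 with h4 | h4
    · rw [max_eq_right h4] at h2
      have := normAtPlace_nonneg w a
      linarith
    · rw [max_eq_left h4] at h2
      linarith

theorem IsCoveringBound.one_le_boxDensity {Θ : ℝ} (h : IsCoveringBound L Θ) :
    1 ≤ boxDensity L * (2 * Θ) ^ finrank ℚ L := by
  have h0 : 0 < Θ := by linarith [h.1]
  have := (tsum_placeBox_bounds (g := fun _ ↦ Θ) h 1 (fun _ ↦ h0) (one_ne_zero (α := L))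
    (by simp) (ε := 1) zero_le_one (fun w ↦ by simp)).1
  rw [show (1 : ℝ) + 1 = 2 by norm_num, prod_pow_mult_const] at this
  have h2 : (1 : ℝ≥0∞) ≤ ∑' v : idealLattice L (FractionalIdeal.mk0 L 1),
        (placeBox L fun _ ↦ Θ).indicator (1 : mixedSpace L → ℝ≥0∞) v := by
    refine le_trans ?_ (ENNReal.le_tsum 0)
    simp [placeBox, h0]
  have h3 := h2.trans this
  rw [ENNReal.one_le_ofReal] at h3
  simp only [Submonoid.coe_one, Ideal.one_eq_top, Ideal.absNorm_top, Nat.cast_one, div_one] at h3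
  rwa [mul_pow, mul_comm (2 ^ _), ← mul_assoc]

/-- The number of nonzero elements of `J` in the box attached to `g`. -/
noncomputable def boxCount (J : Ideal (𝓞 L)) (g : InfinitePlace L → ℝ) : ℝ≥0∞ :=
  ∑' α : 𝓞 L, if α ∈ J ∧ α ≠ 0 ∧ ∀ w : InfinitePlace L, w α < g w then 1 else 0

theorem tsum_placeBox_eq (J : (Ideal (𝓞 L))⁰) {g : InfinitePlace L → ℝ} (hg : ∀ w, 0 < g w) :
    ∑' v : idealLattice L (FractionalIdeal.mk0 L J),
      (placeBox L g).indicator (1 : mixedSpace L → ℝ≥0∞) v = 1 + boxCount (J : Ideal (𝓞 L)) g := by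
  let e : {α : 𝓞 L // α ∈ (J : Ideal (𝓞 L))} → idealLattice L (FractionalIdeal.mk0 L J) :=
    fun α ↦ ⟨mixedEmbedding L (α : 𝓞 L), (mem_idealLattice L _).2
      ⟨_, by simp, rfl⟩⟩
  have he : Function.Bijective e := by
    constructor
    · intro a b hab
      have := (mixedEmbedding_injective L) (congrArg Subtype.val hab)
      exact Subtype.ext (RingOfIntegers.ext this)
    · rintro ⟨v, hv⟩
      obtain ⟨y, hy, rfl⟩ := (mem_idealLattice L _).1 hv
      rw [FractionalIdeal.coe_mk0] at hy
      obtain ⟨α, hα, rfl⟩ := (FractionalIdeal.mem_coeIdeal _).1 hy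
      exact ⟨⟨α, hα⟩, rfl⟩
  rw [← (Equiv.ofBijective e he).tsum_eq, boxCount,
    ← tsum_ite_eq (0 : 𝓞 L) (fun _ ↦ (1 : ℝ≥0∞)), ← ENNReal.tsum_add]
  have h1 := tsum_subtype {α : 𝓞 L | α ∈ (J : Ideal (𝓞 L))}
    (fun α ↦ (placeBox L g).indicator (1 : mixedSpace L → ℝ≥0∞) (mixedEmbedding L α))
  refine h1.trans (tsum_congr fun α ↦ ?_)
  by_cases h0 : α = 0
  · simp [h0, placeBox, hg]
  · by_cases hJ : α ∈ (J : Ideal (𝓞 L))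
    · simp [h0, hJ, Set.indicator_apply, placeBox]
    · simp [h0, hJ]

/-- The number of nonzero points of an ideal in a box, with a power saving error term. -/
theorem boxCount_bounds {Θ : ℝ} (h : IsCoveringBound L Θ) (J : (Ideal (𝓞 L))⁰)
    {g : InfinitePlace L → ℝ} (hg : ∀ w, 0 < g w) {u : ℝ}
    (hu : (∏ w, g w ^ mult w) / Ideal.absNorm (J : Ideal (𝓞 L)) = u) (hu1 : 1 ≤ u) {P : ℝ}
    (hP : P = (finrank ℚ L + 1) * (7 * Θ ^ 2) ^ finrank ℚ L) :
    boxCount (J : Ideal (𝓞 L)) g ≤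
      ENNReal.ofReal (boxDensity L * (u + P * u ^ (1 - (finrank ℚ L : ℝ)⁻¹))) ∧
    ENNReal.ofReal (boxDensity L * (u - P * u ^ (1 - (finrank ℚ L : ℝ)⁻¹))) ≤
      boxCount (J : Ideal (𝓞 L)) g := by
  set n := finrank ℚ L with hn
  have hn0 : n ≠ 0 := finrank_pos.ne'
  have hn1 : (1 : ℝ) ≤ n := by exact_mod_cast finrank_pos
  set a := boxDensity L with ha
  have ha0 : 0 < a := boxDensity_pos L
  have hΘ := h.1
  have hu0 : 0 < u := by linarith
  have hN : 0 < (Ideal.absNorm (J : Ideal (𝓞 L)) : ℝ) := by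
    exact_mod_cast Ideal.absNorm_pos_of_nonZeroDivisors J
  set δ : ℝ := u ^ (-(n : ℝ)⁻¹) with hδ
  have hδ0 : 0 < δ := by positivity
  have hδ1 : δ ≤ 1 := Real.rpow_le_one_of_one_le_of_nonpos hu1 (by simp)
  have hδn : u * δ ^ n = 1 := by
    rw [hδ, ← Real.rpow_natCast, ← Real.rpow_mul hu0.le, neg_mul, inv_mul_cancel₀ (by positivity),
      Real.rpow_neg_one, mul_inv_cancel₀ hu0.ne']
  have huδ : u ^ (1 - (n : ℝ)⁻¹) = u * δ := by
    rw [sub_eq_add_neg, Real.rpow_add hu0, Real.rpow_one]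
  have had : 1 ≤ a * (2 * Θ) ^ n := h.one_le_boxDensity
  set ρ := 6 * Θ * δ with hρ
  have hρ0 : 0 < ρ := by positivity
  obtain ⟨a₀, ha₀J, ha₀, ha₀g⟩ : ∃ a₀ ∈ ((FractionalIdeal.mk0 L J : FractionalIdeal (𝓞 L)⁰ L)),
      a₀ ≠ 0 ∧ ∀ w : InfinitePlace L, w a₀ < ((ρ * g w).toNNReal : ℝ) := by
    refine exists_ne_zero_mem_ideal_lt L (FractionalIdeal.mk0 L J) ?_
    rw [← placeBox_eq _ (fun w ↦ mul_nonneg hρ0.le (hg w).le),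
      volume_placeBox _ (fun w ↦ mul_nonneg hρ0.le (hg w).le), minkowskiBound, volume_idealLattice,
      mixedEmbedding.finrank, ← hn, ← ENNReal.ofReal_ofNat, ← ENNReal.ofReal_pow (by norm_num),
      ← ENNReal.ofReal_mul (by positivity)]
    simp only [mul_pow, Finset.prod_mul_distrib, prod_pow_mult_const, ← hn]
    rw [div_eq_iff hN.ne'] at hu
    rw [hu]
    have h3 : (2 : ℝ) ^ n < 3 ^ n := by gcongr; norm_num
    have h4 : a⁻¹ ≤ (2 * Θ) ^ n := by
      rw [inv_le_iff_one_le_mul₀ ha0, mul_comm]; exact had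
    have h5 : a⁻¹ * 2 ^ n < ρ ^ n * u := by
      have : ρ ^ n * u = 3 ^ n * (2 * Θ) ^ n * (u * δ ^ n) := by
        rw [hρ, ← mul_pow, mul_pow _ δ]; ring
      rw [this, hδn, mul_one, mul_comm]
      calc 2 ^ n * a⁻¹ < 3 ^ n * a⁻¹ := by gcongr
        _ ≤ _ := by gcongr
    have hpi := Real.pi_pos
    have hC : 0 < (2 : ℝ) ^ nrRealPlaces L * Real.pi ^ nrComplexPlaces L *
      Ideal.absNorm (J : Ideal (𝓞 L)) := by positivity
    refine (ENNReal.ofReal_lt_ofReal_iff (by positivity)).2 ?_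
    have := mul_lt_mul_of_pos_left h5 hC
    rw [div_eq_mul_inv]
    refine lt_of_eq_of_lt ?_ (lt_of_lt_of_eq this ?_) <;> ring
  set M := 6 * Θ ^ 2 with hM
  have hM1 : 6 ≤ M := by nlinarith
  have hMP : (n : ℝ) * (1 + M) ^ n + (2 * Θ) ^ n ≤ P := by
    have h1 : 1 + M ≤ 7 * Θ ^ 2 := by nlinarith
    have h2 : 2 * Θ ≤ 7 * Θ ^ 2 := by nlinarith
    rw [hP, add_mul, one_mul]
    gcongr
  have hε' : ∀ w, w a₀ * Θ ≤ M * δ * g w := by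
    intro w
    have h1 := ha₀g w
    rw [Real.coe_toNNReal _ (mul_nonneg hρ0.le (hg w).le)] at h1
    calc w a₀ * Θ ≤ ρ * g w * Θ := by gcongr
      _ = _ := by rw [hρ, hM]; ring
  obtain ⟨hub, hlb⟩ := tsum_placeBox_bounds h J hg ha₀ ha₀J (ε := M * δ) (by positivity) hε'
  rw [tsum_placeBox_eq J hg, hu] at hub hlb
  rw [huδ]
  constructor
  · refine (le_add_self.trans hub).trans (ENNReal.ofReal_le_ofReal ?_)
    have h1 : (1 + M * δ) ^ n ≤ 1 + P * δ := by
      have h2 := (convexOn_pow n).2 (x := 1) (y := 1 + M) (by simp) (by simp; linarith)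
        (sub_nonneg.2 hδ1) hδ0.le (by ring)
      simp only [smul_eq_mul] at h2
      have h3 : (1 + M) ^ n ≤ P := by
        refine le_trans ?_ hMP
        have : 0 ≤ (2 * Θ) ^ n := by positivity
        have : 0 ≤ (1 + M) ^ n := by positivity
        nlinarith
      calc (1 + M * δ) ^ n = ((1 - δ) * 1 + δ * (1 + M)) ^ n := by congr 1; ring
        _ ≤ _ := h2
        _ ≤ 1 + P * δ := by rw [one_pow]; nlinarith
    calc a * u * (1 + M * δ) ^ n ≤ a * u * (1 + P * δ) := by gcongr
      _ = _ := by ring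
  · have h1 : 1 - n * (M * δ) ≤ (max (1 - M * δ) 0) ^ n := by
      rcases le_total (1 - M * δ) 0 with h2 | h2
      · rw [max_eq_right h2, zero_pow hn0]; nlinarith
      · rw [max_eq_left h2]
        have := one_add_mul_le_pow (a := -(M * δ)) (by linarith) n
        rw [← sub_eq_add_neg] at this
        linarith
    have h2 : a * (u - P * (u * δ)) ≤ a * u * (max (1 - M * δ) 0) ^ n - 1 := by
      have h3 : 1 ≤ u * δ := by
        rw [← huδ]
        exact Real.one_le_rpow hu1 (by rw [sub_nonneg]; exact inv_le_one_of_one_le₀ hn1)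
      have h4 : 1 ≤ a * (2 * Θ) ^ n * (u * δ) := one_le_mul_of_one_le_of_one_le had h3
      have h5 : M ≤ (1 + M) ^ n := by
        have := le_self_pow₀ (a := 1 + M) (by linarith) hn0
        linarith
      have h6 : n * M + (2 * Θ) ^ n ≤ P := le_trans (by gcongr) hMP
      have h7 : a * (u * δ) * (n * M + (2 * Θ) ^ n) ≤ a * (u * δ) * P := by gcongr
      have h8 : a * u * (1 - n * (M * δ)) ≤ a * u * (max (1 - M * δ) 0) ^ n := by gcongr
      nlinarith
    refine (ENNReal.ofReal_le_ofReal h2).trans ?_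
    rw [ENNReal.ofReal_sub _ zero_le_one, ENNReal.ofReal_one]
    exact tsub_le_iff_left.2 hlb

theorem absNorm_span_eq_prod (α : 𝓞 L) :
    (Ideal.absNorm (Ideal.span {α}) : ℝ) = ∏ w : InfinitePlace L, w (α : L) ^ mult w := by
  rw [prod_eq_abs_norm, Ideal.absNorm_span_singleton, ← Algebra.coe_norm_int]
  simp

end NumberField

section Unfolding

open MeasureTheory

theorem tsum_lintegral_sub_addMonoidHom {A E : Type*} [AddCommGroup A] [AddCommGroup E]
    [MeasurableSpace E] [MeasurableAdd E] {μ : Measure E} [μ.IsAddLeftInvariant]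
    {Λ : Submodule ℤ E} [Countable Λ] {D : Set E} (hD : IsAddFundamentalDomain Λ D μ)
    (f : A →+ E) (hf : ∀ x, x ∈ Λ ↔ ∃ a, f a = x) (φ : E → ENNReal) :
    ∑' a, ∫⁻ y in D, φ (y - f a) ∂μ = ENat.card f.ker * ∫⁻ y, φ y ∂μ := by
  have : MeasurableConstVAdd Λ E := ⟨fun c ↦ measurable_const_add (c : E)⟩
  have : VAddInvariantMeasure Λ E μ :=
    ⟨fun c s _ ↦ measure_preimage_add μ (c : E) s⟩
  let f' : A → Λ := fun a ↦ ⟨f a, (hf _).2 ⟨a, rfl⟩⟩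
  rw [hD.lintegral_eq_tsum', ← (Equiv.sigmaFiberEquiv f').tsum_eq, ENNReal.tsum_sigma',
    ← ENNReal.tsum_mul_left]
  refine tsum_congr fun v ↦ ?_
  obtain ⟨a₀, ha₀⟩ := (hf v).1 v.2
  have h1 : ∀ x : {a // f' a = v}, ∫⁻ y in D, φ (y - f (Equiv.sigmaFiberEquiv f' ⟨v, x⟩)) ∂μ =
      ∫⁻ y in D, φ (-v +ᵥ y) ∂μ := by
    rintro ⟨x, rfl⟩
    refine lintegral_congr fun y ↦ ?_
    congr 1
    simp only [Equiv.sigmaFiberEquiv_apply, Submodule.vadd_def, vadd_eq_add, f',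
      Submodule.coe_neg]
    abel
  let e : {a // f' a = v} ≃ f.ker :=
    { toFun := fun x ↦ ⟨x.1 - a₀, by
        have : f x.1 = v := congrArg Subtype.val x.2
        simp [AddMonoidHom.mem_ker, this, ha₀]⟩
      invFun := fun k ↦ ⟨k.1 + a₀, by
        have : f k.1 = 0 := k.2
        exact Subtype.ext (by simp [f', this, ha₀])⟩
      left_inv := fun x ↦ by simp
      right_inv := fun x ↦ by simp }
  rw [tsum_congr h1, ENNReal.tsum_const, ENat.card_congr e]

end Unfolding

open NumberField NumberField.InfinitePlace

namespace NumberField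

open mixedEmbedding MeasureTheory Module NumberField.Units
  NumberField.Units.dirichletUnitTheorem
open scoped Classical
open scoped nonZeroDivisors NNReal ENNReal

variable {L : Type*} [Field L] [NumberField L]

/-- The logarithmic vector of `x`, omitting the distinguished place. -/
noncomputable def logVec (x : L) : logSpace L := fun w ↦ mult w.1 * Real.log (w.1 x)

/-- Side lengths of a box of volume parameter `exp T` in the direction `y`. -/
noncomputable def expBox (T : ℝ) (y : logSpace L) (w : InfinitePlace L) : ℝ :=
  Real.exp ((if h : w = w₀ then T - ∑ i, y i else y ⟨w, h⟩) / mult w)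

theorem expBox_pos (T : ℝ) (y : logSpace L) (w : InfinitePlace L) : 0 < expBox T y w :=
  Real.exp_pos _

theorem prod_expBox (T : ℝ) (y : logSpace L) :
    ∏ w, expBox T y w ^ mult w = Real.exp T := by
  have h1 : ∀ w : InfinitePlace L, expBox T y w ^ mult w =
      Real.exp (if h : w = w₀ then T - ∑ i, y i else y ⟨w, h⟩) := by
    intro w
    have : (mult w : ℝ) ≠ 0 := by exact_mod_cast mult_pos.ne'
    rw [expBox, ← Real.exp_nat_mul, mul_div_cancel₀ _ this]
  rw [Finset.prod_congr rfl fun w _ ↦ h1 w, ← Real.exp_sum,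
    Fintype.sum_eq_add_sum_subtype_ne _ (w₀ : InfinitePlace L)]
  congr 1
  simp only [dite_true]
  rw [Finset.sum_congr rfl fun (i : {w : InfinitePlace L // w ≠ w₀}) _ ↦ dif_neg i.2]
  simp

/-- The indicator function of the open simplex of size `a`. -/
noncomputable def simplexInd {ι : Type*} [Fintype ι] (a : ℝ) (z : ι → ℝ) : ℝ≥0∞ :=
  if (∀ i, 0 < z i) ∧ ∑ i, z i < a then 1 else 0

theorem measurable_simplexInd {ι : Type*} [Fintype ι] :
    Measurable fun p : ℝ × (ι → ℝ) ↦ simplexInd p.1 p.2 := by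
  refine Measurable.ite ?_ measurable_const measurable_const
  have h1 : MeasurableSet {p : ℝ × (ι → ℝ) | ∀ i, 0 < p.2 i} := by
    simp only [Set.ofPred_forall]
    exact MeasurableSet.iInter fun i ↦ measurableSet_lt measurable_const (by fun_prop)
  have h2 : MeasurableSet {p : ℝ × (ι → ℝ) | ∑ i, p.2 i < p.1} :=
    measurableSet_lt (by fun_prop) (by fun_prop)
  exact h1.inter h2

theorem lt_expBox_iff (T : ℝ) (y : logSpace L) {α : 𝓞 L} (hα : α ≠ 0) :
    (∀ w : InfinitePlace L, w α < expBox T y w) ↔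
      (∀ i, 0 < (y - logVec (α : L)) i) ∧ ∑ i, (y - logVec (α : L)) i <
        T - Real.log (Ideal.absNorm (Ideal.span {α})) := by
  have hα' : (α : L) ≠ 0 := RingOfIntegers.coe_ne_zero_iff.2 hα
  have hpos : ∀ w : InfinitePlace L, 0 < w (α : L) := fun w ↦ pos_iff.2 hα'
  have hm : ∀ w : InfinitePlace L, (0 : ℝ) < mult w := fun w ↦ by exact_mod_cast mult_pos
  have hlog : Real.log (Ideal.absNorm (Ideal.span {α})) =
      mult (w₀ : InfinitePlace L) * Real.log ((w₀ : InfinitePlace L) α) +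
        ∑ i, logVec (α : L) i := by
    rw [absNorm_span_eq_prod, Real.log_prod fun w _ ↦ (pow_pos (hpos w) _).ne',
      Fintype.sum_eq_add_sum_subtype_ne _ (w₀ : InfinitePlace L)]
    simp [Real.log_pow, logVec]
  have h1 : ∀ (w : InfinitePlace L), w α < expBox T y w ↔
      mult w * Real.log (w α) < (if h : w = w₀ then T - ∑ i, y i else y ⟨w, h⟩) := by
    intro w
    rw [expBox, ← Real.log_lt_iff_lt_exp (hpos w), lt_div_iff₀ (hm w), mul_comm]
  constructor
  · intro h
    refine ⟨fun i ↦ ?_, ?_⟩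
    · have := (h1 i).1 (h i)
      rw [dif_neg i.2] at this
      simpa [logVec] using this
    · have := (h1 w₀).1 (h w₀)
      rw [dif_pos rfl] at this
      simp only [Pi.sub_apply, Finset.sum_sub_distrib]
      linarith
  · rintro ⟨h2, h3⟩ w
    rw [h1]
    split_ifs with hw
    · subst hw
      simp only [Pi.sub_apply, Finset.sum_sub_distrib] at h3
      linarith
    · simpa [logVec] using h2 ⟨w, hw⟩

theorem boxCount_expBox (J : Ideal (𝓞 L)) (T : ℝ) (y : logSpace L) :
    boxCount J (expBox T y) = ∑' α : 𝓞 L, if α ∈ J ∧ α ≠ 0 then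
      simplexInd (T - Real.log (Ideal.absNorm (Ideal.span {α}))) (y - logVec (α : L)) else 0 := by
  refine tsum_congr fun α ↦ ?_
  by_cases h : α ∈ J ∧ α ≠ 0
  · rw [if_pos h, simplexInd]
    simp only [h.1, ← lt_expBox_iff T y h.2, true_and]
    simp [h.2]
  · rw [if_neg h, if_neg fun h' ↦ h ⟨h'.1, h'.2.1⟩]

variable (L) in
/-- Representatives of the ideal classes. -/
theorem exists_classRep : ∃ J : ClassGroup (𝓞 L) → (Ideal (𝓞 L))⁰, ∀ c, ClassGroup.mk0 (J c) = c :=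
  ⟨fun c ↦ (ClassGroup.mk0_surjective c).choose,
    fun c ↦ (ClassGroup.mk0_surjective c).choose_spec⟩

theorem tsum_class_element {J : ClassGroup (𝓞 L) → (Ideal (𝓞 L))⁰}
    (hJ : ∀ c, ClassGroup.mk0 (J c) = c) :
    ∃ γ : (Ideal (𝓞 L))⁰ → 𝓞 L, (∀ I, γ I ≠ 0) ∧
      (∀ I, Ideal.span {γ I} = (J (ClassGroup.mk0 I)⁻¹ * I : Ideal (𝓞 L))) ∧
      ∀ Φ : ClassGroup (𝓞 L) → 𝓞 L → ℝ≥0∞,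
        ∑ c, ∑' α : 𝓞 L, (if α ∈ (J c : Ideal (𝓞 L)) ∧ α ≠ 0 then Φ c α else 0) =
        ∑' I, ∑' ε : (𝓞 L)ˣ, Φ (ClassGroup.mk0 I)⁻¹ (ε * γ I) := by
  have h1 : ∀ I : (Ideal (𝓞 L))⁰, ∃ g : 𝓞 L, g ≠ 0 ∧
      Ideal.span {g} = (J (ClassGroup.mk0 I)⁻¹ * I : Ideal (𝓞 L)) := by
    intro I
    have : ClassGroup.mk0 (J (ClassGroup.mk0 I)⁻¹ * I) = 1 := by
      rw [map_mul, hJ, inv_mul_cancel]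
    rw [ClassGroup.mk0_eq_one_iff] at this
    obtain ⟨g, hg⟩ := this
    rw [Ideal.submodule_span_eq, Submonoid.coe_mul] at hg
    refine ⟨g, ?_, hg.symm⟩
    rintro rfl
    have h2 := nonZeroDivisors.coe_ne_zero (J (ClassGroup.mk0 I)⁻¹ * I)
    rw [Submonoid.coe_mul, hg] at h2
    simp at h2
  choose γ hγ0 hγ using h1
  refine ⟨γ, hγ0, hγ, fun Φ ↦ ?_⟩
  let A := {p : ClassGroup (𝓞 L) × 𝓞 L | p.2 ∈ (J p.1 : Ideal (𝓞 L)) ∧ p.2 ≠ 0}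
  let e : (Ideal (𝓞 L))⁰ × (𝓞 L)ˣ → A := fun p ↦
    ⟨((ClassGroup.mk0 p.1)⁻¹, p.2 * γ p.1), by
      refine ⟨Ideal.mul_mem_left _ _ (Ideal.mul_le_right (I := (p.1 : Ideal (𝓞 L))) ?_),
        mul_ne_zero p.2.ne_zero (hγ0 _)⟩
      rw [mul_comm, ← hγ]
      exact Ideal.mem_span_singleton_self _⟩
  have hspan : ∀ (ε : (𝓞 L)ˣ) I, Ideal.span {(ε : 𝓞 L) * γ I} =
      (J (ClassGroup.mk0 I)⁻¹ * I : Ideal (𝓞 L)) := by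
    intro ε I
    rw [← hγ, mul_comm, Ideal.span_singleton_mul_right_unit ε.isUnit]
  have he : Function.Bijective e := by
    constructor
    · rintro ⟨I, ε⟩ ⟨I', ε'⟩ h
      have h2 := congrArg (fun x : A ↦ x.1.1) h
      have h3 := congrArg (fun x : A ↦ x.1.2) h
      simp only [e] at h2 h3
      have h4 := (hspan ε I).symm.trans ((congrArg (fun x ↦ Ideal.span {x}) h3).trans (hspan ε' I'))
      rw [h2] at h4
      have h5 : I = I' := Subtype.ext (mul_left_cancel₀
        (nonZeroDivisors.coe_ne_zero (J (ClassGroup.mk0 I')⁻¹)) h4)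
      subst h5
      have h6 := mul_right_cancel₀ (hγ0 I) h3
      rw [Units.ext h6]
    · rintro ⟨⟨c, α⟩, hα, hα0⟩
      simp only at hα hα0
      obtain ⟨I, hI⟩ := Ideal.dvd_iff_le.2 ((Ideal.span_singleton_le_iff_mem _).2 hα)
      have hI0 : I ∈ (Ideal (𝓞 L))⁰ := by
        rw [mem_nonZeroDivisors_iff_ne_zero]
        rintro rfl
        simp [hα0] at hI
      have hc : (ClassGroup.mk0 ⟨I, hI0⟩)⁻¹ = c := by
        rw [inv_eq_iff_mul_eq_one, ← hJ c, mul_comm, ← map_mul, ClassGroup.mk0_eq_one_iff]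
        refine ⟨⟨α, ?_⟩⟩
        rw [Ideal.submodule_span_eq, Submonoid.coe_mul, hI]
      have h7 : Ideal.span {γ ⟨I, hI0⟩} = Ideal.span {α} := by
        rw [hγ, hc, hI]
      obtain ⟨u, hu⟩ := Ideal.span_singleton_eq_span_singleton.1 h7
      refine ⟨(⟨I, hI0⟩, u), Subtype.ext ?_⟩
      simp only [e, hc, mul_comm _ (γ _), hu]
  rw [← ENNReal.tsum_prod (f := fun I (ε : (𝓞 L)ˣ) ↦ Φ (ClassGroup.mk0 I)⁻¹ (ε * γ I)),
    ← tsum_fintype (L := .unconditional _), ← ENNReal.tsum_prod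
      (f := fun c α ↦ if α ∈ (J c : Ideal (𝓞 L)) ∧ α ≠ 0 then Φ c α else 0)]
  rw [show (∑' p : (Ideal (𝓞 L))⁰ × (𝓞 L)ˣ, Φ (ClassGroup.mk0 p.1)⁻¹ (p.2 * γ p.1)) =
    ∑' p, (fun q : A ↦ Φ q.1.1 q.1.2) (Equiv.ofBijective e he p) from rfl,
    Equiv.tsum_eq (Equiv.ofBijective e he) fun q : A ↦ Φ q.1.1 q.1.2,
    tsum_subtype A fun q ↦ Φ q.1 q.2]
  refine tsum_congr fun p ↦ ?_
  simp only [Set.indicator_apply, A, Set.mem_ofPred_eq]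

end NumberField

namespace NumberField

open mixedEmbedding MeasureTheory Module NumberField.InfinitePlace NumberField.Units
  NumberField.Units.dirichletUnitTheorem
open scoped Classical
open scoped nonZeroDivisors NNReal ENNReal

theorem simplexInd_of_nonpos {ι : Type*} [Fintype ι] {a : ℝ} (ha : a ≤ 0) (z : ι → ℝ) :
    simplexInd a z = 0 := by
  rw [simplexInd, if_neg]
  rintro ⟨h1, h2⟩
  have := Finset.sum_nonneg fun i (_ : i ∈ Finset.univ) ↦ (h1 i).le
  linarith

theorem measurable_simplexInd_sub {ι : Type*} [Fintype ι] (a : ℝ) (v : ι → ℝ) :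
    Measurable fun y : ι → ℝ ↦ simplexInd a (y - v) := by
  have hf : Measurable fun y : ι → ℝ ↦ (a, y - v) := by fun_prop
  exact measurable_simplexInd.comp hf

variable (L : Type*) [Field L] [NumberField L]

instance : Countable (𝓞 L) := (RingOfIntegers.basis L).equivFun.injective.countable

instance : Countable (Ideal (𝓞 L)) := by
  have h : Function.Surjective fun s : Finset (𝓞 L) ↦ Ideal.span (s : Set (𝓞 L)) :=
    fun I ↦ (IsNoetherian.noetherian I)
  exact h.countable

/-- Ideals counted by norm, with the smooth weight given by the volume of a simplex. -/
noncomputable def idealSmooth (t : ℝ) : ℝ≥0∞ :=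
  ∑' I : (Ideal (𝓞 L))⁰, ∫⁻ z : logSpace L,
    simplexInd (t - Real.log (Ideal.absNorm (I : Ideal (𝓞 L)))) z

variable {L}

theorem one_le_absNorm (I : (Ideal (𝓞 L))⁰) :
    (1 : ℝ) ≤ (Ideal.absNorm (I : Ideal (𝓞 L)) : ℝ) := by
  exact_mod_cast Ideal.absNorm_pos_of_nonZeroDivisors I

theorem idealSmooth_of_nonpos {t : ℝ} (ht : t ≤ 0) : idealSmooth L t = 0 := by
  rw [idealSmooth, ENNReal.tsum_eq_zero]
  intro I
  have := Real.log_nonneg (one_le_absNorm I)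
  simp [simplexInd_of_nonpos (show t - Real.log (Ideal.absNorm (I : Ideal (𝓞 L))) ≤ 0 by linarith)]

theorem logVec_unit_mul (ε : (𝓞 L)ˣ) {α : 𝓞 L} (hα : α ≠ 0) :
    logVec ((ε * α : 𝓞 L) : L) = logVec (α : L) + logEmbedding L (Additive.ofMul ε) := by
  have hα' : (α : L) ≠ 0 := RingOfIntegers.coe_ne_zero_iff.2 hα
  have hε : ((ε : 𝓞 L) : L) ≠ 0 := RingOfIntegers.coe_ne_zero_iff.2 ε.ne_zero
  ext w
  simp only [logVec, Pi.add_apply, logEmbedding_component, map_mul]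
  rw [Real.log_mul ((pos_iff.2 hε).ne') ((pos_iff.2 hα').ne')]
  ring

theorem card_ker_logEmbedding :
    (ENat.card (logEmbedding L).ker : ℝ≥0∞) = torsionOrder L := by
  have : ENat.card (torsion L).toAddSubgroup = ENat.card (torsion L) :=
    ENat.card_congr Additive.toMul
  rw [logEmbedding_ker, torsionOrder, this, ENat.card_eq_coe_natCard]
  simp

theorem tsum_units_lintegral {D : Set (logSpace L)}
    (hD : IsAddFundamentalDomain (unitLattice L) D) (φ : logSpace L → ℝ≥0∞) {α : 𝓞 L}
    (hα : α ≠ 0) :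
    ∑' ε : (𝓞 L)ˣ, ∫⁻ y in D, φ (y - logVec ((ε * α : 𝓞 L) : L)) =
      torsionOrder L * ∫⁻ y, φ y := by
  have hf : ∀ x, x ∈ unitLattice L ↔ ∃ a, logEmbedding L a = x := by
    exact fun x ↦ ⟨fun ⟨a, _, h⟩ ↦ ⟨a, h⟩, fun ⟨a, h⟩ ↦ ⟨a, trivial, h⟩⟩
  rw [← lintegral_sub_right_eq_self (μ := (volume : Measure (logSpace L))) _ (logVec (α : L)),
    ← card_ker_logEmbedding,
    ← tsum_lintegral_sub_addMonoidHom hD (logEmbedding L) hf fun z ↦ φ (z - logVec (α : L))]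
  refine Eq.trans ?_ (Equiv.tsum_eq (Additive.ofMul (α := (𝓞 L)ˣ)) _)
  refine tsum_congr fun ε ↦ lintegral_congr fun y ↦ ?_
  rw [logVec_unit_mul ε hα]
  congr 1
  abel

theorem torsionOrder_mul_idealSmooth {J : ClassGroup (𝓞 L) → (Ideal (𝓞 L))⁰}
    (hJ : ∀ c, ClassGroup.mk0 (J c) = c) {D : Set (logSpace L)}
    (hD : IsAddFundamentalDomain (unitLattice L) D) (t : ℝ) :
    torsionOrder L * idealSmooth L t = ∑ c, ∫⁻ y in D, boxCount (J c : Ideal (𝓞 L))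
      (expBox (t + Real.log (Ideal.absNorm (J c : Ideal (𝓞 L)))) y) := by
  obtain ⟨γ, hγ0, hγ, H⟩ := tsum_class_element hJ
  have h1 : ∀ c, ∫⁻ y in D, boxCount (J c : Ideal (𝓞 L))
      (expBox (t + Real.log (Ideal.absNorm (J c : Ideal (𝓞 L)))) y) =
      ∑' α : 𝓞 L, if α ∈ (J c : Ideal (𝓞 L)) ∧ α ≠ 0 then ∫⁻ y in D,
        simplexInd (t + Real.log (Ideal.absNorm (J c : Ideal (𝓞 L))) -
          Real.log (Ideal.absNorm (Ideal.span {α}))) (y - logVec (α : L)) else 0 := by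
    intro c
    simp only [boxCount_expBox]
    rw [lintegral_tsum]
    · refine tsum_congr fun α ↦ ?_
      split_ifs <;> simp
    · intro α
      split_ifs
      · exact (measurable_simplexInd_sub _ _).aemeasurable
      · exact measurable_const.aemeasurable
  simp only [h1]
  rw [H fun c α ↦ ∫⁻ y in D, simplexInd (t + Real.log (Ideal.absNorm (J c : Ideal (𝓞 L))) -
          Real.log (Ideal.absNorm (Ideal.span {α}))) (y - logVec (α : L)),
    idealSmooth, ← ENNReal.tsum_mul_left]
  refine tsum_congr fun I ↦ ?_
  have hN : ∀ ε : (𝓞 L)ˣ, t + Real.log (Ideal.absNorm (J (ClassGroup.mk0 I)⁻¹ : Ideal (𝓞 L))) -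
      Real.log (Ideal.absNorm (Ideal.span {(ε : 𝓞 L) * γ I})) =
      t - Real.log (Ideal.absNorm (I : Ideal (𝓞 L))) := by
    intro ε
    rw [mul_comm, Ideal.span_singleton_mul_right_unit ε.isUnit, hγ, map_mul, Nat.cast_mul,
      Real.log_mul (by linarith [one_le_absNorm (J (ClassGroup.mk0 I)⁻¹)])
        (by linarith [one_le_absNorm I])]
    ring
  simp only [hN]
  exact (tsum_units_lintegral hD _ (hγ0 I)).symm

theorem idealSmooth_bounds {Θ : ℝ} (h : IsCoveringBound L Θ) {P : ℝ}
    (hP : P = (finrank ℚ L + 1) * (7 * Θ ^ 2) ^ finrank ℚ L) {t : ℝ} (ht : 0 ≤ t) :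
    idealSmooth L t ≠ ∞ ∧
    |(idealSmooth L t).toReal - dedekindZeta_residue L * Real.exp t| ≤
      dedekindZeta_residue L * P * Real.exp ((1 - (finrank ℚ L : ℝ)⁻¹) * t) := by
  obtain ⟨J, hJ⟩ := exists_classRep L
  let D := ZSpan.fundamentalDomain ((basisUnitLattice L).ofZLatticeBasis ℝ (unitLattice L))
  have hD : IsAddFundamentalDomain (unitLattice L) D :=
    ZLattice.isAddFundamentalDomain (basisUnitLattice L) volume
  have hDv : volume D = ENNReal.ofReal (regulator L) := by
    have hfin : volume D ≠ ∞ := ((ZSpan.fundamentalDomain_isBounded _).measure_lt_top).ne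
    rw [regulator, ZLattice.covolume_eq_measure_fundamentalDomain _ _ hD, ofReal_measureReal hfin]
  set Q : ℝ := Real.exp ((1 - (finrank ℚ L : ℝ)⁻¹) * t) with hQ
  have hQ' : Real.exp t ^ (1 - (finrank ℚ L : ℝ)⁻¹) = Q := by
    rw [← Real.exp_mul, mul_comm]
  have hb : ∀ c y, _ := fun c y ↦ boxCount_bounds h (J c) (expBox_pos
    (t + Real.log (Ideal.absNorm (J c : Ideal (𝓞 L)))) y) (u := Real.exp t) (by
      have := one_le_absNorm (J c)
      rw [prod_expBox, Real.exp_add, Real.exp_log (by linarith), mul_div_cancel_right₀]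
      linarith) (Real.one_le_exp ht) hP
  rw [hQ'] at hb
  have key := torsionOrder_mul_idealSmooth hJ hD t
  have hw : 0 < (torsionOrder L : ℝ) := by exact_mod_cast (torsionOrder_pos L)
  have hR := regulator_pos L
  have ha := boxDensity_pos L
  set a := boxDensity L
  have hconst : ∀ B : ℝ, ∑ c : ClassGroup (𝓞 L), ∫⁻ y in D, ENNReal.ofReal (a * B) =
      ENNReal.ofReal (classNumber L * regulator L * a * B) := by
    intro B
    rw [Finset.sum_const, setLIntegral_const, hDv, ← ENNReal.ofReal_mul' hR.le,
      Finset.card_univ, nsmul_eq_mul, ← ENNReal.ofReal_natCast,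
      ← ENNReal.ofReal_mul (by positivity),
      classNumber]
    congr 1
    ring
  have hup : torsionOrder L * idealSmooth L t ≤
      ENNReal.ofReal (classNumber L * regulator L * a * (Real.exp t + P * Q)) := by
    rw [key, ← hconst]
    exact Finset.sum_le_sum fun c _ ↦ lintegral_mono fun y ↦ (hb c y).1
  have hlo : ENNReal.ofReal (classNumber L * regulator L * a * (Real.exp t - P * Q)) ≤
      torsionOrder L * idealSmooth L t := by
    rw [key, ← hconst]
    exact Finset.sum_le_sum fun c _ ↦ lintegral_mono fun y ↦ (hb c y).2
  have hfin : idealSmooth L t ≠ ∞ := by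
    intro h'
    rw [h', ENNReal.mul_top (by exact_mod_cast (torsionOrder_pos L).ne')] at hup
    exact ENNReal.ofReal_ne_top (top_le_iff.1 hup)
  refine ⟨hfin, ?_⟩
  have hκ : dedekindZeta_residue L * torsionOrder L = classNumber L * regulator L * a := by
    rw [dedekindZeta_residue_def]
    simp only [a, boxDensity]
    field_simp
  have hκ0 := dedekindZeta_residue_pos L
  set κ := dedekindZeta_residue L
  have hP0 : 0 ≤ P := by rw [hP]; have := h.1; positivity
  rw [← hκ, ← ENNReal.ofReal_toReal hfin, ← ENNReal.ofReal_natCast, ← ENNReal.ofReal_mul hw.le,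
    ] at hup hlo
  have hup' := (ENNReal.ofReal_le_ofReal_iff (by positivity)).1 hup
  have hlo' := (ENNReal.ofReal_le_ofReal_iff (by positivity)).1 hlo
  rw [abs_le]
  constructor <;> nlinarith
end NumberField

section Laplace

open MeasureTheory Set

theorem lintegral_exp_neg_mul_Ioi {s : ℝ} (hs : 0 < s) (c : ℝ) :
    ∫⁻ t in Ioi c, ENNReal.ofReal (Real.exp (-s * t)) =
      ENNReal.ofReal (s⁻¹ * Real.exp (-s * c)) := by
  have hneg : -s < 0 := by linarith
  rw [← ofReal_integral_eq_lintegral_ofReal (integrableOn_exp_mul_Ioi hneg c)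
    (Filter.Eventually.of_forall fun _ ↦ (Real.exp_pos _).le), integral_exp_mul_Ioi hneg]
  congr 1
  field_simp

theorem integrable_laplace {E : ℝ → ℝ} (hE : Measurable E) {P σ : ℝ}
    (hb : ∀ t, 0 < t → |E t| ≤ P * Real.exp (σ * t)) {s : ℂ} (hs : σ < s.re) :
    IntegrableOn (fun t : ℝ ↦ (E t : ℂ) * Complex.exp (-s * t)) (Ioi 0) := by
  refine Integrable.mono' ((integrableOn_exp_mul_Ioi (a := σ - s.re) (by linarith) 0).const_mul P)
    (by fun_prop) ?_
  refine (ae_restrict_iff' measurableSet_Ioi).2 (Filter.Eventually.of_forall fun t ht ↦ ?_)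
  have h1 : ‖Complex.exp (-s * t)‖ = Real.exp (-s.re * t) := by
    rw [Complex.norm_exp]; simp
  rw [norm_mul, h1, Complex.norm_real, Real.norm_eq_abs]
  refine (mul_le_mul_of_nonneg_right (hb t ht) (Real.exp_pos _).le).trans_eq ?_
  rw [mul_assoc, ← Real.exp_add]
  ring_nf

theorem norm_laplace_le {E : ℝ → ℝ} {P σ : ℝ}
    (hb : ∀ t, 0 < t → |E t| ≤ P * Real.exp (σ * t)) {s : ℂ} (hs : σ < s.re) :
    ‖∫ t in Ioi (0 : ℝ), (E t : ℂ) * Complex.exp (-s * t)‖ ≤ P / (s.re - σ) := by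
  have hint := (integrableOn_exp_mul_Ioi (a := σ - s.re) (by linarith) 0).const_mul P
  refine (norm_integral_le_of_norm_le hint ?_).trans_eq ?_
  · refine (ae_restrict_iff' measurableSet_Ioi).2 (Filter.Eventually.of_forall fun t ht ↦ ?_)
    have h1 : ‖Complex.exp (-s * t)‖ = Real.exp (-s.re * t) := by
      rw [Complex.norm_exp]; simp
    rw [norm_mul, h1, Complex.norm_real, Real.norm_eq_abs]
    refine (mul_le_mul_of_nonneg_right (hb t ht) (Real.exp_pos _).le).trans_eq ?_
    rw [mul_assoc, ← Real.exp_add]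
    ring_nf
  · rw [integral_const_mul, integral_exp_mul_Ioi (by linarith)]
    rw [mul_zero, Real.exp_zero, ← neg_sub s.re σ, neg_div_neg_eq]
    ring

theorem differentiableOn_laplace {E : ℝ → ℝ} (hE : Measurable E) {P σ : ℝ} (hP : 0 ≤ P)
    (hb : ∀ t, 0 < t → |E t| ≤ P * Real.exp (σ * t)) :
    DifferentiableOn ℂ (fun s ↦ ∫ t in Ioi (0 : ℝ), (E t : ℂ) * Complex.exp (-s * t))
      {s | σ < s.re} := by
  intro s₀ hs₀
  rw [mem_ofPred_eq] at hs₀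
  set d := (s₀.re - σ) / 4 with hd
  have hd0 : 0 < d := by rw [hd]; linarith
  have key := (hasDerivAt_integral_of_dominated_loc_of_deriv_le (𝕜 := ℂ)
    (μ := volume.restrict (Ioi (0 : ℝ))) (x₀ := s₀)
    (F := fun s t ↦ (E t : ℂ) * Complex.exp (-s * t))
    (F' := fun s t ↦ (E t : ℂ) * (Complex.exp (-s * t) * (-t)))
    (s := {s | σ + 2 * d < s.re}) (bound := fun t ↦ P * d⁻¹ * Real.exp (-d * t)) ?_ ?_ ?_ ?_ ?_ ?_
    ?_).2
  · exact key.differentiableAt.differentiableWithinAt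
  · exact (isOpen_lt continuous_const Complex.continuous_re).mem_nhds
      (by rw [mem_ofPred_eq, hd]; linarith)
  · exact Filter.Eventually.of_forall fun s ↦ by fun_prop
  · exact integrable_laplace hE hb hs₀
  · fun_prop
  · refine (ae_restrict_iff' measurableSet_Ioi).2 (Filter.Eventually.of_forall fun t ht s hs ↦ ?_)
    rw [mem_Ioi] at ht
    rw [mem_ofPred_eq] at hs
    have h1 : ‖Complex.exp (-s * t)‖ = Real.exp (-s.re * t) := by
      rw [Complex.norm_exp]; simp
    have h2 : t ≤ d⁻¹ * Real.exp (d * t) := by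
      rw [inv_mul_eq_div, le_div_iff₀ hd0]
      linarith [Real.add_one_le_exp (d * t)]
    rw [norm_mul, norm_mul, h1, norm_neg, Complex.norm_real, Complex.norm_real, Real.norm_eq_abs,
      Real.norm_eq_abs, abs_of_pos ht]
    calc |E t| * (Real.exp (-s.re * t) * t)
        ≤ (P * Real.exp (σ * t)) * (Real.exp (-s.re * t) * (d⁻¹ * Real.exp (d * t))) := by
          gcongr
          exact hb t ht
      _ = P * d⁻¹ * Real.exp (σ * t + -s.re * t + d * t) := by
          rw [Real.exp_add, Real.exp_add]; ring
      _ ≤ _ := by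
          gcongr
          nlinarith
  · exact ((integrableOn_exp_mul_Ioi (a := -d) (by linarith) 0).const_mul _)
  · refine Filter.Eventually.of_forall fun t s hs ↦ ?_
    have h1 : HasDerivAt (fun s : ℂ ↦ -s * (t : ℂ)) (-(t : ℂ)) s := by
      simpa using (hasDerivAt_id s).neg.mul_const (t : ℂ)
    exact (h1.cexp).const_mul _

end Laplace

namespace NumberField

open mixedEmbedding MeasureTheory Module NumberField.InfinitePlace NumberField.Units
  NumberField.Units.dirichletUnitTheorem
open scoped Classical
open scoped nonZeroDivisors NNReal ENNReal

theorem lintegral_laplace_simplexInd (ι : Type*) [Fintype ι] {s : ℝ} (hs : 0 < s) :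
    ∫⁻ t, ∫⁻ z : ι → ℝ, simplexInd t z * ENNReal.ofReal (Real.exp (-s * t)) =
      ENNReal.ofReal (s⁻¹ ^ (Fintype.card ι + 1)) := by
  rw [lintegral_lintegral_swap]
  swap
  · exact (measurable_simplexInd.mul (by fun_prop)).aemeasurable
  let g : ℝ → ℝ := (Set.Ioi 0).indicator fun x ↦ Real.exp (-s * x)
  have hg : Integrable g :=
    (integrable_indicator_iff measurableSet_Ioi).2 (integrableOn_exp_mul_Ioi (by linarith) 0)
  have hg0 : ∀ x, 0 ≤ g x := fun x ↦ Set.indicator_nonneg (fun _ _ ↦ (Real.exp_pos _).le) _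
  have hgi : ∫ x, g x = s⁻¹ := by
    rw [integral_indicator measurableSet_Ioi, integral_exp_mul_Ioi (by linarith)]
    simp [neg_div_neg_eq]
  have h1 : ∀ z : ι → ℝ, ∫⁻ t, simplexInd t z * ENNReal.ofReal (Real.exp (-s * t)) =
      ENNReal.ofReal (s⁻¹ * ∏ i, g (z i)) := by
    intro z
    by_cases hz : ∀ i, 0 < z i
    · have h2 : ∀ t, simplexInd t z * ENNReal.ofReal (Real.exp (-s * t)) =
          (Set.Ioi (∑ i, z i)).indicator (fun t ↦ ENNReal.ofReal (Real.exp (-s * t))) t := by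
        intro t
        by_cases ht : ∑ i, z i < t
        · simp [simplexInd, hz, ht]
        · simp [simplexInd, ht]
      have h3 : ∏ i, g (z i) = Real.exp (-s * ∑ i, z i) := by
        rw [Finset.mul_sum, Real.exp_sum]
        exact Finset.prod_congr rfl fun i _ ↦ Set.indicator_of_mem (hz i) _
      simp only [h2]
      rw [lintegral_indicator measurableSet_Ioi, lintegral_exp_neg_mul_Ioi hs, h3]
    · obtain ⟨i, hi⟩ := not_forall.1 hz
      have h3 : ∏ i, g (z i) = 0 :=
        Finset.prod_eq_zero (Finset.mem_univ i) (Set.indicator_of_notMem hi _)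
      simp [simplexInd, hz, h3]
  simp only [h1]
  rw [← ofReal_integral_eq_lintegral_ofReal, integral_const_mul,
    integral_fintype_prod_volume_eq_pow, hgi, pow_succ']
  · exact (Integrable.fintype_prod (fun _ ↦ hg)).const_mul _
  · exact Filter.Eventually.of_forall fun z ↦
      mul_nonneg (inv_pos.2 hs).le (Finset.prod_nonneg fun i _ ↦ hg0 _)

variable (L : Type*) [Field L] [NumberField L]

/-- The Dedekind zeta function on the real axis, as a sum over ideals. -/
noncomputable def idealZeta (s : ℝ) : ℝ :=
  ∑' I : (Ideal (𝓞 L))⁰, (Ideal.absNorm (I : Ideal (𝓞 L)) : ℝ) ^ (-s)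

theorem measurable_lintegral_simplexInd (ι : Type*) [Fintype ι] (c : ℝ) :
    Measurable fun t : ℝ ↦ ∫⁻ z : ι → ℝ, simplexInd (t - c) z := by
  have hf : Measurable fun p : ℝ × (ι → ℝ) ↦ (p.1 - c, p.2) := by fun_prop
  exact (measurable_simplexInd.comp hf).lintegral_prod_right'

theorem measurable_idealSmooth : Measurable (idealSmooth L) :=
  Measurable.tsum fun _ ↦ measurable_lintegral_simplexInd _ _

theorem card_compl_w₀ : Fintype.card {w : InfinitePlace L // w ≠ w₀} + 1 =
    Fintype.card (InfinitePlace L) := by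
  rw [Fintype.card_subtype_compl, Fintype.card_subtype_eq]
  exact Nat.sub_add_cancel Fintype.card_pos

theorem lintegral_laplace_idealSmooth {s : ℝ} (hs : 0 < s) :
    ∫⁻ t, idealSmooth L t * ENNReal.ofReal (Real.exp (-s * t)) =
      ∑' I : (Ideal (𝓞 L))⁰, ENNReal.ofReal ((Ideal.absNorm (I : Ideal (𝓞 L)) : ℝ) ^ (-s)) *
        ENNReal.ofReal (s⁻¹ ^ Fintype.card (InfinitePlace L)) := by
  simp only [idealSmooth, ← ENNReal.tsum_mul_right]
  rw [lintegral_tsum]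
  swap
  · exact fun I ↦ ((measurable_lintegral_simplexInd _ _).mul (by fun_prop)).aemeasurable
  refine tsum_congr fun I ↦ ?_
  have hN : 0 < (Ideal.absNorm (I : Ideal (𝓞 L)) : ℝ) := by linarith [one_le_absNorm I]
  set c := Real.log (Ideal.absNorm (I : Ideal (𝓞 L))) with hc
  rw [← card_compl_w₀, ← lintegral_laplace_simplexInd {w : InfinitePlace L // w ≠ w₀} hs,
    ← lintegral_sub_right_eq_self (μ := volume) (fun t ↦ ∫⁻ z : {w : InfinitePlace L // w ≠ w₀} → ℝ,
      simplexInd t z * ENNReal.ofReal (Real.exp (-s * t))) c, ← lintegral_const_mul']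
  · refine lintegral_congr fun t ↦ ?_
    rw [lintegral_mul_const' _ _ ENNReal.ofReal_ne_top, mul_left_comm,
      ← ENNReal.ofReal_mul (by positivity)]
    congr 2
    rw [Real.rpow_def_of_pos hN, ← hc, ← Real.exp_add]
    ring_nf
  · exact ENNReal.ofReal_ne_top

variable {L}

/-- The deviation of `idealSmooth` from its main term. -/
noncomputable def idealError (L : Type*) [Field L] [NumberField L] (t : ℝ) : ℝ :=
  (idealSmooth L t).toReal / dedekindZeta_residue L - Real.exp t

/-- The analytic continuation of `(s - 1) ζ(s)`. -/
noncomputable def zetaCont (L : Type*) [Field L] [NumberField L] (s : ℂ) : ℂ :=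
  dedekindZeta_residue L * s ^ Fintype.card (InfinitePlace L) *
    (1 + (s - 1) * ∫ t in Set.Ioi (0 : ℝ), (idealError L t : ℂ) * Complex.exp (-s * t))

theorem measurable_idealError : Measurable (idealError L) :=
  ((measurable_idealSmooth L).ennreal_toReal.div_const _).sub Real.measurable_exp

theorem abs_idealError_le {Θ : ℝ} (h : IsCoveringBound L Θ) {P : ℝ}
    (hP : P = (finrank ℚ L + 1) * (7 * Θ ^ 2) ^ finrank ℚ L) {t : ℝ} (ht : 0 < t) :
    |idealError L t| ≤ P * Real.exp ((1 - (finrank ℚ L : ℝ)⁻¹) * t) := by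
  have hκ := dedekindZeta_residue_pos L
  have := (idealSmooth_bounds h hP ht.le).2
  have h1 : idealError L t = ((idealSmooth L t).toReal - dedekindZeta_residue L * Real.exp t) /
      dedekindZeta_residue L := by
    rw [idealError]; field_simp
  rw [h1, abs_div, abs_of_pos hκ, div_le_iff₀ hκ]
  linarith

theorem one_le_of_isCoveringBound {Θ : ℝ} (h : IsCoveringBound L Θ) :
    1 ≤ ((finrank ℚ L : ℝ) + 1) * (7 * Θ ^ 2) ^ finrank ℚ L := by
  have h1 : (1 : ℝ) ≤ (7 * Θ ^ 2) ^ finrank ℚ L := one_le_pow₀ (by nlinarith [h.1])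
  have h2 : (0 : ℝ) ≤ finrank ℚ L := Nat.cast_nonneg _
  nlinarith

theorem idealZeta_spec {Θ : ℝ} (h : IsCoveringBound L Θ) {s : ℝ} (hs : 1 < s) :
    Summable (fun I : (Ideal (𝓞 L))⁰ ↦ (Ideal.absNorm (I : Ideal (𝓞 L)) : ℝ) ^ (-s)) ∧
    zetaCont L s = ((s - 1) * idealZeta L s : ℝ) := by
  have hs0 : 0 < s := by linarith
  have hκ := dedekindZeta_residue_pos L
  set κ := dedekindZeta_residue L with hκdef
  set q := Fintype.card (InfinitePlace L) with hq
  have hn1 : (1 : ℝ) ≤ finrank ℚ L := by exact_mod_cast finrank_pos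
  have hE := fun t (ht : 0 < t) ↦ abs_idealError_le h rfl ht
  have hσ : 1 - (finrank ℚ L : ℝ)⁻¹ < s := by
    have : 0 < (finrank ℚ L : ℝ)⁻¹ := by positivity
    linarith
  have hEint := integrable_laplace measurable_idealError hE (s := (s : ℂ)) (by simpa using hσ)
  have hcast : ∀ t : ℝ, (idealError L t : ℂ) * Complex.exp (-(s : ℂ) * t) =
      ((idealError L t * Real.exp (-s * t) : ℝ) : ℂ) := by
    intro t; push_cast; rfl
  simp only [hcast] at hEint
  have hEint' : IntegrableOn (fun t ↦ idealError L t * Real.exp (-s * t)) (Set.Ioi 0) := by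
    exact hEint.re
  have hexp := integrableOn_exp_mul_Ioi (a := 1 - s) (by linarith) 0
  have hm : ∀ t, (idealSmooth L t).toReal * Real.exp (-s * t) =
      κ * (idealError L t * Real.exp (-s * t) + Real.exp ((1 - s) * t)) := by
    intro t
    have : Real.exp ((1 - s) * t) = Real.exp t * Real.exp (-s * t) := by
      rw [← Real.exp_add]; ring_nf
    rw [this, idealError, ← hκdef]
    field_simp
    ring
  have hmint : IntegrableOn (fun t ↦ (idealSmooth L t).toReal * Real.exp (-s * t)) (Set.Ioi 0) := by
    simp only [hm]
    exact (hEint'.add hexp).const_mul _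
  have hval : ∫ t in Set.Ioi 0, (idealSmooth L t).toReal * Real.exp (-s * t) =
      κ * ((∫ t in Set.Ioi 0, idealError L t * Real.exp (-s * t)) + 1 / (s - 1)) := by
    simp only [hm]
    rw [integral_const_mul, integral_add hEint' hexp, integral_exp_mul_Ioi (by linarith)]
    congr 2
    rw [mul_zero, Real.exp_zero, neg_div, ← div_neg, neg_sub]
  have hl : ∫⁻ t, idealSmooth L t * ENNReal.ofReal (Real.exp (-s * t)) =
      ENNReal.ofReal (∫ t in Set.Ioi 0, (idealSmooth L t).toReal * Real.exp (-s * t)) := by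
    rw [ofReal_integral_eq_lintegral_ofReal hmint
      (Filter.Eventually.of_forall fun t ↦ by positivity), ← lintegral_indicator measurableSet_Ioi]
    refine lintegral_congr fun t ↦ ?_
    by_cases ht : 0 < t
    · rw [Set.indicator_of_mem (by exact ht), ENNReal.ofReal_mul ENNReal.toReal_nonneg,
        ENNReal.ofReal_toReal (idealSmooth_bounds h rfl ht.le).1]
    · rw [Set.indicator_of_notMem (by exact ht), idealSmooth_of_nonpos (not_lt.1 ht), zero_mul]
  rw [lintegral_laplace_idealSmooth L hs0, ENNReal.tsum_mul_right] at hl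
  have hq0 : 0 < s⁻¹ ^ q := by positivity
  have hne : ∑' I : (Ideal (𝓞 L))⁰,
      ENNReal.ofReal ((Ideal.absNorm (I : Ideal (𝓞 L)) : ℝ) ^ (-s)) ≠ ∞ := by
    intro h'
    rw [h', ENNReal.top_mul (by simpa using hq0)] at hl
    exact ENNReal.ofReal_ne_top hl.symm
  have hsum : Summable fun I : (Ideal (𝓞 L))⁰ ↦
      (Ideal.absNorm (I : Ideal (𝓞 L)) : ℝ) ^ (-s) := by
    have := ENNReal.summable_toReal hne
    refine this.congr fun I ↦ ?_
    rw [ENNReal.toReal_ofReal (by positivity)]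
  refine ⟨hsum, ?_⟩
  have hz0 : 0 ≤ idealZeta L s := tsum_nonneg fun I ↦ by positivity
  rw [← ENNReal.ofReal_tsum_of_nonneg (fun I ↦ by positivity) hsum] at hl
  change ENNReal.ofReal (idealZeta L s) * _ = _ at hl
  rw [← ENNReal.ofReal_mul hz0,
    ENNReal.ofReal_eq_ofReal_iff (by positivity)
      (setIntegral_nonneg measurableSet_Ioi fun t _ ↦ by positivity), hval] at hl
  simp only [zetaCont, hcast, ← hq, ← hκdef]
  rw [integral_complex_ofReal]
  set W := ∫ t in Set.Ioi 0, idealError L t * Real.exp (-s * t)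
  have hs1 : s - 1 ≠ 0 := by linarith
  have : idealZeta L s = s ^ q * (κ * (W + 1 / (s - 1))) := by
    rw [← hl, idealZeta, mul_left_comm, ← mul_pow, mul_inv_cancel₀ hs0.ne', one_pow, mul_one]
  rw [this]
  norm_cast
  field_simp
  ring

theorem differentiableOn_zetaCont {Θ : ℝ} (h : IsCoveringBound L Θ) :
    DifferentiableOn ℂ (zetaCont L) {s | 1 - (finrank ℚ L : ℝ)⁻¹ < s.re} := by
  have h1 := differentiableOn_laplace (measurable_idealError (L := L))
    (by linarith [one_le_of_isCoveringBound h]) fun t (ht : 0 < t) ↦ abs_idealError_le h rfl ht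
  unfold zetaCont
  exact (by fun_prop : DifferentiableOn ℂ (fun s : ℂ ↦ (dedekindZeta_residue L : ℂ) *
    s ^ Fintype.card (InfinitePlace L)) _).mul
    ((differentiableOn_const _).add ((by fun_prop : DifferentiableOn ℂ (fun s : ℂ ↦ s - 1) _).mul
      h1))

theorem zetaCont_one : zetaCont L 1 = dedekindZeta_residue L := by
  simp [zetaCont]

theorem zetaCont_im (x : ℝ) : (zetaCont L x).im = 0 := by
  have hcast : ∀ t : ℝ, (idealError L t : ℂ) * Complex.exp (-(x : ℂ) * t) =
      ((idealError L t * Real.exp (-x * t) : ℝ) : ℂ) := by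
    intro t; push_cast; rfl
  simp only [zetaCont, hcast]
  rw [integral_complex_ofReal]
  norm_cast

theorem card_infinitePlace_le : Fintype.card (InfinitePlace L) ≤ finrank ℚ L := by
  have := card_add_two_mul_card_eq_rank L
  have := card_eq_nrRealPlaces_add_nrComplexPlaces L
  lia

theorem norm_zetaCont_le {Θ : ℝ} (h : IsCoveringBound L Θ) {P : ℝ}
    (hP : P = (finrank ℚ L + 1) * (7 * Θ ^ 2) ^ finrank ℚ L) {s : ℂ} (hs : ‖s‖ ≤ 4)
    (hsr : 1 - (2 * finrank ℚ L : ℝ)⁻¹ ≤ s.re) :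
    ‖zetaCont L s‖ ≤ dedekindZeta_residue L *
      (4 ^ finrank ℚ L * (1 + 10 * finrank ℚ L)) * P := by
  have hP1 : 1 ≤ P := hP ▸ one_le_of_isCoveringBound h
  have hκ := dedekindZeta_residue_pos L
  have hn1 : (1 : ℝ) ≤ finrank ℚ L := by exact_mod_cast finrank_pos
  set n := finrank ℚ L with hn
  have hgap : (2 * n : ℝ)⁻¹ ≤ s.re - (1 - (n : ℝ)⁻¹) := by
    have : (2 * n : ℝ)⁻¹ + (2 * n : ℝ)⁻¹ = (n : ℝ)⁻¹ := by field_simp; norm_num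
    linarith
  have hpos : 0 < (2 * n : ℝ)⁻¹ := by positivity
  have h1 := norm_laplace_le (fun t (ht : 0 < t) ↦ abs_idealError_le h hP ht) (s := s)
    (by rw [← hn]; linarith)
  have h2 : P / (s.re - (1 - (n : ℝ)⁻¹)) ≤ P * (2 * n) := by
    rw [div_le_iff₀ (by linarith), mul_assoc]
    have : (1 : ℝ) ≤ 2 * n * (s.re - (1 - (n : ℝ)⁻¹)) := by
      rw [← inv_mul_le_iff₀ (by positivity), mul_one]; exact hgap
    nlinarith
  rw [zetaCont, norm_mul, norm_mul, norm_pow, Complex.norm_real, Real.norm_of_nonneg hκ.le,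
    mul_assoc, mul_assoc]
  refine mul_le_mul_of_nonneg_left ?_ hκ.le
  have h3 : ‖s‖ ^ Fintype.card (InfinitePlace L) ≤ 4 ^ n := by
    calc ‖s‖ ^ Fintype.card (InfinitePlace L) ≤ 4 ^ Fintype.card (InfinitePlace L) := by gcongr
      _ ≤ 4 ^ n := pow_le_pow_right₀ (by norm_num) card_infinitePlace_le
  have h4 : ‖s - 1‖ ≤ 5 := by
    refine (norm_sub_le _ _).trans ?_
    rw [norm_one]; linarith
  have h5 : ‖1 + (s - 1) * ∫ t in Set.Ioi (0 : ℝ), (idealError L t : ℂ) * Complex.exp (-s * t)‖ ≤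
      1 + 5 * (P * (2 * n)) := by
    refine (norm_add_le _ _).trans ?_
    rw [norm_one, norm_mul]
    gcongr
    exact h1.trans h2
  rw [mul_assoc]
  refine mul_le_mul h3 (h5.trans ?_) (norm_nonneg _) (by positivity)
  nlinarith

end NumberField

section FinsuppEuler

open scoped ENNReal

variable {ι : Type*} (x : ι → ℝ≥0∞)

theorem tsum_finsupp_supportedOn (S : Finset ι) :
    ∑' f : {f : ι →₀ ℕ // f.support ⊆ S}, f.1.prod (fun i k ↦ x i ^ k) =
      ∏ i ∈ S, ∑' k : ℕ, x i ^ k := by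
  classical
  induction S using Finset.induction_on with
  | empty =>
    rw [Finset.prod_empty]
    have : Unique {f : ι →₀ ℕ // f.support ⊆ ∅} :=
      ⟨⟨⟨0, by simp⟩⟩, fun f ↦ Subtype.ext (Finsupp.support_eq_empty.1 (by simpa using f.2))⟩
    rw [tsum_fintype (L := .unconditional _), Fintype.sum_unique]
    have : (default : {f : ι →₀ ℕ // f.support ⊆ ∅}).1 = 0 :=
      Finsupp.support_eq_empty.1 (by simpa using (default : {f : ι →₀ ℕ // f.support ⊆ ∅}).2)
    rw [this, Finsupp.prod_zero_index]
  | insert a S ha ih =>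
    let e : {f : ι →₀ ℕ // f.support ⊆ S} × ℕ ≃ {f : ι →₀ ℕ // f.support ⊆ insert a S} :=
      { toFun := fun p ↦ ⟨p.1.1 + Finsupp.single a p.2, by
          refine Finsupp.support_add.trans (Finset.union_subset ?_ ?_)
          · exact p.1.2.trans (Finset.subset_insert _ _)
          · exact Finsupp.support_single_subset.trans (by simp)⟩
        invFun := fun f ↦ (⟨f.1.erase a, by
          rw [Finsupp.support_erase]
          intro i hi
          have := f.2 (Finset.mem_of_mem_erase hi)
          exact (Finset.mem_insert.1 this).resolve_left (Finset.ne_of_mem_erase hi)⟩, f.1 a)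
        left_inv := by
          rintro ⟨⟨f, hf⟩, k⟩
          have hfa : f a = 0 := Finsupp.notMem_support_iff.1 fun h ↦ ha (hf h)
          refine Prod.ext (Subtype.ext ?_) ?_
          · ext i
            by_cases hi : i = a
            · subst hi; simp [hfa]
            · simp [Finsupp.erase_ne hi]
          · simp [hfa]
        right_inv := by
          rintro ⟨f, hf⟩
          exact Subtype.ext (Finsupp.erase_add_single a f) }
    rw [Finset.prod_insert ha, ← ih, ← e.tsum_eq, mul_comm, ← ENNReal.tsum_mul_right]
    simp only [← ENNReal.tsum_mul_left]
    rw [← ENNReal.tsum_prod (f := fun (f : {f : ι →₀ ℕ // f.support ⊆ S}) (k : ℕ) ↦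
      f.1.prod (fun i k ↦ x i ^ k) * x a ^ k)]
    refine tsum_congr fun p ↦ ?_
    change (p.1.1 + Finsupp.single a p.2).prod _ = _
    rw [Finsupp.prod_add_index' (by simp) (by simp [pow_add]), Finsupp.prod_single_index (by simp)]

theorem tsum_finsupp_eq_iSup_prod :
    ∑' f : ι →₀ ℕ, f.prod (fun i k ↦ x i ^ k) = ⨆ S : Finset ι, ∏ i ∈ S, ∑' k : ℕ, x i ^ k := by
  classical
  apply le_antisymm
  · rw [ENNReal.tsum_eq_iSup_sum]
    refine iSup_le fun T ↦ le_iSup_of_le (T.biUnion Finsupp.support) ?_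
    rw [← tsum_finsupp_supportedOn, ← Finset.sum_attach]
    have := ENNReal.sum_le_tsum (T.attach.map ⟨fun f ↦ (⟨f.1, Finset.subset_biUnion_of_mem
      Finsupp.support f.2⟩ : {f : ι →₀ ℕ // f.support ⊆ T.biUnion Finsupp.support}),
      fun a b h ↦ Subtype.ext (congrArg (fun z ↦ z.1) h)⟩)
      (f := fun f ↦ f.1.prod (fun i k ↦ x i ^ k))
    rwa [Finset.sum_map] at this
  · refine iSup_le fun S ↦ ?_
    rw [← tsum_finsupp_supportedOn]
    exact ENNReal.tsum_comp_le_tsum_of_injective Subtype.val_injective _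

end FinsuppEuler

namespace NumberField

open Module IsDedekindDomain
open scoped Classical
open scoped nonZeroDivisors NNReal ENNReal

variable {L : Type*} [Field L] [NumberField L]

/-- The ideal with prescribed multiplicities. -/
noncomputable def finsuppIdeal (f : HeightOneSpectrum (𝓞 L) →₀ ℕ) : Ideal (𝓞 L) :=
  f.prod fun P k ↦ P.asIdeal ^ k

theorem finsuppIdeal_eq {K : Type*} [Field K] (f : HeightOneSpectrum (𝓞 K) →₀ ℕ) :
    finsuppIdeal f = (f.toMultiset.map HeightOneSpectrum.asIdeal).prod := by
  rw [Finsupp.toMultiset_map, Finsupp.prod_toMultiset]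
  rw [Finsupp.prod_mapDomain_index (by simp) (by simp [pow_add]), finsuppIdeal]

theorem finsuppIdeal_bijective : Function.Bijective fun f : HeightOneSpectrum (𝓞 L) →₀ ℕ ↦
    (⟨finsuppIdeal f, by
      rw [mem_nonZeroDivisors_iff_ne_zero]
      exact Finset.prod_ne_zero_iff.2 fun P _ ↦ pow_ne_zero _ P.ne_bot⟩ : (Ideal (𝓞 L))⁰) := by
  have hinj : Function.Injective (HeightOneSpectrum.asIdeal (R := 𝓞 L)) :=
    fun a b h ↦ HeightOneSpectrum.ext h
  constructor
  · intro f g h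
    have h1 := congrArg Subtype.val h
    simp only [finsuppIdeal_eq] at h1
    have key : ∀ f : HeightOneSpectrum (𝓞 L) →₀ ℕ, UniqueFactorizationMonoid.normalizedFactors
        (f.toMultiset.map HeightOneSpectrum.asIdeal).prod =
        f.toMultiset.map HeightOneSpectrum.asIdeal := by
      intro f
      rw [UniqueFactorizationMonoid.normalizedFactors_prod_eq]
      · simp
      · intro a ha
        obtain ⟨P, -, rfl⟩ := Multiset.mem_map.1 ha
        exact P.irreducible
    have h2 := (key f).symm.trans ((congrArg _ h1).trans (key g))
    exact Multiset.toFinsupp.symm.injective (Multiset.map_injective hinj h2)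
  · rintro ⟨I, hI⟩
    have hI0 := mem_nonZeroDivisors_iff_ne_zero.1 hI
    let m : Multiset (HeightOneSpectrum (𝓞 L)) :=
      (UniqueFactorizationMonoid.normalizedFactors I).attach.map fun P ↦
        ⟨P.1, Ideal.isPrime_of_prime (UniqueFactorizationMonoid.prime_of_normalized_factor _ P.2),
          (UniqueFactorizationMonoid.prime_of_normalized_factor _ P.2).ne_zero⟩
    refine ⟨Multiset.toFinsupp m, Subtype.ext ?_⟩
    simp only [finsuppIdeal_eq, Multiset.toFinsupp_toMultiset, m, Multiset.map_map]
    rw [← associated_iff_eq]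
    refine Associated.trans ?_ (UniqueFactorizationMonoid.prod_normalizedFactors hI0)
    simp

theorem one_lt_absNorm (P : HeightOneSpectrum (𝓞 L)) :
    (1 : ℝ) < (Ideal.absNorm P.asIdeal : ℝ) := by
  have h1 : Ideal.absNorm P.asIdeal ≠ 0 := by
    rw [Ne, Ideal.absNorm_eq_zero_iff]; exact P.ne_bot
  have h2 : Ideal.absNorm P.asIdeal ≠ 1 := by
    rw [Ne, Ideal.absNorm_eq_one_iff]; exact P.isPrime.ne_top
  have : 1 < Ideal.absNorm P.asIdeal := by lia
  exact_mod_cast this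

theorem absNorm_rpow_mem (P : HeightOneSpectrum (𝓞 L)) {s : ℝ} (hs : 0 < s) :
    0 < (Ideal.absNorm P.asIdeal : ℝ) ^ (-s) ∧ (Ideal.absNorm P.asIdeal : ℝ) ^ (-s) < 1 := by
  have h := one_lt_absNorm P
  exact ⟨by positivity, Real.rpow_lt_one_of_one_lt_of_neg h (by linarith)⟩

theorem hasSum_log_idealZeta {s : ℝ} (hs : 0 < s)
    (hsum : Summable fun I : (Ideal (𝓞 L))⁰ ↦ (Ideal.absNorm (I : Ideal (𝓞 L)) : ℝ) ^ (-s)) :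
    0 < idealZeta L s ∧ HasSum (fun P : HeightOneSpectrum (𝓞 L) ↦
      -Real.log (1 - (Ideal.absNorm P.asIdeal : ℝ) ^ (-s))) (Real.log (idealZeta L s)) := by
  set q : HeightOneSpectrum (𝓞 L) → ℝ := fun P ↦ (Ideal.absNorm P.asIdeal : ℝ) ^ (-s) with hq
  have hq0 : ∀ P, 0 < q P := fun P ↦ (absNorm_rpow_mem P hs).1
  have hq1 : ∀ P, q P < 1 := fun P ↦ (absNorm_rpow_mem P hs).2
  have hlog0 : ∀ P, 0 ≤ -Real.log (1 - q P) := fun P ↦ by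
    rw [neg_nonneg]
    exact Real.log_nonpos (by linarith [hq1 P]) (by linarith [hq0 P])
  have hgeom : ∀ P, ∑' k : ℕ, ENNReal.ofReal (q P) ^ k =
      ENNReal.ofReal (Real.exp (-Real.log (1 - q P))) := by
    intro P
    rw [Real.exp_neg, Real.exp_log (by linarith [hq1 P]), ← tsum_geometric_of_lt_one (hq0 P).le
      (hq1 P), ENNReal.ofReal_tsum_of_nonneg (fun k ↦ pow_nonneg (hq0 P).le k)
      (summable_geometric_of_lt_one (hq0 P).le (hq1 P))]
    simp only [ENNReal.ofReal_pow (hq0 P).le]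
  have hprod : ENNReal.ofReal (idealZeta L s) =
      ⨆ S : Finset (HeightOneSpectrum (𝓞 L)), ENNReal.ofReal
        (Real.exp (∑ P ∈ S, -Real.log (1 - q P))) := by
    rw [idealZeta, ENNReal.ofReal_tsum_of_nonneg (fun I ↦ by positivity) hsum,
      ← (Equiv.ofBijective _ (finsuppIdeal_bijective (L := L))).tsum_eq]
    have h1 : ∀ f : HeightOneSpectrum (𝓞 L) →₀ ℕ,
        ENNReal.ofReal ((Ideal.absNorm (finsuppIdeal f) : ℝ) ^ (-s)) =
        f.prod fun P k ↦ ENNReal.ofReal (q P) ^ k := by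
      intro f
      simp only [finsuppIdeal, Finsupp.prod, map_prod, map_pow]
      push_cast
      rw [← Real.finsetProd_rpow _ _ (fun _ _ ↦ by positivity),
        ENNReal.ofReal_prod_of_nonneg (fun _ _ ↦ by positivity)]
      refine Finset.prod_congr rfl fun P _ ↦ ?_
      rw [← ENNReal.ofReal_pow (hq0 P).le, ← Real.rpow_natCast, ← Real.rpow_natCast,
        ← Real.rpow_mul (by positivity), hq, ← Real.rpow_mul (by positivity), mul_comm]
    refine (tsum_congr h1).trans ?_
    rw [tsum_finsupp_eq_iSup_prod]
    refine iSup_congr fun S ↦ ?_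
    rw [Real.exp_sum, ENNReal.ofReal_prod_of_nonneg (fun _ _ ↦ (Real.exp_pos _).le)]
    exact Finset.prod_congr rfl fun P _ ↦ hgeom P
  have hle : ∀ S : Finset (HeightOneSpectrum (𝓞 L)),
      Real.exp (∑ P ∈ S, -Real.log (1 - q P)) ≤ idealZeta L s := by
    intro S
    have h0 : 0 ≤ idealZeta L s := tsum_nonneg fun I ↦ by positivity
    rw [← ENNReal.ofReal_le_ofReal_iff h0, hprod]
    exact le_iSup (fun S : Finset (HeightOneSpectrum (𝓞 L)) ↦ ENNReal.ofReal
        (Real.exp (∑ P ∈ S, -Real.log (1 - q P)))) S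
  have hpos : 0 < idealZeta L s := (Real.exp_pos _).trans_le (hle ∅)
  refine ⟨hpos, hasSum_of_isLUB_of_nonneg _ hlog0 ⟨?_, ?_⟩⟩
  · rintro _ ⟨S, rfl⟩
    exact (Real.le_log_iff_exp_le hpos).2 (hle S)
  · intro b hb
    rw [Real.log_le_iff_le_exp hpos, ← ENNReal.ofReal_le_ofReal_iff (Real.exp_pos _).le, hprod]
    exact iSup_le fun S ↦ ENNReal.ofReal_le_ofReal (Real.exp_le_exp.2 (hb ⟨S, rfl⟩))

end NumberField

namespace NumberField

open Module mixedEmbedding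

variable {L : Type*} [Field L] [NumberField L]

theorem IsCoveringBound.of_span_eq_top {ι : Type*} [Fintype ι] {Θ : ℝ} (v : ι → 𝓞 L)
    (hv : Submodule.span ℚ (Set.range fun i ↦ (v i : L)) = ⊤) (hΘ : 1 ≤ Θ)
    (h : ∀ w : InfinitePlace L, ∑ i, w (v i : L) < Θ) : IsCoveringBound L Θ := by
  refine ⟨hΘ, fun x ↦ ?_⟩
  have hspan : Submodule.span ℝ (Set.range fun i ↦ mixedEmbedding L (v i)) = ⊤ := by
    have hmem : ∀ y : L, mixedEmbedding L y ∈
        Submodule.span ℝ (Set.range fun i ↦ mixedEmbedding L (v i)) := by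
      intro y
      have hy : y ∈ Submodule.span ℚ (Set.range fun i ↦ (v i : L)) := hv ▸ Submodule.mem_top
      induction hy using Submodule.span_induction with
      | mem y hy =>
        obtain ⟨i, rfl⟩ := hy
        exact Submodule.subset_span ⟨i, rfl⟩
      | zero => rw [map_zero]; exact zero_mem _
      | add y z _ _ hy hz => rw [map_add]; exact add_mem hy hz
      | smul q y _ hy =>
        have : mixedEmbedding L (q • y) = (q : ℝ) • mixedEmbedding L y := by
          rw [map_rat_smul]
          exact (Rat.cast_smul_eq_qsmul ℝ q _).symm
        rw [this]
        exact Submodule.smul_mem _ _ hy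
    rw [eq_top_iff, ← (latticeBasis L).span_eq, Submodule.span_le]
    rintro _ ⟨i, rfl⟩
    rw [latticeBasis_apply]
    exact hmem _
  obtain ⟨c, hc⟩ := (Submodule.mem_span_range_iff_exists_fun ℝ).1
    (hspan ▸ Submodule.mem_top : x ∈ Submodule.span ℝ (Set.range fun i ↦ mixedEmbedding L (v i)))
  refine ⟨∑ i, ⌊c i⌋ • v i, fun w ↦ ?_⟩
  have hdiff : x - mixedEmbedding L ((∑ i, ⌊c i⌋ • v i : 𝓞 L) : L) =
      ∑ i, Int.fract (c i) • mixedEmbedding L (v i) := by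
    have hcoe : ((∑ i, ⌊c i⌋ • v i : 𝓞 L) : L) = ∑ i, ⌊c i⌋ • (v i : L) :=
      (map_sum (algebraMap (𝓞 L) L) _ _).trans (Finset.sum_congr rfl fun i _ ↦ map_zsmul _ _ _)
    rw [← hc, hcoe, map_sum, ← Finset.sum_sub_distrib]
    refine Finset.sum_congr rfl fun i _ ↦ ?_
    rw [map_zsmul, ← Int.cast_smul_eq_zsmul ℝ, ← sub_smul, Int.fract]
  rw [hdiff]
  refine lt_of_le_of_lt ?_ (h w)
  refine (Finset.le_sum_of_subadditive (normAtPlace w) (map_zero _).le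
    (normAtPlace_add_le w) _ _).trans ?_
  refine Finset.sum_le_sum fun i _ ↦ ?_
  rw [normAtPlace_smul, normAtPlace_apply, abs_of_nonneg (Int.fract_nonneg _)]
  exact mul_le_of_le_one_left (apply_nonneg _ _) (Int.fract_lt_one _).le

variable (L) in
/-- A bound for all conjugates of the integral basis. -/
noncomputable def basisHeight : ℝ :=
  1 + ∑ w : InfinitePlace L, ∑ i, w (integralBasis L i)

theorem sum_integralBasis_lt (w : InfinitePlace L) :
    ∑ i, w (integralBasis L i) < basisHeight L := by
  have := Finset.single_le_sum (f := fun w : InfinitePlace L ↦ ∑ i, w (integralBasis L i))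
    (fun w _ ↦ Finset.sum_nonneg fun i _ ↦ apply_nonneg _ _) (Finset.mem_univ w)
  rw [basisHeight]
  linarith

theorem one_le_basisHeight : 1 ≤ basisHeight L := by
  rw [basisHeight, le_add_iff_nonneg_right]
  exact Finset.sum_nonneg fun w _ ↦ Finset.sum_nonneg fun i _ ↦ apply_nonneg _ _

theorem isCoveringBound_basisHeight : IsCoveringBound L (basisHeight L) := by
  refine .of_span_eq_top (fun i ↦ RingOfIntegers.basis L i) ?_ one_le_basisHeight fun w ↦ ?_
  · convert (integralBasis L).span_eq with i
    rw [integralBasis_apply]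
  · convert sum_integralBasis_lt w with i
    rw [integralBasis_apply]

theorem isCoveringBound_of_quadratic {F : Type*} [Field F] [NumberField F] [Algebra F L]
    (h2 : finrank F L = 2) {γ : 𝓞 L} (hγ : (γ : L) ∉ (algebraMap F L).range) {T : ℝ}
    (hT : 0 ≤ T) (hw : ∀ w : InfinitePlace L, w (γ : L) ≤ T) :
    IsCoveringBound L (basisHeight F * (1 + T)) := by
  have hmk : ∀ x : L, ∃ a b : F, x = algebraMap F L a + algebraMap F L b * γ := by
    have hli : LinearIndependent F ![(1 : L), γ] := by
      rw [LinearIndependent.pair_iff' one_ne_zero]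
      intro a ha
      exact hγ ⟨a, by rw [← ha, Algebra.smul_def, mul_one]⟩
    intro x
    have : FiniteDimensional F L := FiniteDimensional.of_finrank_eq_succ h2
    have hx : x ∈ Submodule.span F (Set.range ![(1 : L), γ]) := by
      rw [hli.span_eq_top_of_card_eq_finrank (by simp [h2])]
      trivial
    obtain ⟨c, hc⟩ := (Submodule.mem_span_range_iff_exists_fun F).1 hx
    refine ⟨c 0, c 1, ?_⟩
    rw [← hc]
    simp [Algebra.smul_def]
  let v : (Module.Free.ChooseBasisIndex ℤ (𝓞 F)) ⊕ (Module.Free.ChooseBasisIndex ℤ (𝓞 F)) → 𝓞 L :=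
    Sum.elim (fun i ↦ algebraMap (𝓞 F) (𝓞 L) (RingOfIntegers.basis F i))
      (fun i ↦ algebraMap (𝓞 F) (𝓞 L) (RingOfIntegers.basis F i) * γ)
  have hcoe : ∀ i, ((algebraMap (𝓞 F) (𝓞 L) (RingOfIntegers.basis F i) : 𝓞 L) : L) =
      algebraMap F L (integralBasis F i) := fun i ↦ by
    rw [integralBasis_apply]; rfl
  refine .of_span_eq_top v ?_ ?_ fun w ↦ ?_
  · rw [eq_top_iff]
    rintro x -
    obtain ⟨a, b, rfl⟩ := hmk x
    have haux : ∀ (a : F) (z : L), algebraMap F L a * z ∈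
        Submodule.span ℚ (Set.range fun i ↦ algebraMap F L (integralBasis F i) * z) := by
      intro a z
      rw [← (integralBasis F).sum_repr a, map_sum, Finset.sum_mul]
      refine Submodule.sum_mem _ fun i _ ↦ ?_
      rw [map_rat_smul, smul_mul_assoc]
      exact Submodule.smul_mem _ _ (Submodule.subset_span ⟨i, rfl⟩)
    refine add_mem ?_ ?_
    · refine Submodule.span_mono ?_ (mul_one (algebraMap F L a) ▸ haux a 1)
      rintro _ ⟨i, rfl⟩
      exact ⟨Sum.inl i, by simp [v, hcoe]⟩
    · refine Submodule.span_mono ?_ (haux b γ)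
      rintro _ ⟨i, rfl⟩
      exact ⟨Sum.inr i, by simp [v, hcoe]⟩
  · nlinarith [one_le_basisHeight (L := F)]
  · rw [Fintype.sum_sum_type]
    simp only [v, Sum.elim_inl, Sum.elim_inr, map_mul, hcoe]
    have hc : ∀ i, w (algebraMap F L (integralBasis F i)) =
      w.comap (algebraMap F L) (integralBasis F i) := fun i ↦ rfl
    simp only [hc]
    rw [← Finset.sum_mul]
    have h1 := sum_integralBasis_lt (w.comap (algebraMap F L))
    have h0 : 0 ≤ ∑ i, w.comap (algebraMap F L) (integralBasis F i) :=
      Finset.sum_nonneg fun i _ ↦ apply_nonneg _ _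
    have := mul_le_mul_of_nonneg_left (hw w) h0
    nlinarith

end NumberField

namespace NumberField

open Module mixedEmbedding

section Height

variable (K : Type*) [Field K] [NumberField K]

theorem exists_primitive_small [IsTotallyComplex K] :
    ∃ a : 𝓞 K, IntermediateField.adjoin ℚ {(a : K)} = ⊤ ∧
      ∀ w : InfinitePlace K, w (a : K) ≤ 3 * 2 ^ finrank ℚ K * √|discr K| := by
  obtain ⟨w₀⟩ := (inferInstance : Nonempty (InfinitePlace K))
  have hw₀ : w₀.IsComplex := IsTotallyComplex.isComplex w₀
  have hD : (1 : ℝ) ≤ √|discr K| := by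
    rw [Real.one_le_sqrt]
    exact_mod_cast Int.one_le_abs (discr_ne_zero K)
  have h2 : (1 : ℝ) ≤ 2 ^ finrank ℚ K := one_le_pow₀ (by norm_num)
  let B : NNReal := (2 : NNReal) ^ finrank ℚ K * NNReal.sqrt ‖discr K‖₊ + 1
  have hB : minkowskiBound K ↑1 < convexBodyLT'Factor K * B := by
    refine lt_of_lt_of_le ?_ (le_mul_of_one_le_left (by positivity)
      (by exact_mod_cast one_le_convexBodyLT'Factor K))
    have : (2 : NNReal) ^ finrank ℚ K * NNReal.sqrt ‖discr K‖₊ < B := by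
      simp only [B, lt_add_iff_pos_right, zero_lt_one]
    refine lt_of_le_of_lt ?_ (ENNReal.coe_lt_coe.mpr this)
    rw [minkowskiBound, volume_fundamentalDomain_fractionalIdealLatticeBasis,
      Units.val_one, FractionalIdeal.absNorm_one, Rat.cast_one,
      ENNReal.ofReal_one, one_mul, mixedEmbedding.finrank, volume_fundamentalDomain_latticeBasis,
      mul_comm, ENNReal.coe_mul, ENNReal.coe_pow, ENNReal.coe_ofNat]
    gcongr
    exact mul_le_of_le_one_left (by positivity) (pow_le_one₀ (by positivity) (by simp))
  obtain ⟨a, ha, hw⟩ := exists_primitive_element_lt_of_isComplex K hw₀ hB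
  refine ⟨a, ha, fun w ↦ (hw w).le.trans ?_⟩
  have hBv : (B : ℝ) = 2 ^ finrank ℚ K * √|discr K| + 1 := by
    simp only [B, NNReal.coe_add, NNReal.coe_mul, NNReal.coe_pow, NNReal.coe_ofNat,
      Real.coe_sqrt, coe_nnnorm, Int.norm_eq_abs, NNReal.coe_one]
  have hY : (1 : ℝ) ≤ 2 ^ finrank ℚ K * √|discr K| := one_le_mul_of_one_le_of_one_le h2 hD
  rw [Real.sqrt_le_left (by positivity), hBv]
  nlinarith

end Height

section Regulator

variable (F K : Type*) [Field F] [NumberField F] [Field K] [NumberField K] [Algebra F K]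
  [IsTotallyReal F] [IsTotallyComplex K]

theorem card_infinitePlace_eq_of_quadratic (h2 : finrank F K = 2) :
    Fintype.card (InfinitePlace K) = Fintype.card (InfinitePlace F) := by
  rw [InfinitePlace.card_eq_nrRealPlaces_add_nrComplexPlaces,
    InfinitePlace.card_eq_nrRealPlaces_add_nrComplexPlaces,
    IsTotallyComplex.nrRealPlaces_eq_zero K, IsTotallyReal.nrComplexPlaces_eq_zero F, zero_add,
    add_zero, ← IsTotallyReal.finrank F, ← Nat.mul_left_cancel_iff zero_lt_two,
    ← IsTotallyComplex.finrank, ← Module.finrank_mul_finrank ℚ F K, mul_comm, h2]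

open NumberField.Units dirichletUnitTheorem in
open scoped Classical in
theorem regulator_le_of_quadratic (h2 : finrank F K = 2) :
    regulator K ≤ 2 ^ Units.rank F * regulator F := by
  have hcard := card_infinitePlace_eq_of_quadratic F K h2
  let E : InfinitePlace K ≃ InfinitePlace F :=
    Equiv.ofBijective (fun w ↦ w.comap (algebraMap F K)) <|
      (Fintype.bijective_iff_surjective_and_card _).mpr ⟨InfinitePlace.comap_surjective, hcard⟩
  have hE : ∀ (w : InfinitePlace F) (x : F), E.symm w (algebraMap F K x) = w x := by
    intro w x
    conv_rhs => rw [← E.apply_symm_apply w]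
    rfl
  have hrank : Units.rank F = Units.rank K := by rw [Units.rank, Units.rank, hcard]
  let u : Fin (Units.rank K) → (𝓞 K)ˣ := fun i ↦
    Units.map (algebraMap (𝓞 F) (𝓞 K)).toMonoidHom (fundSystem F (finCongr hrank.symm i))
  have hreg : regOfFamily u = 2 ^ Units.rank F * regulator F := by
    let W₀ := E.symm w₀
    let f : {w : InfinitePlace K // w ≠ W₀} ≃ {w : InfinitePlace F // w ≠ w₀} :=
      E.subtypeEquiv fun w ↦ by rw [not_iff_not, Equiv.eq_symm_apply]
    let g := ((finCongr hrank.symm).trans (equivFinRank F)).trans f.symm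
    rw [show (2 : ℝ) ^ Units.rank F = |∏ w : {w : InfinitePlace F // w ≠ w₀}, 2| by
      rw [Finset.prod_const, abs_pow, abs_of_pos zero_lt_two, Units.rank]
      simp]
    rw [regulator_eq_regOfFamily_fundSystem, regOfFamily_eq_det _ W₀ g.symm, regOfFamily_eq_det',
      ← abs_mul, ← Matrix.det_mul_column, ← Matrix.det_reindex_self f, Matrix.reindex_apply]
    congr; ext i w
    rw [Matrix.submatrix_apply, Matrix.of_apply, Matrix.of_apply,
      show f.symm w = E.symm w.1 by rfl]
    have : algebraMap (𝓞 K) K (u (g.symm (f.symm i)) : 𝓞 K) =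
        algebraMap F K (fundSystem F ((equivFinRank F).symm i)) := by
      simp only [u, g]
      simp
      rfl
    rw [this, hE]
    simp [IsTotallyComplex.mult_eq, IsTotallyReal.mult_eq]
  have hdiv := regOfFamily_div_regulator u
  have hR := regulator_pos K
  have hpos : 0 < regOfFamily u := by rw [hreg]; have := regulator_pos F; positivity
  rw [← hreg]
  have h1 : 0 < regOfFamily u / regulator K := by positivity
  rw [hdiv, Nat.cast_pos] at h1
  have h3 : (1 : ℝ) ≤ regOfFamily u / regulator K := by rw [hdiv]; exact_mod_cast h1
  rwa [one_le_div hR] at h3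

theorem residue_le_of_quadratic (h2 : finrank F K = 2) :
    dedekindZeta_residue K ≤ classNumber K *
      ((2 * Real.pi) ^ finrank ℚ F * 2 ^ Units.rank F * Units.regulator F) / √|discr K| := by
  have hr2 : InfinitePlace.nrComplexPlaces K = finrank ℚ F := by
    have := card_infinitePlace_eq_of_quadratic F K h2
    rw [InfinitePlace.card_eq_nrRealPlaces_add_nrComplexPlaces,
      IsTotallyComplex.nrRealPlaces_eq_zero K, zero_add,
      InfinitePlace.card_eq_nrRealPlaces_add_nrComplexPlaces,
      IsTotallyReal.nrComplexPlaces_eq_zero F, add_zero, ← IsTotallyReal.finrank F] at this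
    exact this
  rw [dedekindZeta_residue_def, IsTotallyComplex.nrRealPlaces_eq_zero K, hr2, pow_zero, one_mul,
    ← div_div]
  gcongr
  have hw : (1 : ℝ) ≤ Units.torsionOrder K := by
    exact_mod_cast Nat.one_le_iff_ne_zero.2 (NeZero.ne _)
  have hR := regulator_le_of_quadratic F K h2
  have := Units.regulator_pos K
  refine (div_le_self (by positivity) hw).trans ?_
  calc (2 * Real.pi) ^ finrank ℚ F * Units.regulator K * classNumber K
      ≤ (2 * Real.pi) ^ finrank ℚ F * (2 ^ Units.rank F * Units.regulator F) * classNumber K := by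
        gcongr
    _ = _ := by ring

end Regulator

end NumberField

namespace NumberField

open Module IsDedekindDomain

variable (F K : Type*) [Field F] [NumberField F] [Field K] [NumberField K] [Algebra F K]

/-- `p` has two primes of `K` above it. -/
def IsSplitAt (p : HeightOneSpectrum (𝓞 F)) : Prop :=
  ∃ P₁ P₂ : HeightOneSpectrum (𝓞 K), P₁ ≠ P₂ ∧ (∀ Q : HeightOneSpectrum (𝓞 K),
    Q.under (𝓞 F) = p ↔ Q = P₁ ∨ Q = P₂) ∧ Ideal.absNorm P₁.asIdeal = Ideal.absNorm p.asIdeal ∧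
    Ideal.absNorm P₂.asIdeal = Ideal.absNorm p.asIdeal

/-- `p` has a single prime of `K` above it, of residue degree one. -/
def IsRamifiedAt (p : HeightOneSpectrum (𝓞 F)) : Prop :=
  ∃ P : HeightOneSpectrum (𝓞 K), (∀ Q : HeightOneSpectrum (𝓞 K), Q.under (𝓞 F) = p ↔ Q = P) ∧
    Ideal.absNorm P.asIdeal = Ideal.absNorm p.asIdeal

/-- `p` has a single prime of `K` above it, of residue degree two. -/
def IsInertAt (p : HeightOneSpectrum (𝓞 F)) : Prop :=
  ∃ P : HeightOneSpectrum (𝓞 K), (∀ Q : HeightOneSpectrum (𝓞 K), Q.under (𝓞 F) = p ↔ Q = P) ∧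
    Ideal.absNorm P.asIdeal = Ideal.absNorm p.asIdeal ^ 2

variable {F K}

set_option linter.deprecated false in
theorem isSplitAt_or (h2 : finrank F K = 2) (p : HeightOneSpectrum (𝓞 F)) :
    IsSplitAt F K p ∨ IsRamifiedAt F K p ∨ IsInertAt F K p := by
  classical
  have hmax : p.asIdeal.IsMaximal := p.isMaximal
  have hsum := Ideal.sum_ramification_inertia (𝓞 K) F K (p := p.asIdeal) p.ne_bot
  rw [h2] at hsum
  have hmem : ∀ P : HeightOneSpectrum (𝓞 K), P.under (𝓞 F) = p ↔
      P.asIdeal ∈ IsDedekindDomain.primesOverFinset p.asIdeal (𝓞 K) := by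
    intro P
    rw [IsDedekindDomain.mem_primesOverFinset_iff p.ne_bot]
    refine ⟨fun h ↦ ⟨P.isPrime, ⟨?_⟩⟩, fun h ↦ HeightOneSpectrum.ext h.2.over.symm⟩
    rw [← h]
    rfl
  have hmk : ∀ Q ∈ IsDedekindDomain.primesOverFinset p.asIdeal (𝓞 K), ∃ P : HeightOneSpectrum (𝓞 K),
      P.asIdeal = Q := by
    intro Q hQ
    rw [IsDedekindDomain.mem_primesOverFinset_iff p.ne_bot] at hQ
    exact ⟨⟨Q, hQ.1, Ideal.ne_bot_of_mem_primesOver p.ne_bot hQ⟩, rfl⟩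
  have hef : ∀ Q ∈ IsDedekindDomain.primesOverFinset p.asIdeal (𝓞 K),
      0 < Ideal.ramificationIdx' p.asIdeal Q ∧ 0 < Ideal.inertiaDeg' p.asIdeal Q ∧
      Ideal.absNorm Q = Ideal.absNorm p.asIdeal ^ Ideal.inertiaDeg' p.asIdeal Q := by
    intro Q hQ
    rw [IsDedekindDomain.mem_primesOverFinset_iff p.ne_bot] at hQ
    have := hQ.1
    have := hQ.2
    exact ⟨Nat.pos_iff_ne_zero.mpr <| Ideal.IsDedekindDomain.ramificationIdx'_ne_zero_of_liesOver _
      p.ne_bot, Nat.pos_iff_ne_zero.mpr <| Ideal.inertiaDeg'_ne_zero _ _,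
      Ideal.absNorm_eq_pow_inertiaDeg'_of_liesOver Q p.asIdeal p.isPrime p.ne_bot⟩
  generalize IsDedekindDomain.primesOverFinset p.asIdeal (𝓞 K) = S at *
  obtain ⟨Q₁, hQ₁⟩ : S.Nonempty := by
    rw [Finset.nonempty_iff_ne_empty]
    rintro rfl
    simp at hsum
  obtain ⟨P₁, rfl⟩ := hmk _ hQ₁
  obtain ⟨e1, f1, n1⟩ := hef _ hQ₁
  by_cases hS : S = {P₁.asIdeal}
  · right
    have hfib : ∀ Q : HeightOneSpectrum (𝓞 K), Q.under (𝓞 F) = p ↔ Q = P₁ := by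
      intro Q
      rw [hmem, hS, Finset.mem_singleton]
      exact ⟨fun h ↦ HeightOneSpectrum.ext h, fun h ↦ h ▸ rfl⟩
    rw [hS, Finset.sum_singleton] at hsum
    have hle : Ideal.inertiaDeg' p.asIdeal P₁.asIdeal ≤ 2 :=
      Nat.le_of_dvd two_pos ⟨_, by rw [← hsum, mul_comm]⟩
    obtain h | h : Ideal.inertiaDeg' p.asIdeal P₁.asIdeal = 1 ∨
      Ideal.inertiaDeg' p.asIdeal P₁.asIdeal = 2 := by lia
    · exact Or.inl ⟨P₁, hfib, by rw [n1, h, pow_one]⟩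
    · exact Or.inr ⟨P₁, hfib, by rw [n1, h]⟩
  · left
    obtain ⟨Q₂, hQ₂, hne⟩ : ∃ Q₂ ∈ S, Q₂ ≠ P₁.asIdeal := by
      by_contra! h
      exact hS (Finset.eq_singleton_iff_unique_mem.2 ⟨hQ₁, h⟩)
    obtain ⟨P₂, rfl⟩ := hmk _ hQ₂
    obtain ⟨e2, f2, n2⟩ := hef _ hQ₂
    rw [← Finset.add_sum_erase _ _ hQ₁,
      ← Finset.add_sum_erase _ _ (Finset.mem_erase.2 ⟨hne, hQ₂⟩)] at hsum
    have l1 := Nat.mul_le_mul_right (Ideal.inertiaDeg' p.asIdeal P₁.asIdeal) e1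
    have l2 := Nat.mul_le_mul_right (Ideal.inertiaDeg' p.asIdeal P₂.asIdeal) e2
    have g1 : Ideal.inertiaDeg' p.asIdeal P₁.asIdeal = 1 := by lia
    have g2 : Ideal.inertiaDeg' p.asIdeal P₂.asIdeal = 1 := by lia
    refine ⟨P₁, P₂, fun h ↦ hne (by rw [h]), fun Q ↦ ?_, by rw [n1, g1, pow_one],
      by rw [n2, g2, pow_one]⟩
    rw [hmem]
    refine ⟨fun h ↦ ?_, ?_⟩
    · by_contra! hQ
      have hQ' : Q.asIdeal ∈ (S.erase P₁.asIdeal).erase P₂.asIdeal :=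
        Finset.mem_erase.2 ⟨fun h ↦ hQ.2 (HeightOneSpectrum.ext h),
          Finset.mem_erase.2 ⟨fun h ↦ hQ.1 (HeightOneSpectrum.ext h), h⟩⟩
      rw [← Finset.add_sum_erase _ _ hQ'] at hsum
      obtain ⟨e3, f3, -⟩ := hef _ h
      have l3 := Nat.mul_pos e3 f3
      lia
    · rintro (rfl | rfl) <;> assumption

theorem IsInertAt.not_isSplitAt {p : HeightOneSpectrum (𝓞 F)} (h : IsInertAt F K p) :
    ¬ IsSplitAt F K p := by
  rintro ⟨P₁, P₂, hne, hfib, -⟩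
  obtain ⟨P, hP, -⟩ := h
  exact hne (((hP P₁).1 ((hfib P₁).2 (Or.inl rfl))).trans
    ((hP P₂).1 ((hfib P₂).2 (Or.inr rfl))).symm)

open scoped Classical in
variable (F K) in
/-- The quadratic character of `K / F` at a prime of `F`. -/
noncomputable def splitSign (p : HeightOneSpectrum (𝓞 F)) : ℝ :=
  if IsSplitAt F K p then 1 else if IsInertAt F K p then -1 else 0

theorem splitSign_eq (p : HeightOneSpectrum (𝓞 F)) :
    splitSign F K p = 1 ∨ splitSign F K p = -1 ∨ splitSign F K p = 0 := by
  unfold splitSign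
  split_ifs <;> simp

theorem splitSign_eq_neg_one_iff {p : HeightOneSpectrum (𝓞 F)} :
    splitSign F K p = -1 ↔ IsInertAt F K p := by
  unfold splitSign
  split_ifs with h1 h2
  · exact ⟨fun h ↦ by norm_num at h, fun h ↦ absurd h1 h.not_isSplitAt⟩
  · simpa
  · simpa

theorem splitSign_eq_one_iff {p : HeightOneSpectrum (𝓞 F)} :
    splitSign F K p = 1 ↔ IsSplitAt F K p := by
  unfold splitSign
  split_ifs with h1 h2
  · simpa
  · simp only [h1, iff_false]; norm_num
  · simpa

theorem hasSum_fiber (h2 : finrank F K = 2) (p : HeightOneSpectrum (𝓞 F)) {s : ℝ} (hs : 0 < s) :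
    HasSum (fun P : {P : HeightOneSpectrum (𝓞 K) // P.under (𝓞 F) = p} ↦
      -Real.log (1 - (Ideal.absNorm P.1.asIdeal : ℝ) ^ (-s)))
      (-Real.log (1 - (Ideal.absNorm p.asIdeal : ℝ) ^ (-s)) +
        -Real.log (1 - splitSign F K p * (Ideal.absNorm p.asIdeal : ℝ) ^ (-s))) := by
  classical
  have key : ∀ T : Finset (HeightOneSpectrum (𝓞 K)), (∀ P, P.under (𝓞 F) = p ↔ P ∈ T) →
      HasSum (fun P : {P : HeightOneSpectrum (𝓞 K) // P.under (𝓞 F) = p} ↦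
        -Real.log (1 - (Ideal.absNorm P.1.asIdeal : ℝ) ^ (-s)))
        (∑ P ∈ T, -Real.log (1 - (Ideal.absNorm P.asIdeal : ℝ) ^ (-s))) := by
    intro T hT
    have := T.hasSum (fun P ↦ -Real.log (1 - (Ideal.absNorm P.asIdeal : ℝ) ^ (-s)))
    exact (Equiv.subtypeEquivRight hT).hasSum_iff.2 this
  by_cases h1 : IsSplitAt F K p
  · rw [splitSign_eq_one_iff.2 h1, one_mul]
    obtain ⟨P₁, P₂, hne, hfib, n1, n2⟩ := h1
    convert key {P₁, P₂} (by simpa using hfib) using 1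
    rw [Finset.sum_pair hne, n1, n2]
  by_cases h3 : IsInertAt F K p
  · rw [splitSign_eq_neg_one_iff.2 h3]
    obtain ⟨P, hfib, n1⟩ := h3
    convert key {P} (by simpa using hfib) using 1
    have hx := absNorm_rpow_mem p hs
    rw [Finset.sum_singleton, n1, ← neg_add, ← Real.log_mul (by linarith) (by linarith)]
    push_cast
    rw [← Real.rpow_natCast, ← Real.rpow_mul (by positivity), mul_comm _ (-s),
      Real.rpow_mul (by positivity), Real.rpow_natCast]
    congr 2
    ring
  · obtain ⟨P, hfib, n1⟩ := ((isSplitAt_or h2 p).resolve_left h1).resolve_right h3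
    convert key {P} (by simpa using hfib) using 1
    rw [Finset.sum_singleton, n1, splitSign, if_neg h1, if_neg h3]
    simp

theorem hasSum_log_idealZeta_quadratic (h2 : finrank F K = 2) {Θ : ℝ} (h : IsCoveringBound K Θ)
    {s : ℝ} (hs : 1 < s) :
    HasSum (fun p : HeightOneSpectrum (𝓞 F) ↦
      -Real.log (1 - (Ideal.absNorm p.asIdeal : ℝ) ^ (-s)) +
        -Real.log (1 - splitSign F K p * (Ideal.absNorm p.asIdeal : ℝ) ^ (-s)))
      (Real.log (idealZeta K s)) := by
  have h1 := (hasSum_log_idealZeta (by linarith) (idealZeta_spec h hs).1).2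
  rw [← (Equiv.sigmaFiberEquiv fun P : HeightOneSpectrum (𝓞 K) ↦ P.under (𝓞 F)).hasSum_iff] at h1
  exact h1.sigma fun p ↦ hasSum_fiber h2 p (by linarith)

end NumberField

namespace NumberField

open Module IsDedekindDomain

theorem natCard_le_of_forall_pow_eq {κ : Type*} [Field κ] {q : ℕ} (hq : 1 < q)
    (h : ∀ x : κ, x ^ q = x) : Nat.card κ ≤ q := by
  classical
  have hne : (Polynomial.X ^ q - Polynomial.X : Polynomial κ) ≠ 0 :=
    FiniteField.X_pow_card_sub_X_ne_zero κ hq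
  have hsub : (Set.univ : Set κ) ⊆
      ((Polynomial.X ^ q - Polynomial.X : Polynomial κ).roots.toFinset : Set κ) := by
    intro x _
    simp [hne, h x]
  calc Nat.card κ = (Set.univ : Set κ).ncard := (Set.ncard_univ κ).symm
    _ ≤ (Polynomial.X ^ q - Polynomial.X : Polynomial κ).roots.toFinset.card := by
        rw [← Set.ncard_coe_finset]
        exact Set.ncard_le_ncard hsub (Finset.finite_toSet _)
    _ ≤ q := (Multiset.toFinset_card_le _).trans ((Polynomial.card_roots' _).trans
        (FiniteField.X_pow_card_sub_X_natDegree_eq κ hq).le)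

section

variable {F K₁ K₂ K₃ M : Type*} [Field F] [Field K₁] [Field K₂] [Field K₃] [Field M]
  [Algebra F M] [Algebra K₁ M] [Algebra K₂ M] [Algebra K₃ M]

variable (K₁ K₂ K₃) in
/-- The Galois group of `M / F` is `{1, g₁, g₂, g₃}` and `Kᵢ` is the fixed field of `gᵢ`. -/
structure IsBiquadratic (g₁ g₂ g₃ : Gal(M/F)) : Prop where
  eq_or : ∀ σ : Gal(M/F), σ = 1 ∨ σ = g₁ ∨ σ = g₂ ∨ σ = g₃
  mul_self₁ : g₁ * g₁ = 1
  mul_self₂ : g₂ * g₂ = 1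
  mul_self₃ : g₃ * g₃ = 1
  mul_eq : g₁ * g₂ = g₃
  fixed₁ : ∀ y, g₁ y = y ↔ y ∈ (algebraMap K₁ M).range
  fixed₂ : ∀ y, g₂ y = y ↔ y ∈ (algebraMap K₂ M).range
  fixed₃ : ∀ y, g₃ y = y ↔ y ∈ (algebraMap K₃ M).range

variable {g₁ g₂ g₃ : Gal(M/F)}

theorem IsBiquadratic.commute (h : IsBiquadratic K₁ K₂ K₃ g₁ g₂ g₃) : g₁ * g₂ = g₂ * g₁ := by
  have h3 := h.mul_self₃
  rw [← h.mul_eq] at h3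
  rw [eq_inv_of_mul_eq_one_left h3, mul_inv_rev, ← eq_inv_of_mul_eq_one_left h.mul_self₁,
    ← eq_inv_of_mul_eq_one_left h.mul_self₂]

theorem IsBiquadratic.rotate (h : IsBiquadratic K₁ K₂ K₃ g₁ g₂ g₃) :
    IsBiquadratic K₂ K₃ K₁ g₂ g₃ g₁ :=
  ⟨fun σ ↦ by have := h.eq_or σ; tauto, h.mul_self₂, h.mul_self₃, h.mul_self₁,
    by rw [← h.mul_eq, h.commute, ← mul_assoc, h.mul_self₂, one_mul], h.fixed₂, h.fixed₃, h.fixed₁⟩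

theorem smul_algebraMap_ringOfIntegers {K : Type*} [Field K] [NumberField K] [Algebra K M]
    {g : Gal(M/F)} (hg : ∀ y, g y = y ↔ y ∈ (algebraMap K M).range) (y : 𝓞 K) :
    g • algebraMap (𝓞 K) (𝓞 M) y = algebraMap (𝓞 K) (𝓞 M) y :=
  RingOfIntegers.ext ((hg _).2 ⟨y, rfl⟩)

theorem exists_algebraMap_eq_of_smul_eq {K : Type*} [Field K] [NumberField K] [Algebra K M]
    {g : Gal(M/F)} (hg : ∀ y, g y = y ↔ y ∈ (algebraMap K M).range) {x : 𝓞 M} (hx : g • x = x) :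
    ∃ y : 𝓞 K, algebraMap (𝓞 K) (𝓞 M) y = x := by
  obtain ⟨y, hy⟩ := (hg x).1 (congrArg (algebraMap (𝓞 M) M) hx)
  have hint : IsIntegral ℤ y := by
    rw [← isIntegral_algebraMap_iff (algebraMap K M).injective, hy]
    exact RingOfIntegers.isIntegral_coe x
  exact ⟨⟨y, hint⟩, RingOfIntegers.ext hy⟩

theorem smul_mem_of_forall_under_eq {K : Type*} [Field K] [NumberField K] [Algebra F K]
    [Algebra K M] [IsScalarTower F K M] {g τ : Gal(M/F)}
    (hg : ∀ y, g y = y ↔ y ∈ (algebraMap K M).range) (hgg : g * g = 1)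
    (hτ : τ * g = g * τ) {p : HeightOneSpectrum (𝓞 F)} {P : HeightOneSpectrum (𝓞 K)}
    (hP : ∀ Q : HeightOneSpectrum (𝓞 K), Q.under (𝓞 F) = p ↔ Q = P)
    {Q : HeightOneSpectrum (𝓞 M)} (hQ : Q.under (𝓞 F) = p)
    (hgQ : ∀ x ∈ Q.asIdeal, g • x ∈ Q.asIdeal) {x : 𝓞 M} (hx : x ∈ Q.asIdeal) :
    τ • x ∈ Q.asIdeal := by
  let Q' : HeightOneSpectrum (𝓞 M) :=
    { asIdeal := Q.asIdeal.comap (MulSemiringAction.toRingHom _ (𝓞 M) τ)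
      isPrime := Q.isPrime.comap _
      ne_bot := by
        obtain ⟨z, hz, hz0⟩ := Submodule.exists_mem_ne_zero_of_ne_bot Q.ne_bot
        refine Submodule.ne_bot_iff _ |>.2 ⟨τ⁻¹ • z, ?_, fun h ↦ hz0 (by
          rw [← smul_inv_smul τ z, h, smul_zero])⟩
        simpa using hz }
  have hmem : ∀ z : 𝓞 M, z ∈ Q'.asIdeal ↔ τ • z ∈ Q.asIdeal := fun z ↦ Iff.rfl
  have hQ' : Q'.under (𝓞 F) = p := by
    rw [← hQ]
    ext z
    simp only [HeightOneSpectrum.under_asIdeal, Ideal.mem_comap, hmem]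
    have : τ • algebraMap (𝓞 F) (𝓞 M) z = algebraMap (𝓞 F) (𝓞 M) z :=
      RingOfIntegers.ext (τ.commutes (z : F))
    rw [this]
  have hK : ∀ Q : HeightOneSpectrum (𝓞 M), Q.under (𝓞 F) = p → Q.under (𝓞 K) = P := by
    intro Q hQ
    rw [← hP, ← hQ]
    ext z
    simp only [HeightOneSpectrum.under_asIdeal, Ideal.mem_comap,
      ← IsScalarTower.algebraMap_apply]
  have hfix : g • (x * g • x) = x * g • x := by
    rw [smul_mul', smul_smul, hgg, one_smul, mul_comm]
  obtain ⟨y, hy⟩ := exists_algebraMap_eq_of_smul_eq hg hfix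
  have hyP : y ∈ P.asIdeal := by
    rw [← hK Q hQ, HeightOneSpectrum.under_asIdeal, Ideal.mem_comap, hy]
    exact Q.asIdeal.mul_mem_right _ hx
  rw [← hK Q' hQ', HeightOneSpectrum.under_asIdeal, Ideal.mem_comap, hy, hmem, smul_mul',
    smul_smul, hτ, ← smul_smul] at hyP
  refine (Q.isPrime.mem_or_mem hyP).elim id fun h ↦ ?_
  have := hgQ _ h
  rwa [smul_smul, hgg, one_smul] at this

variable [NumberField F]

theorem IsInertAt.exists_pow_sub_notMem {K : Type*} [Field K] [NumberField K] [Algebra F K]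
    [Algebra K M] [IsScalarTower F K M] {p : HeightOneSpectrum (𝓞 F)} (h : IsInertAt F K p)
    {Q : HeightOneSpectrum (𝓞 M)} (hQ : Q.under (𝓞 F) = p) :
    Nat.card (𝓞 K ⧸ Q.asIdeal.under (𝓞 K)) = Ideal.absNorm p.asIdeal ^ 2 ∧
    ∃ y : 𝓞 K, algebraMap (𝓞 K) (𝓞 M) y ^ Ideal.absNorm p.asIdeal - algebraMap (𝓞 K) (𝓞 M) y
      ∉ Q.asIdeal := by
  obtain ⟨P, hP, hN⟩ := h
  have hQP : Q.under (𝓞 K) = P := by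
    rw [← hP, ← hQ]
    ext z
    simp only [HeightOneSpectrum.under_asIdeal, Ideal.mem_comap,
      ← IsScalarTower.algebraMap_apply]
  have hQP' : Q.asIdeal.under (𝓞 K) = P.asIdeal := by rw [← hQP]; rfl
  rw [Ideal.absNorm_apply P.asIdeal, Submodule.cardQuot_apply] at hN
  refine ⟨hQP' ▸ hN, ?_⟩
  by_contra! hall
  have := P.isMaximal
  let := Ideal.Quotient.field P.asIdeal
  have hq : 1 < Ideal.absNorm p.asIdeal := by exact_mod_cast one_lt_absNorm p
  have hle : Nat.card (𝓞 K ⧸ P.asIdeal) ≤ Ideal.absNorm p.asIdeal := by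
    refine natCard_le_of_forall_pow_eq hq fun x ↦ ?_
    obtain ⟨y, rfl⟩ := Ideal.Quotient.mk_surjective x
    rw [← map_pow, Ideal.Quotient.eq, ← hQP', Ideal.mem_comap, map_sub, map_pow]
    exact hall y
  rw [hN] at hle
  nlinarith

variable [NumberField K₁] [NumberField K₂] [NumberField K₃] [NumberField M]
  [Algebra F K₁] [Algebra F K₂] [Algebra F K₃] [IsScalarTower F K₁ M] [IsScalarTower F K₂ M]
  [IsScalarTower F K₃ M]

theorem IsBiquadratic.isSplitAt [IsGalois F M] (h : IsBiquadratic K₁ K₂ K₃ g₁ g₂ g₃)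
    (h2 : finrank F K₃ = 2) {p : HeightOneSpectrum (𝓞 F)} (h₁ : IsInertAt F K₁ p)
    (h₂ : IsInertAt F K₂ p) : IsSplitAt F K₃ p := by
  have := p.isMaximal
  obtain ⟨I, hI, hIp⟩ := Ideal.exists_maximal_ideal_liesOver_of_isIntegral (S := 𝓞 M) p.asIdeal
  let Q : HeightOneSpectrum (𝓞 M) := ⟨I, hI.isPrime, Ideal.ne_bot_of_liesOver_of_ne_bot p.ne_bot I⟩
  have hQ : Q.under (𝓞 F) = p := HeightOneSpectrum.ext hIp.over.symm
  have hfin : Finite (𝓞 M ⧸ Q.asIdeal) := Ideal.finiteQuotientOfFreeOfNeBot _ Q.ne_bot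
  have := Q.isPrime
  obtain ⟨σ, hσ⟩ := IsArithFrobAt.exists_of_isInvariant (𝓞 F) Gal(M/F) Q.asIdeal
  set q := Ideal.absNorm p.asIdeal with hq
  have hσ' : ∀ x : 𝓞 M, σ • x - x ^ q ∈ Q.asIdeal := by
    intro x
    have := hσ x
    rw [← HeightOneSpectrum.under_asIdeal, hQ] at this
    rwa [hq, Ideal.absNorm_apply p.asIdeal, Submodule.cardQuot_apply]
  obtain ⟨c₁, y₁, hy₁⟩ := h₁.exists_pow_sub_notMem hQ
  obtain ⟨c₂, y₂, hy₂⟩ := h₂.exists_pow_sub_notMem hQ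
  rw [← neg_mem_iff, neg_sub] at hy₁ hy₂
  have hσ1 : σ = g₃ := by
    rcases h.eq_or σ with h0 | h0 | h0 | h0
    · have := hσ' (algebraMap (𝓞 K₁) (𝓞 M) y₁)
      rw [h0, one_smul] at this
      exact absurd this hy₁
    · have := hσ' (algebraMap (𝓞 K₁) (𝓞 M) y₁)
      rw [h0, smul_algebraMap_ringOfIntegers h.fixed₁] at this
      exact absurd this hy₁
    · have := hσ' (algebraMap (𝓞 K₂) (𝓞 M) y₂)
      rw [h0, smul_algebraMap_ringOfIntegers h.fixed₂] at this
      exact absurd this hy₂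
    · exact h0
  subst hσ1
  by_contra hns
  obtain ⟨P, hP⟩ : ∃ P : HeightOneSpectrum (𝓞 K₃), ∀ Q : HeightOneSpectrum (𝓞 K₃),
      Q.under (𝓞 F) = p ↔ Q = P := by
    rcases (isSplitAt_or h2 p).resolve_left hns with ⟨P, hP, -⟩ | ⟨P, hP, -⟩ <;> exact ⟨P, hP⟩
  have hmk : ∀ x : 𝓞 M, Ideal.Quotient.mk Q.asIdeal (σ • x) = Ideal.Quotient.mk Q.asIdeal x ^ q :=
    fun x ↦ by rw [← map_pow, Ideal.Quotient.eq]; exact hσ' x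
  have hq1 : 1 < q := by exact_mod_cast one_lt_absNorm p
  have hσQ : ∀ x ∈ Q.asIdeal, σ • x ∈ Q.asIdeal := by
    intro x hx
    rw [← Ideal.Quotient.eq_zero_iff_mem] at hx ⊢
    rw [hmk, hx, zero_pow (by lia)]
  have hcard : Nat.card (𝓞 M ⧸ Q.asIdeal) ≤ q ^ 2 := by
    have := Q.isMaximal
    let := Ideal.Quotient.field Q.asIdeal
    refine natCard_le_of_forall_pow_eq (by nlinarith) fun x ↦ ?_
    obtain ⟨x, rfl⟩ := Ideal.Quotient.mk_surjective x
    rw [sq, pow_mul, ← hmk, ← hmk, smul_smul, h.mul_self₃, one_smul]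
  have hsurj : Function.Surjective
      (algebraMap (𝓞 K₁ ⧸ Q.asIdeal.under (𝓞 K₁)) (𝓞 M ⧸ Q.asIdeal)) :=
    (Ideal.algebraMap_quotient_injective.bijective_of_nat_card_le
      (by rw [c₁]; exact hcard)).surjective
  have hg₁ : ∀ x : 𝓞 M, Ideal.Quotient.mk Q.asIdeal (g₁ • x) = Ideal.Quotient.mk Q.asIdeal x := by
    intro x
    obtain ⟨y, hy⟩ := hsurj (Ideal.Quotient.mk Q.asIdeal x)
    obtain ⟨y, rfl⟩ := Ideal.Quotient.mk_surjective y
    rw [Ideal.Quotient.algebraMap_mk_of_liesOver, Ideal.Quotient.eq] at hy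
    have hc : g₁ * σ = σ * g₁ := h.rotate.rotate.commute.symm
    have := smul_mem_of_forall_under_eq h.fixed₃ h.mul_self₃ hc hP hQ hσQ hy
    rw [smul_sub, smul_algebraMap_ringOfIntegers h.fixed₁] at this
    rw [Ideal.Quotient.eq]
    convert Q.asIdeal.sub_mem hy this using 1
    ring
  refine hy₂ ?_
  rw [← Ideal.Quotient.eq, map_pow, ← hmk, ← h.mul_eq, mul_smul,
    smul_algebraMap_ringOfIntegers h.fixed₂, hg₁]

/-- The Euler factors of the zeta functions of a biquadratic extension multiply to that of its
top field, whence the logarithmic coefficients are nonnegative. -/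
theorem IsBiquadratic.splitSign_pow_nonneg [IsGalois F M]
    (h : IsBiquadratic K₁ K₂ K₃ g₁ g₂ g₃) (d₁ : finrank F K₁ = 2) (d₂ : finrank F K₂ = 2)
    (d₃ : finrank F K₃ = 2) (p : HeightOneSpectrum (𝓞 F)) (k : ℕ) :
    0 ≤ 1 + splitSign F K₁ p ^ k + splitSign F K₂ p ^ k + splitSign F K₃ p ^ k := by
  have e3 := fun h₁ h₂ ↦ splitSign_eq_one_iff.2 (h.isSplitAt d₃ (p := p)
    (splitSign_eq_neg_one_iff.1 h₁) (splitSign_eq_neg_one_iff.1 h₂))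
  have e1 := fun h₂ h₃ ↦ splitSign_eq_one_iff.2 (h.rotate.isSplitAt d₁ (p := p)
    (splitSign_eq_neg_one_iff.1 h₂) (splitSign_eq_neg_one_iff.1 h₃))
  have e2 := fun h₃ h₁ ↦ splitSign_eq_one_iff.2 (h.rotate.rotate.isSplitAt d₂ (p := p)
    (splitSign_eq_neg_one_iff.1 h₃) (splitSign_eq_neg_one_iff.1 h₁))
  have hz : (0 : ℝ) ≤ 0 ^ k := by positivity
  rcases Nat.even_or_odd k with hk | hk
  · have := hk.pow_nonneg (splitSign F K₁ p)
    have := hk.pow_nonneg (splitSign F K₂ p)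
    have := hk.pow_nonneg (splitSign F K₃ p)
    linarith
  · rcases splitSign_eq (K := K₁) p with h1 | h1 | h1 <;>
    rcases splitSign_eq (K := K₂) p with h2 | h2 | h2 <;>
    rcases splitSign_eq (K := K₃) p with h3 | h3 | h3 <;>
    first
    | (rw [h1, h2, h3]; try simp only [one_pow, hk.neg_one_pow]
       linarith)
    | (have := e1 h2 h3; linarith)
    | (have := e2 h3 h1; linarith)
    | (have := e3 h1 h2; linarith)

end

end NumberField

namespace NumberField

universe u

open Module IsDedekindDomain IntermediateField

theorem exists_isBiquadratic {F K₁ K₂ M : Type*} [Field F] [Field K₁] [Field K₂] [Field M]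
    [Algebra F M] [Algebra K₁ M] [Algebra K₂ M] [FiniteDimensional F M] [IsGalois F M]
    {E₁ E₂ : IntermediateField F M} (h₁ : ∀ y, y ∈ E₁ ↔ y ∈ (algebraMap K₁ M).range)
    (h₂ : ∀ y, y ∈ E₂ ↔ y ∈ (algebraMap K₂ M).range) (d₁ : finrank F E₁ = 2)
    (d₂ : finrank F E₂ = 2) (hne : E₁ ≠ E₂) (hsup : E₁ ⊔ E₂ = ⊤) :
    ∃ g₁ g₂ : Gal(M/F), finrank F (fixedField (Subgroup.zpowers (g₁ * g₂))) = 2 ∧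
      IsBiquadratic K₁ K₂ (fixedField (Subgroup.zpowers (g₁ * g₂))) g₁ g₂ (g₁ * g₂) := by
  have i₁ : E₁.fixingSubgroup.index = 2 := by rw [← finrank_eq_fixingSubgroup_index, d₁]
  have i₂ : E₂.fixingSubgroup.index = 2 := by rw [← finrank_eq_fixingSubgroup_index, d₂]
  have hle : ∀ {A B : IntermediateField F M}, finrank F A = 2 → finrank F B = 2 → A ≠ B →
      ∃ g ∈ A.fixingSubgroup, g ∉ B.fixingSubgroup := by
    intro A B dA dB hAB
    by_contra! h
    have hBA : B ≤ A := by
      rw [← IsGalois.fixedField_fixingSubgroup A, ← IsGalois.fixedField_fixingSubgroup B]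
      exact fixedField_antitone h
    exact hAB (eq_of_le_of_finrank_eq hBA (dB.trans dA.symm)).symm
  obtain ⟨g₁, h11, h12⟩ := hle d₁ d₂ hne
  obtain ⟨g₂, h22, h21⟩ := hle d₂ d₁ hne.symm
  have hbot : ∀ σ : Gal(M/F), σ ∈ E₁.fixingSubgroup → σ ∈ E₂.fixingSubgroup → σ = 1 := by
    intro σ hσ₁ hσ₂
    have : σ ∈ (E₁ ⊔ E₂).fixingSubgroup := by
      rw [fixingSubgroup_sup]
      exact ⟨hσ₁, hσ₂⟩
    rwa [hsup, fixingSubgroup_top, Subgroup.mem_bot] at this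
  have m₁ := fun a b : Gal(M/F) ↦ Subgroup.mul_mem_iff_of_index_two (a := a) (b := b) i₁
  have m₂ := fun a b : Gal(M/F) ↦ Subgroup.mul_mem_iff_of_index_two (a := a) (b := b) i₂
  have s₁ : g₁ * g₁ = 1 := hbot _ (by rw [m₁]) (by rw [m₂])
  have s₂ : g₂ * g₂ = 1 := hbot _ (by rw [m₁]) (by rw [m₂])
  have s₃ : (g₁ * g₂) * (g₁ * g₂) = 1 := hbot _ (by rw [m₁]) (by rw [m₂])
  have hext : ∀ {σ g : Gal(M/F)}, g * g = 1 → (σ ∈ E₁.fixingSubgroup ↔ g ∈ E₁.fixingSubgroup) →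
      (σ ∈ E₂.fixingSubgroup ↔ g ∈ E₂.fixingSubgroup) → σ = g := by
    intro σ g hg a b
    have := hbot (σ * g) (by rw [m₁, a]) (by rw [m₂, b])
    rw [eq_inv_of_mul_eq_one_left this, ← eq_inv_of_mul_eq_one_left hg]
  have n1 : g₁ ≠ 1 := fun h ↦ h12 (h ▸ one_mem _)
  have n2 : g₂ ≠ 1 := fun h ↦ h21 (h ▸ one_mem _)
  have n3 : g₁ * g₂ ≠ 1 := by
    intro h
    have : g₁ * g₂ ∉ E₁.fixingSubgroup := by rw [m₁]; tauto
    exact this (h ▸ one_mem _)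
  have z₁ : E₁.fixingSubgroup = Subgroup.zpowers g₁ := by
    refine le_antisymm (fun σ hσ ↦ ?_) (by simpa using h11)
    by_cases h : σ ∈ E₂.fixingSubgroup
    · rw [hbot σ hσ h]
      exact one_mem _
    · have hσg : σ = g₁ := hext s₁ (by tauto) (by tauto)
      rw [hσg]
      exact Subgroup.mem_zpowers g₁
  have z₂ : E₂.fixingSubgroup = Subgroup.zpowers g₂ := by
    refine le_antisymm (fun σ hσ ↦ ?_) (by simpa using h22)
    by_cases h : σ ∈ E₁.fixingSubgroup
    · rw [hbot σ h hσ]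
      exact one_mem _
    · have hσg : σ = g₂ := hext s₂ (by tauto) (by tauto)
      rw [hσg]
      exact Subgroup.mem_zpowers g₂
  have hz : ∀ (g : Gal(M/F)) y, y ∈ fixedField (Subgroup.zpowers g) ↔ g y = y := by
    intro g y
    rw [mem_fixedField_iff]
    refine ⟨fun h ↦ h g (Subgroup.mem_zpowers g), fun h σ hσ ↦ ?_⟩
    exact (Subgroup.zpowers_le.2 (show g ∈ MulAction.stabilizer Gal(M/F) y from h) hσ :)
  have ho : ∀ {g : Gal(M/F)}, g ≠ 1 → g * g = 1 → Nat.card (Subgroup.zpowers g) = 2 := by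
    intro g hg hgg
    rw [Nat.card_zpowers]
    exact orderOf_eq_prime (by rw [sq, hgg]) hg
  refine ⟨g₁, g₂, ?_, ⟨fun σ ↦ ?_, s₁, s₂, s₃, rfl, fun y ↦ ?_, fun y ↦ ?_, fun y ↦ ?_⟩⟩
  · rw [finrank_eq_fixingSubgroup_index, fixingSubgroup_fixedField]
    have c₁ := E₁.fixingSubgroup.card_mul_index
    have c₃ := (Subgroup.zpowers (g₁ * g₂)).card_mul_index
    rw [i₁, z₁, ho n1 s₁] at c₁
    rw [ho n3 s₃] at c₃
    lia
  · by_cases a : σ ∈ E₁.fixingSubgroup <;> by_cases b : σ ∈ E₂.fixingSubgroup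
    · exact Or.inl (hbot _ a b)
    · exact Or.inr (Or.inl (hext s₁ (by tauto) (by tauto)))
    · exact Or.inr (Or.inr (Or.inl (hext s₂ (by tauto) (by tauto))))
    · refine Or.inr (Or.inr (Or.inr (hext s₃ ?_ ?_)))
      · rw [m₁]; tauto
      · rw [m₂]; tauto
  · rw [← h₁, ← IsGalois.fixedField_fixingSubgroup E₁, z₁, hz]
  · rw [← h₂, ← IsGalois.fixedField_fixingSubgroup E₂, z₂, hz]
  · rw [← hz]
    exact ⟨fun h ↦ ⟨⟨y, h⟩, rfl⟩, fun ⟨z, hz⟩ ↦ hz ▸ z.2⟩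

theorem InfinitePlace.apply_smul_algebraMap_le {F K M : Type*} [Field F] [Field K] [Field M]
    [Algebra F M] [Algebra K M] {α : 𝓞 K} {T : ℝ} (hT : ∀ w : InfinitePlace K, w α ≤ T)
    (W : InfinitePlace M) (g : Gal(M/F)) : W (g • algebraMap (𝓞 K) (𝓞 M) α : 𝓞 M) ≤ T :=
  hT (W.comap ((g : M →+* M).comp (algebraMap K M)))

theorem InfinitePlace.apply_sub_le {M : Type*} [Field M] (W : InfinitePlace M) (x y : M) :
    W (x - y) ≤ W x + W y := by
  rw [← norm_embedding_eq, ← norm_embedding_eq, ← norm_embedding_eq, map_sub]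
  exact norm_sub_le _ _

theorem IsBiquadratic.isCoveringBound {F K₁ K₂ K₃ M : Type*} [Field F] [Field K₁] [Field K₂]
    [Field K₃] [Field M] [NumberField F] [NumberField K₁] [NumberField K₂] [NumberField K₃]
    [NumberField M] [Algebra F M] [Algebra K₁ M] [Algebra K₂ M] [Algebra K₃ M] [Algebra F K₁]
    [Algebra F K₂] [Algebra F K₃] [IsScalarTower F K₁ M] [IsScalarTower F K₂ M]
    [IsScalarTower F K₃ M] [IsGalois F M]
    {g₁ g₂ g₃ : Gal(M/F)} (h : IsBiquadratic K₁ K₂ K₃ g₁ g₂ g₃) (d₃ : finrank F K₃ = 2)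
    {α₁ : 𝓞 K₁} {α₂ : 𝓞 K₂} (hα₁ : (α₁ : K₁) ∉ (algebraMap F K₁).range)
    (hα₂ : (α₂ : K₂) ∉ (algebraMap F K₂).range) {T₁ T₂ : ℝ}
    (hT₁ : ∀ w : InfinitePlace K₁, w α₁ ≤ T₁) (hT₂ : ∀ w : InfinitePlace K₂, w α₂ ≤ T₂) :
    IsCoveringBound K₃ (basisHeight F * (1 + 4 * T₁ * T₂)) := by
  set a := algebraMap (𝓞 K₁) (𝓞 M) α₁ with ha
  set b := algebraMap (𝓞 K₂) (𝓞 M) α₂ with hb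
  have ga : g₁ • a = a := smul_algebraMap_ringOfIntegers h.fixed₁ α₁
  have gb : g₂ • b = b := smul_algebraMap_ringOfIntegers h.fixed₂ α₂
  have hmem : ∀ y : M, g₁ y = y → g₂ y = y → y ∈ (algebraMap F M).range := by
    intro y h1 h2
    refine (IsGalois.mem_bot_iff_fixed y).2 fun σ ↦ ?_
    rcases h.eq_or σ with rfl | rfl | rfl | rfl
    · rfl
    · exact h1
    · exact h2
    · rw [← h.mul_eq, AlgEquiv.mul_apply, h2, h1]
  have ha2 : a - g₂ • a ≠ 0 := by
    intro h0
    obtain ⟨z, hz⟩ := hmem a (congrArg (algebraMap (𝓞 M) M) ga)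
      (congrArg (algebraMap (𝓞 M) M) (sub_eq_zero.1 h0).symm)
    refine hα₁ ⟨z, (algebraMap K₁ M).injective ?_⟩
    rw [← IsScalarTower.algebraMap_apply, hz]
    rfl
  have hb1 : b - g₁ • b ≠ 0 := by
    intro h0
    obtain ⟨z, hz⟩ := hmem b (congrArg (algebraMap (𝓞 M) M) (sub_eq_zero.1 h0).symm)
      (congrArg (algebraMap (𝓞 M) M) gb)
    refine hα₂ ⟨z, (algebraMap K₂ M).injective ?_⟩
    rw [← IsScalarTower.algebraMap_apply, hz]
    rfl
  set c := (a - g₂ • a) * (b - g₁ • b) with hc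
  have c1 : g₁ • c = -c := by
    rw [hc, smul_mul', smul_sub, smul_sub, smul_smul, smul_smul, h.commute, ← smul_smul, ga,
      h.mul_self₁, one_smul]
    ring
  have c2 : g₂ • c = -c := by
    rw [hc, smul_mul', smul_sub, smul_sub, smul_smul, smul_smul, ← h.commute, ← smul_smul g₁, gb,
      h.mul_self₂, one_smul]
    ring
  have c3 : g₃ • c = c := by rw [← h.mul_eq, mul_smul, c2, smul_neg, c1, neg_neg]
  obtain ⟨γ, hγ⟩ := exists_algebraMap_eq_of_smul_eq h.fixed₃ c3
  have hT0 : 0 ≤ T₁ := (apply_nonneg _ _).trans (hT₁ (Classical.arbitrary _))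
  have hT0' : 0 ≤ T₂ := (apply_nonneg _ _).trans (hT₂ (Classical.arbitrary _))
  refine isCoveringBound_of_quadratic d₃ (γ := γ) ?_ (by positivity) ?_
  · rintro ⟨z, hz⟩
    have hz' : algebraMap F M z = c := by
      rw [IsScalarTower.algebraMap_apply F K₃ M, hz, ← hγ]
      rfl
    have : g₁ c = (c : M) := by rw [← hz', AlgEquiv.commutes]
    have : g₁ • c = c := RingOfIntegers.ext this
    rw [c1, neg_eq_self] at this
    exact mul_ne_zero ha2 hb1 this
  · intro w
    obtain ⟨W, rfl⟩ := InfinitePlace.comap_surjective (k := K₃) (K := M) w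
    have e : (W.comap (algebraMap K₃ M)) γ = W ((a : M) - (g₂ • a : 𝓞 M)) *
        W ((b : M) - (g₁ • b : 𝓞 M)) := by
      rw [← map_mul, ← map_sub, ← map_sub, ← map_mul, ← hc, ← hγ]
      rfl
    have t1 := W.apply_sub_le (a : M) (g₂ • a : 𝓞 M)
    have t2 := W.apply_sub_le (b : M) (g₁ • b : 𝓞 M)
    have b1 := InfinitePlace.apply_smul_algebraMap_le hT₁ W g₂
    have b2 := InfinitePlace.apply_smul_algebraMap_le hT₁ W (1 : Gal(M/F))
    have b3 := InfinitePlace.apply_smul_algebraMap_le hT₂ W g₁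
    have b4 := InfinitePlace.apply_smul_algebraMap_le hT₂ W (1 : Gal(M/F))
    rw [one_smul, ← ha] at b2
    rw [one_smul, ← hb] at b4
    rw [e]
    calc _ ≤ (2 * T₁) * (2 * T₂) := mul_le_mul (by linarith) (by linarith) (apply_nonneg _ _)
          (by linarith)
      _ = _ := by ring

theorem exists_third_quadratic {F : Type*} {Ω : Type u} [Field F] [NumberField F] [Field Ω]
    [Algebra F Ω] {K₁ K₂ : IntermediateField F Ω} [NumberField K₁] [NumberField K₂]
    (d₁ : finrank F K₁ = 2) (d₂ : finrank F K₂ = 2) (hne : K₁ ≠ K₂)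
    {α₁ : 𝓞 K₁} {α₂ : 𝓞 K₂} (hα₁ : (α₁ : K₁) ∉ (algebraMap F K₁).range)
    (hα₂ : (α₂ : K₂) ∉ (algebraMap F K₂).range) {T₁ T₂ : ℝ}
    (hT₁ : ∀ w : InfinitePlace K₁, w α₁ ≤ T₁) (hT₂ : ∀ w : InfinitePlace K₂, w α₂ ≤ T₂) :
    ∃ (K₃ : Type u) (_ : Field K₃) (_ : NumberField K₃) (_ : Algebra F K₃), finrank F K₃ = 2 ∧
      (∀ p k, 0 ≤ 1 + splitSign F K₁ p ^ k + splitSign F K₂ p ^ k + splitSign F K₃ p ^ k) ∧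
      IsCoveringBound K₃ (basisHeight F * (1 + 4 * T₁ * T₂)) := by
  have : FiniteDimensional F K₁ := FiniteDimensional.of_finrank_eq_succ d₁
  have : FiniteDimensional F K₂ := FiniteDimensional.of_finrank_eq_succ d₂
  have : Algebra.IsQuadraticExtension F K₁ := ⟨d₁⟩
  have : Algebra.IsQuadraticExtension F K₂ := ⟨d₂⟩
  let M := (K₁ ⊔ K₂ : IntermediateField F Ω)
  have : NumberField M := NumberField.of_module_finite F M
  let i₁ : K₁ →ₐ[F] M := inclusion le_sup_left
  let i₂ : K₂ →ₐ[F] M := inclusion le_sup_right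
  let : Algebra K₁ M := i₁.toAlgebra
  let : Algebra K₂ M := i₂.toAlgebra
  have : IsScalarTower F K₁ M := .of_algHom i₁
  have : IsScalarTower F K₂ M := .of_algHom i₂
  have : IsGalois F M := ⟨⟩
  obtain ⟨g₁, g₂, d₃, h⟩ := exists_isBiquadratic (F := F) (K₁ := K₁) (K₂ := K₂) (M := M)
    (E₁ := restrict le_sup_left) (E₂ := restrict le_sup_right) (fun y ↦ Iff.rfl) (fun y ↦ Iff.rfl)
    ((restrictAlgEquiv le_sup_left).toLinearEquiv.finrank_eq.symm.trans d₁)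
    ((restrictAlgEquiv le_sup_right).toLinearEquiv.finrank_eq.symm.trans d₂)
    (fun h ↦ hne (by simpa [lift_restrict] using congrArg lift h))
    (lift_injective _ (by rw [lift_sup, lift_restrict, lift_restrict, lift_top]))
  exact ⟨_, inferInstance, inferInstance, inferInstance, d₃, h.splitSign_pow_nonneg d₁ d₂ d₃,
    h.isCoveringBound d₃ hα₁ hα₂ hT₁ hT₂⟩

end NumberField

namespace NumberField

open Module IsDedekindDomain

variable {F : Type*} [Field F] [NumberField F]

theorem exists_absMono_exp {a : HeightOneSpectrum (𝓞 F) → ℕ → ℝ} (ha : ∀ p k, 0 ≤ a p k)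
    {l : HeightOneSpectrum (𝓞 F) → ℝ → ℝ} {ψ : ℝ → ℝ}
    (hl : ∀ p s, 1 < s → HasSum (fun k : ℕ ↦
      a p k * (((Ideal.absNorm p.asIdeal : ℝ) ^ (-s)) ^ (k + 1) / (k + 1))) (l p s))
    (hψ : ∀ s, 1 < s → HasSum (fun p ↦ l p s) (ψ s)) :
    ∃ b, AbsMono b (fun s ↦ Real.exp (ψ s)) ∧ 1 ≤ b 0 := by
  refine AbsMono.exp_dirichlet (ι := HeightOneSpectrum (𝓞 F) × ℕ)
    (c := fun i ↦ a i.1 i.2 / (i.2 + 1)) (q := fun i ↦ (Ideal.absNorm i.1.asIdeal : ℝ) ^ (i.2 + 1))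
    (fun i ↦ div_nonneg (ha _ _) (by positivity))
    (fun i ↦ one_le_pow₀ (one_lt_absNorm i.1).le) fun s hs _ ↦ ?_
  have hterm : ∀ i : HeightOneSpectrum (𝓞 F) × ℕ,
      a i.1 i.2 / (i.2 + 1) * ((Ideal.absNorm i.1.asIdeal : ℝ) ^ (i.2 + 1)) ^ (-s) =
      a i.1 i.2 * (((Ideal.absNorm i.1.asIdeal : ℝ) ^ (-s)) ^ (i.2 + 1) / (i.2 + 1)) := by
    intro i
    have h0 : (0 : ℝ) ≤ Ideal.absNorm i.1.asIdeal := by positivity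
    rw [← Real.rpow_natCast, ← Real.rpow_mul h0, mul_comm _ (-s), Real.rpow_mul h0,
      Real.rpow_natCast]
    ring
  simp only [hterm]
  have hs' : Summable fun i : HeightOneSpectrum (𝓞 F) × ℕ ↦
      a i.1 i.2 * (((Ideal.absNorm i.1.asIdeal : ℝ) ^ (-s)) ^ (i.2 + 1) / (i.2 + 1)) := by
    rw [summable_prod_of_nonneg]
    · refine ⟨fun p ↦ (hl p s hs).summable, ?_⟩
      simp only [(hl _ s hs).tsum_eq]
      exact (hψ s hs).summable
    · exact fun i ↦ mul_nonneg (ha _ _) (by positivity)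
  have := hs'.hasSum.prod_fiberwise fun p ↦ hl p s hs
  rw [(hψ s hs).unique this]
  exact hs'.hasSum

theorem hasSum_splitSign_log (K : Type*) [Field K] [NumberField K] [Algebra F K]
    (p : HeightOneSpectrum (𝓞 F)) {s : ℝ} (hs : 1 < s) :
    HasSum (fun k : ℕ ↦ splitSign F K p ^ (k + 1) *
      (((Ideal.absNorm p.asIdeal : ℝ) ^ (-s)) ^ (k + 1) / (k + 1)))
      (-Real.log (1 - splitSign F K p * (Ideal.absNorm p.asIdeal : ℝ) ^ (-s))) := by
  obtain ⟨h0, h1⟩ := absNorm_rpow_mem p (s := s) (by linarith)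
  have habs : |splitSign F K p * (Ideal.absNorm p.asIdeal : ℝ) ^ (-s)| < 1 := by
    rw [abs_mul, abs_of_pos h0]
    have : |splitSign F K p| ≤ 1 := by rcases splitSign_eq (K := K) p with h | h | h <;> simp [h]
    nlinarith
  refine (Real.hasSum_pow_div_log_of_abs_lt_one habs).congr_fun fun k ↦ ?_
  rw [mul_pow, mul_div_assoc]

theorem hasSum_absNorm_log (p : HeightOneSpectrum (𝓞 F)) {s : ℝ} (hs : 1 < s) :
    HasSum (fun k : ℕ ↦ (((Ideal.absNorm p.asIdeal : ℝ) ^ (-s)) ^ (k + 1) / (k + 1)))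
      (-Real.log (1 - (Ideal.absNorm p.asIdeal : ℝ) ^ (-s))) := by
  obtain ⟨h0, h1⟩ := absNorm_rpow_mem p (s := s) (by linarith)
  exact Real.hasSum_pow_div_log_of_abs_lt_one (by rwa [abs_of_pos h0])

theorem idealZeta_pos {L : Type*} [Field L] [NumberField L] {s : ℝ} (hs : 1 < s) :
    0 < idealZeta L s :=
  (hasSum_log_idealZeta (by linarith)
    (idealZeta_spec (isCoveringBound_basisHeight (L := L)) hs).1).1

theorem exists_absMono_idealZeta {K : Type*} [Field K] [NumberField K] [Algebra F K]
    (h2 : finrank F K = 2) : ∃ b, AbsMono b (idealZeta K) ∧ 1 ≤ b 0 := by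
  obtain ⟨b, hb, hb0⟩ := exists_absMono_exp (F := F)
    (a := fun p k ↦ 1 + splitSign F K p ^ (k + 1)) (ψ := fun s ↦ Real.log (idealZeta K s))
    (fun p k ↦ by
      have : |splitSign F K p ^ (k + 1)| ≤ 1 := by
        rw [abs_pow]
        refine pow_le_one₀ (abs_nonneg _) ?_
        rcases splitSign_eq (K := K) p with h | h | h <;> simp [h]
      linarith [neg_le_of_abs_le this])
    (fun p s hs ↦ ((hasSum_absNorm_log p hs).add (hasSum_splitSign_log K p hs)).congr_fun
      fun k ↦ by ring)
    (fun s hs ↦ hasSum_log_idealZeta_quadratic h2 (isCoveringBound_basisHeight (L := K)) hs)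
  exact ⟨b, hb.congr fun s hs _ ↦ Real.exp_log (idealZeta_pos hs), hb0⟩

theorem idealZeta_le_sq {K : Type*} [Field K] [NumberField K] [Algebra F K]
    (h2 : finrank F K = 2) {s : ℝ} (hs : 1 < s) : idealZeta K s ≤ idealZeta F s ^ 2 := by
  have hF := (hasSum_log_idealZeta (by linarith)
    (idealZeta_spec (isCoveringBound_basisHeight (L := F)) hs).1).2
  have hK := hasSum_log_idealZeta_quadratic h2 (isCoveringBound_basisHeight (L := K)) hs
  rw [← Real.log_le_log_iff (idealZeta_pos hs) (pow_pos (idealZeta_pos hs) 2), sq,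
    Real.log_mul (idealZeta_pos hs).ne' (idealZeta_pos hs).ne']
  refine hasSum_le (fun p ↦ ?_) hK (hF.add hF)
  obtain ⟨h0, h1⟩ := absNorm_rpow_mem p (s := s) (by linarith)
  have : splitSign F K p ≤ 1 := by rcases splitSign_eq (K := K) p with h | h | h <;> simp [h]
  have : Real.log (1 - (Ideal.absNorm p.asIdeal : ℝ) ^ (-s)) ≤
      Real.log (1 - splitSign F K p * (Ideal.absNorm p.asIdeal : ℝ) ^ (-s)) :=
    Real.log_le_log (by linarith) (by nlinarith)
  linarith

theorem exists_absMono_biquadratic {K₁ K₂ K₃ : Type*} [Field K₁] [NumberField K₁] [Field K₂]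
    [NumberField K₂] [Field K₃] [NumberField K₃] [Algebra F K₁] [Algebra F K₂] [Algebra F K₃]
    (d₁ : finrank F K₁ = 2) (d₂ : finrank F K₂ = 2) (d₃ : finrank F K₃ = 2)
    (h : ∀ (p : HeightOneSpectrum (𝓞 F)) k,
      0 ≤ 1 + splitSign F K₁ p ^ k + splitSign F K₂ p ^ k + splitSign F K₃ p ^ k) :
    ∃ b, AbsMono b (fun s ↦ idealZeta K₁ s * idealZeta K₂ s * idealZeta K₃ s /
      idealZeta F s ^ 2) ∧ 1 ≤ b 0 := by
  obtain ⟨b, hb, hb0⟩ := exists_absMono_exp (F := F)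
    (ψ := fun s ↦ Real.log (idealZeta K₁ s) + Real.log (idealZeta K₂ s) +
      Real.log (idealZeta K₃ s) - 2 * Real.log (idealZeta F s))
    (fun p k ↦ h p (k + 1))
    (fun p s hs ↦ ((((hasSum_absNorm_log p hs).add (hasSum_splitSign_log K₁ p hs)).add
      (hasSum_splitSign_log K₂ p hs)).add (hasSum_splitSign_log K₃ p hs)).congr_fun
      fun k ↦ by ring)
    (fun s hs ↦ by
      have hF := (hasSum_log_idealZeta (by linarith)
        (idealZeta_spec (isCoveringBound_basisHeight (L := F)) hs).1).2
      have h1 := hasSum_log_idealZeta_quadratic d₁ (isCoveringBound_basisHeight (L := K₁)) hs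
      have h2 := hasSum_log_idealZeta_quadratic d₂ (isCoveringBound_basisHeight (L := K₂)) hs
      have h3 := hasSum_log_idealZeta_quadratic d₃ (isCoveringBound_basisHeight (L := K₃)) hs
      exact (((h1.add h2).add h3).sub (hF.mul_left 2)).congr_fun fun p ↦ by ring)
  refine ⟨b, hb.congr fun s hs _ ↦ ?_, hb0⟩
  have hF := idealZeta_pos (L := F) hs
  have h1 := idealZeta_pos (L := K₁) hs
  have h2 := idealZeta_pos (L := K₂) hs
  have h3 := idealZeta_pos (L := K₃) hs
  rw [Real.exp_sub, Real.exp_add, Real.exp_add, Real.exp_log h1, Real.exp_log h2, Real.exp_log h3,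
    two_mul, Real.exp_add, Real.exp_log hF, sq]

end NumberField

namespace NumberField

open Module IsDedekindDomain
open scoped nonZeroDivisors

theorem norm_log_one_sub_le {z : ℂ} (hz : ‖z‖ < 1) :
    ‖Complex.log (1 - z)‖ ≤ -Real.log (1 - ‖z‖) := by
  have h1 := (Complex.hasSum_taylorSeries_neg_log hz)
  have h2 := Real.hasSum_pow_div_log_of_abs_lt_one (x := ‖z‖) (by simpa using hz)
  have h2' : HasSum (fun n : ℕ ↦ ‖z‖ ^ n / n) (-Real.log (1 - ‖z‖)) := by
    rw [← hasSum_nat_add_iff' 1]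
    simpa using h2
  rw [← norm_neg, ← h1.tsum_eq, ← h2'.tsum_eq]
  have h3 : (fun n : ℕ ↦ ‖z ^ n / (n : ℂ)‖) = fun n : ℕ ↦ ‖z‖ ^ n / n := by
    ext n; simp
  have := norm_tsum_le_tsum_norm (f := fun n : ℕ ↦ z ^ n / (n : ℂ)) (by rw [h3]; exact h2'.summable)
  rwa [h3] at this

variable (L : Type*) [Field L] [NumberField L]

theorem zetaCont_ne_zero_of_one_lt_re {s : ℂ} (hs : 1 < s.re) : zetaCont L s ≠ 0 := by
  set U : Set ℂ := {s | 1 < s.re} with hU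
  have hUo : IsOpen U := isOpen_lt continuous_const Complex.continuous_re
  set t : HeightOneSpectrum (𝓞 L) → ℂ → ℂ := fun P s ↦
    -Complex.log (1 - Complex.exp (-s * Real.log (Ideal.absNorm P.asIdeal))) with ht
  have hnorm : ∀ (P : HeightOneSpectrum (𝓞 L)) (s : ℂ),
      ‖Complex.exp (-s * Real.log (Ideal.absNorm P.asIdeal))‖ =
        (Ideal.absNorm P.asIdeal : ℝ) ^ (-s.re) := by
    intro P s
    rw [Complex.norm_exp, Real.rpow_def_of_pos (by linarith [one_lt_absNorm P])]
    congr 1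
    rw [Complex.re_mul_ofReal, Complex.neg_re, mul_comm]
  have hlog := fun {σ : ℝ} (hσ : 1 < σ) ↦ hasSum_log_idealZeta (L := L) (by linarith : 0 < σ)
    (idealZeta_spec isCoveringBound_basisHeight hσ).1
  have hlt : ∀ (P : HeightOneSpectrum (𝓞 L)) {σ : ℝ}, 1 < σ →
      (Ideal.absNorm P.asIdeal : ℝ) ^ (-σ) < 1 := fun P σ hσ ↦
    (absNorm_rpow_mem P (by linarith)).2
  have hg : DifferentiableOn ℂ (fun s ↦ ∑' P, t P s) U := by
    intro s₀ hs₀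
    obtain ⟨σ, h1σ, hσ⟩ := exists_between (show 1 < s₀.re from hs₀)
    have hVo : IsOpen {s : ℂ | σ < s.re} := isOpen_lt continuous_const Complex.continuous_re
    refine ((Complex.differentiableOn_tsum_of_summable_norm (hlog h1σ).2.summable
      (F := t) (U := {s : ℂ | σ < s.re}) ?_ hVo ?_).differentiableAt
        (hVo.mem_nhds hσ)).differentiableWithinAt
    · intro P s hs
      refine (DifferentiableAt.neg (DifferentiableAt.clog (by fun_prop) ?_)).differentiableWithinAt
      refine Or.inl ?_
      have h1 := hnorm P s
      have h2 := hlt P (σ := s.re) (h1σ.trans hs)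
      have h3 := Complex.re_le_norm (Complex.exp (-s * Real.log (Ideal.absNorm P.asIdeal)))
      rw [Complex.sub_re, Complex.one_re]
      linarith
    · intro P s hs
      have hs' : σ < s.re := hs
      simp only [t, norm_neg]
      refine (norm_log_one_sub_le (by rw [hnorm]; exact hlt P (h1σ.trans hs))).trans ?_
      rw [hnorm, neg_le_neg_iff]
      have h4 : (Ideal.absNorm P.asIdeal : ℝ) ^ (-s.re) ≤ (Ideal.absNorm P.asIdeal : ℝ) ^ (-σ) :=
        Real.rpow_le_rpow_of_exponent_le (one_lt_absNorm P).le (by linarith)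
      exact Real.log_le_log (by linarith [hlt P h1σ]) (by linarith)
  have hreal : ∀ σ : ℝ, 1 < σ →
      zetaCont L σ = ((σ : ℂ) - 1) * Complex.exp (∑' P, t P σ) := by
    intro σ hσ
    have h1 := (idealZeta_spec (L := L) isCoveringBound_basisHeight hσ).2
    have h2 := hlog hσ
    have h3 : ∀ P, t P σ = ((-Real.log (1 - (Ideal.absNorm P.asIdeal : ℝ) ^ (-σ)) : ℝ) : ℂ) := by
      intro P
      have h4 : Complex.exp (-σ * Real.log (Ideal.absNorm P.asIdeal)) =
          (((Ideal.absNorm P.asIdeal : ℝ) ^ (-σ) : ℝ) : ℂ) := by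
        rw [Real.rpow_def_of_pos (by linarith [one_lt_absNorm P])]
        push_cast
        ring_nf
      simp only [t]
      rw [h4, Complex.ofReal_neg, Complex.ofReal_log (by linarith [hlt P hσ])]
      push_cast
      rfl
    rw [h1, tsum_congr h3, ← Complex.ofReal_tsum, h2.2.tsum_eq, ← Complex.ofReal_exp,
      Real.exp_log h2.1]
    push_cast
    rfl
  have hZ : DifferentiableOn ℂ (zetaCont L) U :=
    (differentiableOn_zetaCont isCoveringBound_basisHeight).mono fun s hs ↦ by
      have : 0 ≤ (finrank ℚ L : ℝ)⁻¹ := by positivity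
      have hs' : 1 < s.re := hs
      simp only [Set.mem_ofPred_eq]
      linarith
  have hE : DifferentiableOn ℂ (fun s ↦ (s - 1) * Complex.exp (∑' P, t P s)) U :=
    (by fun_prop : DifferentiableOn ℂ (fun s : ℂ ↦ s - 1) U).mul hg.cexp
  have hconv : IsPreconnected U := (convex_halfSpace_re_gt 1).isPreconnected
  have heq := (hZ.analyticOnNhd hUo).eqOn_of_preconnected_of_frequently_eq
    (hE.analyticOnNhd hUo) hconv (z₀ := 2) (by simp [hU]) (by
      have hmap : Filter.Tendsto (fun x : ℝ ↦ (x : ℂ)) (nhdsWithin 2 {2}ᶜ) (nhdsWithin 2 {2}ᶜ) := by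
        refine tendsto_nhdsWithin_iff.2 ⟨?_, ?_⟩
        · have := (Complex.continuous_ofReal.tendsto 2).mono_left
            (nhdsWithin_le_nhds (s := {(2 : ℝ)}ᶜ))
          simpa using this
        · filter_upwards [self_mem_nhdsWithin] with x hx
          simp only [Set.mem_compl_iff, Set.mem_singleton_iff] at hx ⊢
          exact_mod_cast hx
      refine hmap.frequently (Filter.Eventually.frequently ?_)
      filter_upwards [nhdsWithin_le_nhds (lt_mem_nhds (show (1 : ℝ) < 2 by norm_num))] with x hx
      exact hreal x hx)
  rw [heq hs]
  refine mul_ne_zero (fun h ↦ ?_) (Complex.exp_ne_zero _)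
  have : s = 1 := by linear_combination h
  simp [this] at hs

/-- The completed zeta function is bounded away from zero slightly beyond the disc of centre `2`
and radius `1`. -/
theorem exists_zetaCont_lower_bound {r₁ : ℝ} (hr₁ : 1 < r₁)
    (hr₁' : 1 - (finrank ℚ L : ℝ)⁻¹ < 2 - r₁) :
    ∃ r δ : ℝ, 1 < r ∧ r ≤ r₁ ∧ 0 < δ ∧ δ ≤ 1 ∧
      ∀ z ∈ Metric.closedBall (2 : ℂ) r, δ ≤ ‖zetaCont L z‖ := by
  have hcont : ContinuousOn (zetaCont L) (Metric.closedBall 2 r₁) :=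
    (differentiableOn_zetaCont isCoveringBound_basisHeight).continuousOn.mono fun z hz ↦ by
      have h1 : |(z - 2).re| ≤ r₁ := (Complex.abs_re_le_norm _).trans (by
        simpa [dist_eq_norm] using hz)
      rw [abs_le, Complex.sub_re] at h1
      simp only [Set.mem_ofPred_eq]
      have : (2 : ℂ).re = 2 := rfl
      linarith [h1.1]
  have hne : ∀ z ∈ Metric.closedBall (2 : ℂ) 1, zetaCont L z ≠ 0 := by
    intro z hz
    by_cases hz1 : z = 1
    · rw [hz1, zetaCont_one]
      exact_mod_cast (dedekindZeta_residue_pos L).ne'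
    · refine zetaCont_ne_zero_of_one_lt_re L ?_
      by_contra! hre
      have h1 : ‖z - 2‖ ≤ 1 := by simpa [dist_eq_norm] using hz
      have h2 : (z.re - 2) * (z.re - 2) + z.im * z.im ≤ 1 := by
        have h3 := Complex.sq_norm (z - 2)
        rw [Complex.normSq_apply] at h3
        have h4 : (z - 2).re = z.re - 2 := rfl
        have h5 : (z - 2).im = z.im := by simp
        rw [h4, h5] at h3
        nlinarith [norm_nonneg (z - 2)]
      have h3 : z.re = 1 := by nlinarith [mul_self_nonneg z.im]
      have h4 : z.im = 0 := by
        rw [h3] at h2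
        exact mul_self_eq_zero.1 (le_antisymm (by linarith) (mul_self_nonneg _))
      exact hz1 (Complex.ext (by simpa using h3) (by simpa using h4))
  have hcompact : IsCompact (Metric.closedBall (2 : ℂ) 1) := isCompact_closedBall _ _
  set S := Metric.closedBall (2 : ℂ) r₁ ∩ zetaCont L ⁻¹' {0} with hS
  have hSclosed : IsClosed S :=
    hcont.preimage_isClosed_of_isClosed Metric.isClosed_closedBall isClosed_singleton
  have hdisj : Disjoint (Metric.closedBall (2 : ℂ) 1) S :=
    Set.disjoint_left.2 fun z hz hzS ↦ hne z hz hzS.2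
  obtain ⟨η, hη, hηd⟩ := hdisj.exists_cthickenings hcompact hSclosed
  obtain ⟨r, hr1, hr⟩ := exists_between (lt_min hr₁ (by linarith : 1 < 1 + η))
  have hrr₁ : r ≤ r₁ := (hr.trans_le (min_le_left _ _)).le
  have hrη : r ≤ 1 + η := (hr.trans_le (min_le_right _ _)).le
  have hne' : ∀ z ∈ Metric.closedBall (2 : ℂ) r, zetaCont L z ≠ 0 := by
    intro z hz h0
    have hzS : z ∈ S := ⟨Metric.closedBall_subset_closedBall hrr₁ hz, h0⟩
    refine Set.disjoint_left.1 hηd ?_ (Metric.self_subset_cthickening S hzS)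
    rw [cthickening_closedBall hη.le zero_le_one]
    exact Metric.closedBall_subset_closedBall (by linarith) hz
  obtain ⟨z₀, hz₀, hmin⟩ := (isCompact_closedBall (2 : ℂ) r).exists_isMinOn
    ⟨2, Metric.mem_closedBall_self (by linarith)⟩
    (hcont.mono (Metric.closedBall_subset_closedBall hrr₁)).norm
  refine ⟨r, min ‖zetaCont L z₀‖ 1, hr1, hrr₁, lt_min (norm_pos_iff.2 (hne' _ hz₀)) one_pos,
    min_le_right _ _, fun z hz ↦ (min_le_left _ _).trans (hmin hz)⟩

end NumberField

namespace NumberField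

open Module IsDedekindDomain

/-- Up to the residue, a bound near the disc of centre `2` and radius `1` for the completed zeta
function of a quadratic extension, with covering bound `Θ`, of a field of degree `n`. -/
noncomputable def quadBound (n : ℕ) (Θ : ℝ) : ℝ :=
  4 ^ (2 * n) * (1 + 10 * ((2 * n : ℕ) : ℝ)) * ((((2 * n : ℕ) : ℝ) + 1) * (7 * Θ ^ 2) ^ (2 * n))

theorem quadBound_mul (n : ℕ) (A X : ℝ) : quadBound n (A * X) = quadBound n A * X ^ (4 * n) := by
  unfold quadBound
  rw [mul_pow A X 2, ← mul_assoc 7, mul_pow (7 * A ^ 2), ← pow_mul X,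
    show 2 * (2 * n) = 4 * n by ring]
  ring

theorem quadBound_mono (n : ℕ) {A B : ℝ} (hA : 0 ≤ A) (hAB : A ≤ B) :
    quadBound n A ≤ quadBound n B := by
  unfold quadBound
  gcongr

theorem quadBound_nonneg (n : ℕ) (A : ℝ) : 0 ≤ quadBound n A := by
  unfold quadBound
  positivity

section

variable {F K : Type*} [Field F] [NumberField F] [Field K] [NumberField K] [Algebra F K]
  {Θ r : ℝ}

theorem finrank_of_quadratic (h2 : finrank F K = 2) : finrank ℚ K = 2 * finrank ℚ F := by
  rw [← finrank_mul_finrank ℚ F K, h2, mul_comm]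

theorem one_le_quadBound (h2 : finrank F K = 2) (h : IsCoveringBound K Θ) :
    1 ≤ quadBound (finrank ℚ F) Θ := by
  have h1 := one_le_of_isCoveringBound h
  rw [finrank_of_quadratic h2] at h1
  refine h1.trans (le_mul_of_one_le_left (by linarith) ?_)
  refine one_le_mul_of_one_le_of_one_le (one_le_pow₀ (by norm_num)) ?_
  have : (0 : ℝ) ≤ ((2 * finrank ℚ F : ℕ) : ℝ) := by positivity
  linarith

theorem re_of_mem_closedBall {z : ℂ} (hz : z ∈ Metric.closedBall (2 : ℂ) r) : 2 - r ≤ z.re := by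
  have h1 : |(z - 2).re| ≤ r := (Complex.abs_re_le_norm _).trans (by
    simpa [dist_eq_norm] using hz)
  rw [abs_le, Complex.sub_re] at h1
  have : (2 : ℂ).re = 2 := rfl
  linarith [h1.1]

theorem differentiableOn_zetaCont_closedBall (h2 : finrank F K = 2) (h : IsCoveringBound K Θ)
    (hr : r ≤ 1 + (4 * finrank ℚ F : ℝ)⁻¹) :
    DifferentiableOn ℂ (zetaCont K) (Metric.closedBall 2 r) := by
  refine (differentiableOn_zetaCont h).mono fun z hz ↦ ?_
  have h1 := re_of_mem_closedBall hz
  simp only [Set.mem_ofPred_eq]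
  rw [finrank_of_quadratic h2]
  have hn : (0 : ℝ) < finrank ℚ F := by exact_mod_cast finrank_pos
  have h3 : (4 * finrank ℚ F : ℝ)⁻¹ < ((2 * finrank ℚ F : ℕ) : ℝ)⁻¹ := by
    push_cast
    exact inv_strictAnti₀ (by positivity) (by linarith)
  linarith

theorem norm_zetaCont_le_quadBound (h2 : finrank F K = 2) (h : IsCoveringBound K Θ)
    (hr2 : r ≤ 2) (hr : r ≤ 1 + (4 * finrank ℚ F : ℝ)⁻¹) {z : ℂ}
    (hz : z ∈ Metric.closedBall 2 r) :
    ‖zetaCont K z‖ ≤ dedekindZeta_residue K * quadBound (finrank ℚ F) Θ := by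
  have h1 := re_of_mem_closedBall hz
  have hz4 : ‖z‖ ≤ 4 := by
    have h3 : ‖z - 2‖ ≤ r := by simpa [dist_eq_norm] using hz
    have h4 := norm_add_le (z - 2) 2
    rw [sub_add_cancel, Complex.norm_ofNat] at h4
    linarith
  have h5 := norm_zetaCont_le h rfl hz4 (by
    rw [finrank_of_quadratic h2]
    have : (2 * ((2 * finrank ℚ F : ℕ) : ℝ)) = 4 * finrank ℚ F := by push_cast; ring
    rw [this]
    linarith)
  rw [finrank_of_quadratic h2] at h5
  refine h5.trans_eq ?_
  unfold quadBound
  ring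

theorem exists_zetaCont_eq_zero (h2 : finrank F K = 2) (h : IsCoveringBound K Θ)
    (hr1 : 1 < r) (hr2 : r ≤ 2) (hr : r ≤ 1 + (4 * finrank ℚ F : ℝ)⁻¹)
    {B x₀ θ : ℝ} (hB : dedekindZeta_residue K * quadBound (finrank ℚ F) Θ ≤ B) (hB1 : 1 ≤ B)
    (hx : 1 < x₀) (hx0r : x₀ < r) (hθ : 0 < θ) (hxθ : x₀ ≤ (r / x₀) ^ θ)
    (hsmall : dedekindZeta_residue K * (8 * B / ((r - 1) * (1 - x₀ / r))) ^ θ < (x₀ - 1) / 2) :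
    ∃ x, 1 < x ∧ x ≤ x₀ ∧ zetaCont K ((2 - x : ℝ) : ℂ) = 0 := by
  obtain ⟨b, hb, hb0⟩ := exists_absMono_idealZeta h2
  have hd := differentiableOn_zetaCont_closedBall h2 h hr
  have hneg : (zetaCont K ((2 - x₀ : ℝ) : ℂ)).re < 0 := by
    by_contra! hGx
    refine absurd hsmall (not_lt.2 ?_)
    refine AbsMono.residue_lower_bound hb hb0 hr1 hr2 hd
      (fun z hz ↦ (norm_zetaCont_le_quadBound h2 h hr2 hr hz).trans hB) hB1
      zetaCont_one (dedekindZeta_residue_pos K).le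
      (fun s hs _ ↦ (idealZeta_spec h hs).2) hx le_rfl hx0r hθ hxθ ?_
    simpa using hGx
  have hcont : ContinuousOn (fun x : ℝ ↦ (zetaCont K ((2 - x : ℝ) : ℂ)).re) (Set.Icc 1 x₀) := by
    refine Complex.continuous_re.comp_continuousOn (hd.continuousOn.comp (by fun_prop) ?_)
    intro x hx
    rw [Metric.mem_closedBall, dist_eq_norm]
    have : ((2 - x : ℝ) : ℂ) - 2 = ((-x : ℝ) : ℂ) := by push_cast; ring
    rw [this, Complex.norm_real, norm_neg, Real.norm_of_nonneg (by linarith [hx.1])]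
    linarith [hx.2]
  have h1 : (0 : ℝ) < (zetaCont K ((2 - 1 : ℝ) : ℂ)).re := by
    have : ((2 - 1 : ℝ) : ℂ) = 1 := by norm_num
    rw [this, zetaCont_one]
    exact_mod_cast dedekindZeta_residue_pos K
  obtain ⟨x, hxm, hx0⟩ := intermediate_value_Ioo' hx.le hcont ⟨hneg, h1⟩
  exact ⟨x, hxm.1, hxm.2.le, Complex.ext hx0 (zetaCont_im _)⟩

theorem one_add_residue_le (h2 : finrank F K = 2) (h : IsCoveringBound K Θ)
    (hr1 : 1 < r) (hr2 : r ≤ 2) (hr : r ≤ 1 + (4 * finrank ℚ F : ℝ)⁻¹)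
    {x θ : ℝ} (hx0 : 0 < x) (hx1 : x < 1) (hθ : 0 < θ) (hθ2 : θ ≤ 1 / 2) (hxθ : x⁻¹ ≤ r ^ θ) :
    1 + dedekindZeta_residue K ≤
      (2 + idealZeta F (2 - x) ^ 2 * (4 * quadBound (finrank ℚ F) Θ / (r - 1)) ^ θ) ^ 2 := by
  obtain ⟨b, hb, -⟩ := exists_absMono_idealZeta h2
  have hκ := dedekindZeta_residue_pos K
  have hQ := one_le_quadBound h2 h
  set κ := dedekindZeta_residue K
  set Q := quadBound (finrank ℚ F) Θ
  have hr0 : 0 < r - 1 := by linarith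
  have h1 := AbsMono.residue_upper_bound (B := (1 + κ) * Q) hb hr1 hr2
    (differentiableOn_zetaCont_closedBall h2 h hr)
    (fun z hz ↦ (norm_zetaCont_le_quadBound h2 h hr2 hr hz).trans (by nlinarith))
    (by nlinarith) zetaCont_one (fun s hs _ ↦ (idealZeta_spec h hs).2) hx0 hx1 hθ hxθ
  have h3 := idealZeta_le_sq (F := F) h2 (show 1 < 2 - x by linarith)
  have h4 : (4 * ((1 + κ) * Q) / (r - 1)) ^ θ = (1 + κ) ^ θ * (4 * Q / (r - 1)) ^ θ := by
    rw [← Real.mul_rpow (by linarith) (by positivity)]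
    ring_nf
  have h5 : (1 + κ) ^ θ ≤ √(1 + κ) := by
    rw [Real.sqrt_eq_rpow]
    exact Real.rpow_le_rpow_of_exponent_le (by linarith) hθ2
  rw [h4] at h1
  set E := (4 * Q / (r - 1)) ^ θ
  have hE : 0 ≤ E := by positivity
  have hs1 : 1 ≤ √(1 + κ) := Real.one_le_sqrt.2 (by linarith)
  have h6 : 1 + κ ≤ √(1 + κ) * (2 + idealZeta F (2 - x) ^ 2 * E) := by
    have : idealZeta K (2 - x) * ((1 + κ) ^ θ * E) ≤
        idealZeta F (2 - x) ^ 2 * (√(1 + κ) * E) := by gcongr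
    nlinarith
  have h7 : √(1 + κ) ≤ 2 + idealZeta F (2 - x) ^ 2 * E := by
    nlinarith [Real.mul_self_sqrt (show 0 ≤ 1 + κ by linarith)]
  calc 1 + κ = √(1 + κ) ^ 2 := (Real.sq_sqrt (by linarith)).symm
    _ ≤ _ := by gcongr

end

theorem sub_one_le_of_zetaCont_eq_zero {F K₁ K₂ K₃ : Type*} [Field F] [NumberField F]
    [Field K₁] [NumberField K₁] [Algebra F K₁] [Field K₂] [NumberField K₂] [Algebra F K₂]
    [Field K₃] [NumberField K₃] [Algebra F K₃]
    (d₁ : finrank F K₁ = 2) (d₂ : finrank F K₂ = 2) (d₃ : finrank F K₃ = 2)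
    (hsign : ∀ (p : HeightOneSpectrum (𝓞 F)) (k : ℕ),
      0 ≤ 1 + splitSign F K₁ p ^ k + splitSign F K₂ p ^ k + splitSign F K₃ p ^ k)
    {Θ₁ Θ₂ Θ₃ r δ : ℝ} (h₁ : IsCoveringBound K₁ Θ₁) (h₂ : IsCoveringBound K₂ Θ₂)
    (h₃ : IsCoveringBound K₃ Θ₃) (hr1 : 1 < r) (hr2 : r ≤ 2)
    (hr : r ≤ 1 + (4 * finrank ℚ F : ℝ)⁻¹) (hδ : 0 < δ)
    (hF : ∀ z ∈ Metric.closedBall (2 : ℂ) r, δ ≤ ‖zetaCont F z‖)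
    {B x x₀ θ : ℝ} (hB1 : 1 ≤ B)
    (hB : dedekindZeta_residue K₁ * quadBound (finrank ℚ F) Θ₁ *
      (dedekindZeta_residue K₂ * quadBound (finrank ℚ F) Θ₂) *
      (dedekindZeta_residue K₃ * quadBound (finrank ℚ F) Θ₃) / δ ^ 2 ≤ B)
    (hx : 1 < x) (hx0 : x ≤ x₀) (hx0r : x₀ < r) (hθ : 0 < θ) (hxθ : x₀ ≤ (r / x₀) ^ θ)
    (hzero : zetaCont K₁ ((2 - x : ℝ) : ℂ) = 0) :
    (x - 1) / 2 ≤ dedekindZeta_residue K₁ * dedekindZeta_residue K₂ * dedekindZeta_residue K₃ /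
      dedekindZeta_residue F ^ 2 * (8 * B / ((r - 1) * (1 - x₀ / r))) ^ θ := by
  obtain ⟨b, hb, hb0⟩ := exists_absMono_biquadratic d₁ d₂ d₃ hsign
  have hκ₁ := dedekindZeta_residue_pos K₁
  have hκ₂ := dedekindZeta_residue_pos K₂
  have hκ₃ := dedekindZeta_residue_pos K₃
  have hκF := dedekindZeta_residue_pos F
  have hn : (0 : ℝ) < finrank ℚ F := by exact_mod_cast finrank_pos
  have hFd : DifferentiableOn ℂ (zetaCont F) (Metric.closedBall 2 r) := by
    refine (differentiableOn_zetaCont isCoveringBound_basisHeight).mono fun z hz ↦ ?_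
    have h1 := re_of_mem_closedBall hz
    simp only [Set.mem_ofPred_eq]
    have h3 : (4 * finrank ℚ F : ℝ)⁻¹ < (finrank ℚ F : ℝ)⁻¹ :=
      inv_strictAnti₀ (by positivity) (by linarith)
    linarith
  have hne : ∀ z ∈ Metric.closedBall (2 : ℂ) r, zetaCont F z ^ 2 ≠ 0 := fun z hz ↦
    pow_ne_zero _ (norm_pos_iff.1 (hδ.trans_le (hF z hz)))
  refine AbsMono.residue_lower_bound (b := b)
    (G := fun z ↦ zetaCont K₁ z * zetaCont K₂ z * zetaCont K₃ z / zetaCont F z ^ 2)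
    (B := B) hb hb0 hr1 hr2 ?_ ?_ hB1 ?_ (by positivity) ?_ hx hx0 hx0r hθ hxθ ?_
  · exact (((differentiableOn_zetaCont_closedBall d₁ h₁ hr).mul
      (differentiableOn_zetaCont_closedBall d₂ h₂ hr)).mul
      (differentiableOn_zetaCont_closedBall d₃ h₃ hr)).div (hFd.pow 2) hne
  · intro z hz
    refine le_trans ?_ hB
    rw [norm_div, norm_mul, norm_mul, norm_pow]
    have e₁ := norm_zetaCont_le_quadBound d₁ h₁ hr2 hr hz
    have e₂ := norm_zetaCont_le_quadBound d₂ h₂ hr2 hr hz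
    have e₃ := norm_zetaCont_le_quadBound d₃ h₃ hr2 hr hz
    have e₄ := hF z hz
    have e₅ : ‖zetaCont K₁ z‖ * ‖zetaCont K₂ z‖ * ‖zetaCont K₃ z‖ ≤ _ :=
      mul_le_mul (mul_le_mul e₁ e₂ (norm_nonneg _) ((norm_nonneg _).trans e₁)) e₃ (norm_nonneg _)
        (mul_nonneg ((norm_nonneg _).trans e₁) ((norm_nonneg _).trans e₂))
    exact div_le_div₀ ((by positivity : (0 : ℝ) ≤ _).trans e₅) e₅ (by positivity)
      (pow_le_pow_left₀ hδ.le e₄ 2)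
  · simp only [zetaCont_one]
    push_cast
    rfl
  · intro s hs _
    have hF0 := idealZeta_pos (L := F) hs
    have hs0 : (s : ℂ) - 1 ≠ 0 := by
      have : s - 1 ≠ 0 := by linarith
      exact_mod_cast this
    simp only [(idealZeta_spec h₁ hs).2, (idealZeta_spec h₂ hs).2, (idealZeta_spec h₃ hs).2,
      (idealZeta_spec (L := F) isCoveringBound_basisHeight hs).2]
    have hF0' : (idealZeta F s : ℂ) ≠ 0 := by exact_mod_cast hF0.ne'
    push_cast
    field_simp
  · have : (2 - (x : ℂ)) = ((2 - x : ℝ) : ℂ) := by push_cast; rfl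
    simp only [this, hzero]
    simp

end NumberField

namespace NumberField

universe u

open Module IsDedekindDomain

theorem mul_pow_rpow_inv {c s : ℝ} (hc : 0 ≤ c) (hs : 0 ≤ s) {n : ℕ} (hn : 0 < n) :
    (c * (s ^ 8) ^ (4 * n)) ^ ((32 * n : ℝ)⁻¹) = c ^ ((32 * n : ℝ)⁻¹) * s := by
  have hn' : (n : ℝ) ≠ 0 := by exact_mod_cast hn.ne'
  rw [Real.mul_rpow hc (by positivity), ← pow_mul, ← Real.rpow_natCast, ← Real.rpow_mul hs]
  congr 1
  convert Real.rpow_one s using 2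
  push_cast
  field_simp
  norm_num

theorem exists_le_div_rpow {r θ : ℝ} (hr : 1 < r) (hθ : 0 < θ) :
    ∃ x₀, 1 < x₀ ∧ x₀ < r ∧ x₀ ≤ (r / x₀) ^ θ := by
  have hr0 : 0 < r := by linarith
  have h : ContinuousAt (fun x : ℝ ↦ (r / x) ^ θ - x) 1 := by
    refine ContinuousAt.sub (ContinuousAt.rpow_const ?_ (Or.inr hθ.le)) continuousAt_id
    exact continuousAt_const.div continuousAt_id one_ne_zero
  have h1 : (0 : ℝ) < (r / 1) ^ θ - 1 := by
    rw [div_one]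
    linarith [Real.one_lt_rpow hr hθ]
  have h2 : ∀ᶠ x in nhdsWithin (1 : ℝ) (Set.Ioi 1), 0 < (r / x) ^ θ - x :=
    nhdsWithin_le_nhds (h.eventually_const_lt h1)
  have h3 : ∀ᶠ x in nhdsWithin (1 : ℝ) (Set.Ioi 1), x < r := nhdsWithin_le_nhds (gt_mem_nhds hr)
  obtain ⟨x, hx, hxr, hx1⟩ := (h2.and (h3.and self_mem_nhdsWithin)).exists
  exact ⟨x, hx1, hxr, by linarith⟩

/-- The part of the bound for the residue of a quadratic extension of a totally real field which
depends only on the base field. -/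
noncomputable def residueConst (F : Type*) [Field F] [NumberField F] : ℝ :=
  (2 * Real.pi) ^ finrank ℚ F * 2 ^ Units.rank F * Units.regulator F

theorem residueConst_pos (F : Type*) [Field F] [NumberField F] : 0 < residueConst F := by
  have := Units.regulator_pos F
  unfold residueConst
  positivity

theorem exists_generator_and_residue_le (F : Type*) {K : Type*} [Field F] [NumberField F]
    [Field K] [NumberField K] [Algebra F K] [IsTotallyReal F] [IsTotallyComplex K]
    (h2 : finrank F K = 2) {C : ℝ} (hC : classNumber K ≤ C) :
    ∃ s : ℝ, 1 ≤ s ∧ s ^ 16 = (|discr K| : ℤ) ∧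
      dedekindZeta_residue K ≤ C * residueConst F / s ^ 8 ∧
      ∃ α : 𝓞 K, (α : K) ∉ (algebraMap F K).range ∧
        ∀ w : InfinitePlace K, w α ≤ 3 * 4 ^ finrank ℚ F * s ^ 8 := by
  have hD : (1 : ℝ) ≤ √|discr K| := by
    rw [Real.one_le_sqrt]
    exact_mod_cast Int.one_le_abs (discr_ne_zero K)
  have hs : (√|discr K| ^ ((8 : ℕ) : ℝ)⁻¹) ^ 8 = √|discr K| :=
    Real.rpow_inv_natCast_pow (by linarith) (by norm_num)
  refine ⟨√|discr K| ^ ((8 : ℕ) : ℝ)⁻¹, Real.one_le_rpow hD (by positivity), ?_, ?_, ?_⟩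
  · rw [show 16 = 8 * 2 by rfl, pow_mul, hs, Real.sq_sqrt (by positivity), Int.cast_abs]
  · rw [hs]
    have hpos := residueConst_pos F
    refine (residue_le_of_quadratic F K h2).trans ?_
    change classNumber K * residueConst F / _ ≤ _
    gcongr
  · obtain ⟨α, hα, hw⟩ := exists_primitive_small K
    refine ⟨α, ?_, fun w ↦ ?_⟩
    · rintro ⟨a, ha⟩
      have h1 : (⊤ : IntermediateField ℚ K) ≤ (IsScalarTower.toAlgHom ℚ F K).fieldRange := by
        rw [← hα, IntermediateField.adjoin_le_iff, Set.singleton_subset_iff]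
        exact ⟨a, ha⟩
      have h3 : Function.Surjective (algebraMap F K) := fun y ↦ by
        obtain ⟨b, hb⟩ := h1 (IntermediateField.mem_top (x := y))
        exact ⟨b, hb⟩
      have h4 : finrank F K = 1 := by
        have : (⊥ : Subalgebra F K) = ⊤ := by
          rw [eq_top_iff]
          rintro y -
          obtain ⟨b, rfl⟩ := h3 y
          exact Subalgebra.algebraMap_mem _ b
        exact Subalgebra.bot_eq_top_iff_finrank_eq_one.1 this
      lia
    · rw [hs]
      refine (hw w).trans_eq ?_
      rw [finrank_of_quadratic h2, pow_mul]
      norm_num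

theorem mul_one_add_le {A T X : ℝ} (hA : 0 ≤ A) (hX : 1 ≤ X) :
    A * (1 + T * X) ≤ A * (1 + T) * X := by
  nlinarith

/-- Over a totally real field, an exceptional zero for every quadratic extension with small class
number and large discriminant. -/
theorem exists_forall_zetaCont_eq_zero (F : Type*) [Field F] [NumberField F] [IsTotallyReal F]
    {C r x₀ : ℝ} (hC : 0 < C) (hr1 : 1 < r) (hr2 : r ≤ 2) (hr : r ≤ 1 + (4 * finrank ℚ F : ℝ)⁻¹)
    (hx : 1 < x₀) (hx0r : x₀ < r) (hxθ : x₀ ≤ (r / x₀) ^ ((32 * finrank ℚ F : ℝ)⁻¹)) :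
    ∃ N : ℝ, ∀ (K : Type u) [Field K] [NumberField K] [Algebra F K] [IsTotallyComplex K],
      finrank F K = 2 → classNumber K ≤ C → N < |discr K| →
      ∃ x, 1 < x ∧ x ≤ x₀ ∧ zetaCont K ((2 - x : ℝ) : ℂ) = 0 := by
  have hn : 0 < finrank ℚ F := finrank_pos
  have hR := residueConst_pos F
  set n := finrank ℚ F with hndef
  set A := basisHeight F * (1 + 3 * 4 ^ n) with hA
  have hAF := one_le_basisHeight (L := F)
  set R := C * residueConst F with hRdef
  have hR0 : 0 < R := by positivity
  set W := (r - 1) * (1 - x₀ / r) with hW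
  have hW0 : 0 < W := by
    refine mul_pos (by linarith) (sub_pos.2 ?_)
    rwa [div_lt_one (by linarith)]
  set M := 1 + R * quadBound n A with hM
  have hq := quadBound_nonneg n A
  have hM0 : 1 ≤ M := by nlinarith
  set E := (8 * M / W) ^ ((32 * n : ℝ)⁻¹) with hE
  have hE0 : 0 ≤ E := by positivity
  set N := R * E * 2 / (x₀ - 1) with hN
  have hx01 : 0 < x₀ - 1 := by linarith
  have hN0 : 0 ≤ N := by positivity
  refine ⟨N ^ 16, fun K _ _ _ _ h2 hCK hdisc ↦ ?_⟩
  obtain ⟨s, hs1, hs, hκ, α, hα, hw⟩ := exists_generator_and_residue_le F h2 hCK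
  have hs8 : 1 ≤ s ^ 8 := one_le_pow₀ hs1
  have hcov := isCoveringBound_of_quadratic h2 hα (by positivity) hw
  have hκ0 := dedekindZeta_residue_pos K
  have hNs : N < s := by
    rw [← hs] at hdisc
    exact lt_of_pow_lt_pow_left₀ 16 (by linarith) hdisc
  refine exists_zetaCont_eq_zero (B := M * (s ^ 8) ^ (4 * n)) (θ := (32 * n : ℝ)⁻¹) h2 hcov hr1 hr2
    hr ?_ ?_ hx hx0r (by positivity) hxθ ?_
  · have h1 : quadBound n (basisHeight F * (1 + 3 * 4 ^ n * s ^ 8)) ≤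
        quadBound n A * (s ^ 8) ^ (4 * n) := by
      rw [← quadBound_mul]
      exact quadBound_mono n (by positivity) (mul_one_add_le (by linarith) hs8)
    have h3 : dedekindZeta_residue K ≤ R := hκ.trans (div_le_self hR0.le hs8)
    calc _ ≤ R * (quadBound n A * (s ^ 8) ^ (4 * n)) :=
          mul_le_mul h3 h1 (quadBound_nonneg _ _) hR0.le
      _ ≤ M * (s ^ 8) ^ (4 * n) := by
          rw [hM, ← mul_assoc]
          gcongr
          linarith
  · exact one_le_mul_of_one_le_of_one_le hM0 (one_le_pow₀ hs8)
  · have h1 : (8 * (M * (s ^ 8) ^ (4 * n)) / W) ^ ((32 * n : ℝ)⁻¹) = E * s := by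
      rw [hE, ← mul_pow_rpow_inv (by positivity) (by linarith) hn]
      ring_nf
    rw [h1]
    have h3 : R * E < (x₀ - 1) / 2 * s := by
      rw [hN, div_lt_iff₀ hx01] at hNs
      linarith
    have h4 : s ^ 2 ≤ s ^ 8 := pow_le_pow_right₀ hs1 (by norm_num)
    calc dedekindZeta_residue K * (E * s) ≤ R / s ^ 8 * (E * s) := by gcongr
      _ ≤ R / s ^ 2 * (E * s) := by gcongr
      _ = R * E / s := by field_simp
      _ < _ := by rwa [div_lt_iff₀ (by linarith)]

theorem le_sq_mul_sq_of_one_add_le {κ q Q Z ρ s : ℝ} {n : ℕ} (hn : 0 < n) (hq : 0 ≤ q)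
    (hs : 1 ≤ s) (hZ : 0 ≤ Z) (hρ : 0 < ρ) (hqQ : q ≤ Q * (s ^ 8) ^ (4 * n))
    (h : 1 + κ ≤ (2 + Z * (4 * q / ρ) ^ ((32 * n : ℝ)⁻¹)) ^ 2) :
    κ ≤ (2 + Z * (4 * Q / ρ) ^ ((32 * n : ℝ)⁻¹)) ^ 2 * s ^ 2 := by
  have hQ : 0 ≤ Q := nonneg_of_mul_nonneg_left (hq.trans hqQ) (by positivity)
  have h1 : (4 * q / ρ) ^ ((32 * n : ℝ)⁻¹) ≤ (4 * Q / ρ) ^ ((32 * n : ℝ)⁻¹) * s := by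
    rw [← mul_pow_rpow_inv (by positivity) (by linarith) hn]
    refine Real.rpow_le_rpow (by positivity) ?_ (by positivity)
    rw [div_mul_eq_mul_div, mul_assoc]
    gcongr
  rw [← mul_pow]
  have h2 : 2 + Z * (4 * q / ρ) ^ ((32 * n : ℝ)⁻¹) ≤
      (2 + Z * (4 * Q / ρ) ^ ((32 * n : ℝ)⁻¹)) * s := by
    have := mul_le_mul_of_nonneg_left h1 hZ
    nlinarith
  linarith [pow_le_pow_left₀ (by positivity) h2 2]

theorem le_of_sub_one_le {κ₁ κ₂ κ₃ κ q₁ q₂ q₃ Q₂ Q₃ R Y W δ s u : ℝ} {n : ℕ} (hn : 0 < n)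
    (hκ₁ : 0 ≤ κ₁) (hκ₂ : 0 ≤ κ₂) (hκ₃ : 0 ≤ κ₃) (hκ : 0 < κ) (hq₁ : 0 ≤ q₁) (hq₂ : 0 ≤ q₂)
    (hq₃ : 0 ≤ q₃) (hR : 0 ≤ R) (hY : 0 ≤ Y) (hW : 0 < W) (hδ : 0 < δ) (hs : 1 ≤ s)
    (hκR : κ₂ ≤ R / s ^ 8) (hκY : κ₃ ≤ Y * s ^ 2) (hqQ₂ : q₂ ≤ Q₂ * (s ^ 8) ^ (4 * n))
    (hqQ₃ : q₃ ≤ Q₃ * (s ^ 8) ^ (4 * n)) (hu : 0 < u)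
    (h : ∀ B, 1 ≤ B → κ₁ * q₁ * (κ₂ * q₂) * (κ₃ * q₃) / δ ^ 2 ≤ B →
      u / 2 ≤ κ₁ * κ₂ * κ₃ / κ ^ 2 * (8 * B / W) ^ ((32 * n : ℝ)⁻¹)) :
    s ≤ κ₁ * R * Y / κ ^ 2 * (8 * (1 + κ₁ * q₁ * (R * Q₂) * (Y * Q₃) / δ ^ 2) / W) ^
      ((32 * n : ℝ)⁻¹) * 2 / u := by
  have hs0 : 0 < s := by linarith
  have hQ₂ : 0 ≤ Q₂ := nonneg_of_mul_nonneg_left (hq₂.trans hqQ₂) (by positivity)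
  have hQ₃ : 0 ≤ Q₃ := nonneg_of_mul_nonneg_left (hq₃.trans hqQ₃) (by positivity)
  set P := (s ^ 8) ^ (4 * n) with hP
  have hP1 : 1 ≤ P := one_le_pow₀ (one_le_pow₀ hs)
  have hM0 : 0 ≤ κ₁ * q₁ * (R * Q₂) * (Y * Q₃) / δ ^ 2 := by positivity
  set M := 1 + κ₁ * q₁ * (R * Q₂) * (Y * Q₃) / δ ^ 2 with hM
  have hκR' : κ₂ * s ^ 2 ≤ R := by
    rw [le_div_iff₀ (by positivity)] at hκR
    have : s ^ 2 ≤ s ^ 8 := pow_le_pow_right₀ hs (by norm_num)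
    nlinarith
  have hmain := h (M * P ^ 2)
    (one_le_mul_of_one_le_of_one_le (by linarith) (one_le_pow₀ hP1)) (by
      calc κ₁ * q₁ * (κ₂ * q₂) * (κ₃ * q₃) / δ ^ 2
          ≤ κ₁ * q₁ * (κ₂ * (Q₂ * P)) * (Y * s ^ 2 * (Q₃ * P)) / δ ^ 2 := by gcongr
        _ = κ₁ * q₁ * (κ₂ * s ^ 2 * Q₂) * (Y * Q₃) / δ ^ 2 * P ^ 2 := by ring
        _ ≤ κ₁ * q₁ * (R * Q₂) * (Y * Q₃) / δ ^ 2 * P ^ 2 := by gcongr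
        _ ≤ M * P ^ 2 := by gcongr; linarith)
  have hEs : (8 * (M * P ^ 2) / W) ^ ((32 * n : ℝ)⁻¹) =
      (8 * M / W) ^ ((32 * n : ℝ)⁻¹) * s ^ 2 := by
    have h1 := mul_pow_rpow_inv (c := 8 * M * P / W) (by positivity) hs0.le hn
    have h2 := mul_pow_rpow_inv (c := 8 * M / W) (by positivity) hs0.le hn
    have e1 : 8 * (M * P ^ 2) / W = 8 * M * P / W * (s ^ 8) ^ (4 * n) := by rw [← hP]; ring
    have e2 : 8 * M * P / W = 8 * M / W * (s ^ 8) ^ (4 * n) := by rw [← hP]; ring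
    rw [e1, h1, e2, h2]
    ring
  rw [hEs] at hmain
  have hE0 : 0 ≤ (8 * M / W) ^ ((32 * n : ℝ)⁻¹) := by positivity
  set E := (8 * M / W) ^ ((32 * n : ℝ)⁻¹)
  rw [le_div_iff₀ hu]
  have h1 : κ₁ * κ₂ * κ₃ / κ ^ 2 * (E * s ^ 2) ≤
      κ₁ * (R / s ^ 8) * (Y * s ^ 2) / κ ^ 2 * (E * s ^ 2) := by gcongr
  have h2 : κ₁ * (R / s ^ 8) * (Y * s ^ 2) / κ ^ 2 * (E * s ^ 2) =
      κ₁ * R * Y / κ ^ 2 * E / s ^ 4 := by field_simp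
  have h3 : u / 2 * s ^ 4 ≤ κ₁ * R * Y / κ ^ 2 * E := by
    rw [← le_div_iff₀ (by positivity)]
    linarith
  have h4 : s ≤ s ^ 4 := le_self_pow₀ hs (by norm_num)
  nlinarith

/-- The zero of the zeta function of one quadratic extension bounds the discriminants of the others
with small class number. -/
theorem exists_discr_bound_of_zetaCont_eq_zero {F : Type*} {Ω : Type u} [Field F] [NumberField F]
    [Field Ω] [Algebra F Ω] [IsTotallyReal F] {C r δ x x₀ : ℝ} (hC : 0 < C) (hr1 : 1 < r)
    (hr2 : r ≤ 2) (hr : r ≤ 1 + (4 * finrank ℚ F : ℝ)⁻¹) (hδ : 0 < δ)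
    (hF : ∀ z ∈ Metric.closedBall (2 : ℂ) r, δ ≤ ‖zetaCont F z‖)
    (hx0r : x₀ < r) (hxθ : x₀ ≤ (r / x₀) ^ ((32 * finrank ℚ F : ℝ)⁻¹))
    {K₁ : IntermediateField F Ω} [NumberField K₁] (d₁ : finrank F K₁ = 2)
    {α₁ : 𝓞 K₁} (hα₁ : (α₁ : K₁) ∉ (algebraMap F K₁).range)
    {T₁ : ℝ} (hT₁0 : 0 ≤ T₁) (hT₁ : ∀ w : InfinitePlace K₁, w α₁ ≤ T₁)
    (hx : 1 < x) (hxx₀ : x ≤ x₀) (hzero : zetaCont K₁ ((2 - x : ℝ) : ℂ) = 0) :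
    ∃ N : ℝ, ∀ (K₂ : IntermediateField F Ω) [NumberField K₂] [IsTotallyComplex K₂],
      finrank F K₂ = 2 → classNumber K₂ ≤ C → K₁ ≠ K₂ → |discr K₂| ≤ N := by
  have hn : 0 < finrank ℚ F := finrank_pos
  have hR := residueConst_pos F
  have hcov₁ := isCoveringBound_of_quadratic d₁ hα₁ hT₁0 hT₁
  have hκF := dedekindZeta_residue_pos F
  have hκ₁ := dedekindZeta_residue_pos K₁
  have hAF := one_le_basisHeight (L := F)
  have hr0 : 0 < r - 1 := by linarith
  have hW0 : 0 < (r - 1) * (1 - x₀ / r) := by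
    refine mul_pos hr0 (sub_pos.2 ?_)
    rwa [div_lt_one (by linarith)]
  have hn1 : (1 : ℝ) ≤ finrank ℚ F := by exact_mod_cast hn
  set θ : ℝ := (32 * finrank ℚ F : ℝ)⁻¹ with hθ
  have hθ0 : 0 < θ := by positivity
  have hθ2 : θ ≤ 1 / 2 := by
    rw [hθ, one_div]
    exact inv_anti₀ (by norm_num) (by linarith)
  have hy1 : (r ^ θ)⁻¹ < 1 := inv_lt_one_of_one_lt₀ (Real.one_lt_rpow hr1 hθ0)
  refine ⟨(dedekindZeta_residue K₁ * (C * residueConst F) * (2 + idealZeta F (2 - (r ^ θ)⁻¹) ^ 2 *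
    (4 * quadBound (finrank ℚ F) (basisHeight F * (1 + 4 * T₁ * (3 * 4 ^ finrank ℚ F))) /
      (r - 1)) ^ θ) ^ 2 / dedekindZeta_residue F ^ 2 * (8 * (1 + dedekindZeta_residue K₁ *
      quadBound (finrank ℚ F) (basisHeight F * (1 + T₁)) * (C * residueConst F *
        quadBound (finrank ℚ F) (basisHeight F * (1 + 3 * 4 ^ finrank ℚ F))) *
      ((2 + idealZeta F (2 - (r ^ θ)⁻¹) ^ 2 * (4 * quadBound (finrank ℚ F)
        (basisHeight F * (1 + 4 * T₁ * (3 * 4 ^ finrank ℚ F))) / (r - 1)) ^ θ) ^ 2 *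
      quadBound (finrank ℚ F) (basisHeight F * (1 + 4 * T₁ * (3 * 4 ^ finrank ℚ F)))) / δ ^ 2) /
      ((r - 1) * (1 - x₀ / r))) ^ θ * 2 / (x - 1)) ^ 16, fun K₂ _ _ d₂ hCK hne ↦ ?_⟩
  obtain ⟨s, hs1, hs, hκ, α₂, hα₂, hw⟩ := exists_generator_and_residue_le F d₂ hCK
  have hs8 : 1 ≤ s ^ 8 := one_le_pow₀ hs1
  have hcov₂ := isCoveringBound_of_quadratic d₂ hα₂ (by positivity) hw
  obtain ⟨K₃, _, _, _, d₃, hsign, hcov₃⟩ := exists_third_quadratic d₁ d₂ hne hα₁ hα₂ hT₁ hw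
  have q₂ : quadBound (finrank ℚ F) (basisHeight F * (1 + 3 * 4 ^ finrank ℚ F * s ^ 8)) ≤
      quadBound (finrank ℚ F) (basisHeight F * (1 + 3 * 4 ^ finrank ℚ F)) *
        (s ^ 8) ^ (4 * finrank ℚ F) := by
    rw [← quadBound_mul]
    exact quadBound_mono _ (by positivity) (mul_one_add_le (by linarith) hs8)
  have q₃ : quadBound (finrank ℚ F) (basisHeight F * (1 + 4 * T₁ * (3 * 4 ^ finrank ℚ F * s ^ 8))) ≤
      quadBound (finrank ℚ F) (basisHeight F * (1 + 4 * T₁ * (3 * 4 ^ finrank ℚ F))) *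
        (s ^ 8) ^ (4 * finrank ℚ F) := by
    rw [← quadBound_mul, ← mul_assoc (4 * T₁)]
    exact quadBound_mono _ (by positivity) (mul_one_add_le (by linarith) hs8)
  have k₃ := le_sq_mul_sq_of_one_add_le hn (quadBound_nonneg _ _) hs1 (sq_nonneg _) hr0 q₃
    (one_add_residue_le d₃ hcov₃ hr1 hr2 hr (by positivity) hy1 hθ0 hθ2 (by rw [inv_inv]))
  rw [← hs]
  exact pow_le_pow_left₀ (by linarith) (le_of_sub_one_le hn (dedekindZeta_residue_pos K₁).le
    (dedekindZeta_residue_pos K₂).le (dedekindZeta_residue_pos K₃).le (dedekindZeta_residue_pos F)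
    (quadBound_nonneg _ _) (quadBound_nonneg _ _) (quadBound_nonneg _ _) (by positivity)
    (sq_nonneg _) hW0 hδ hs1 hκ k₃ q₂ q₃ (by linarith) fun B hB1 hB ↦
      sub_one_le_of_zetaCont_eq_zero d₁ d₂ d₃ hsign hcov₁ hcov₂ hcov₃ hr1 hr2 hr hδ hF hB1 hB
        hx hxx₀ hx0r hθ0 hxθ hzero) 16

end NumberField

namespace NumberField

universe u

open Module

theorem exists_discr_bound_of_classNumber_le (F : Type*) (Ω : Type u) [Field F] [NumberField F]
    [Field Ω] [Algebra F Ω] [IsTotallyReal F] {C : ℝ} (hC : 0 < C) :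
    ∃ N : ℝ, ∀ (K : IntermediateField F Ω) [NumberField K] [IsTotallyComplex K],
      finrank F K = 2 → classNumber K ≤ C → |discr K| ≤ N := by
  have hn1 : (1 : ℝ) ≤ finrank ℚ F := by exact_mod_cast finrank_pos
  have h4 : (4 * finrank ℚ F : ℝ)⁻¹ < (finrank ℚ F : ℝ)⁻¹ :=
    inv_strictAnti₀ (by positivity) (by linarith)
  obtain ⟨r, δ, hr1, hr, hδ, -, hF⟩ := exists_zetaCont_lower_bound F
    (r₁ := 1 + (4 * finrank ℚ F : ℝ)⁻¹) (lt_add_of_pos_right _ (by positivity)) (by linarith)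
  have hr2 : r ≤ 2 := by
    have : (4 * finrank ℚ F : ℝ)⁻¹ ≤ 1 := inv_le_one_of_one_le₀ (by linarith)
    linarith
  obtain ⟨x₀, hx₀, hx₀r, hxθ⟩ := exists_le_div_rpow (θ := (32 * finrank ℚ F : ℝ)⁻¹) hr1
    (by positivity)
  obtain ⟨N, hN⟩ := exists_forall_zetaCont_eq_zero.{u} F hC hr1 hr2 hr hx₀ hx₀r hxθ
  by_cases hsmall : ∀ (K : IntermediateField F Ω) [NumberField K] [IsTotallyComplex K],
      finrank F K = 2 → classNumber K ≤ C → |discr K| ≤ N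
  · exact ⟨N, hsmall⟩
  · push Not at hsmall
    obtain ⟨K₁, _, _, d₁, hC₁, hN₁⟩ := hsmall
    obtain ⟨x, hx, hxx₀, hzero⟩ := hN K₁ d₁ hC₁ hN₁
    obtain ⟨s, hs, -, -, α₁, hα₁, hT₁⟩ := exists_generator_and_residue_le F d₁ hC₁
    obtain ⟨N', hN'⟩ := exists_discr_bound_of_zetaCont_eq_zero (Ω := Ω) hC hr1 hr2 hr hδ hF hx₀r hxθ
      d₁ hα₁ (by positivity) hT₁ hx hxx₀ hzero
    refine ⟨max N' (|discr K₁| : ℤ), fun K _ _ d hCK ↦ ?_⟩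
    by_cases hne : K₁ = K
    · subst hne
      exact le_max_right _ _
    · exact (hN' K d hCK hne).trans (le_max_left _ _)

end NumberField

theorem NumberField.classNumber_eq_of_ringEquiv {K L : Type*} [Field K] [NumberField K] [Field L]
    [NumberField L] (e : K ≃+* L) : classNumber K = classNumber L :=
  Fintype.card_congr (ClassGroup.mulEquiv (RingOfIntegers.mapRingEquiv e)).toEquiv

theorem IsTotallyRealField.isTotallyReal {K : Type*} [Field K] (h : IsTotallyRealField K) :
    IsTotallyReal K :=
  ⟨fun _ ↦ InfinitePlace.isReal_iff.2 (h _)⟩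

theorem IsTotallyImaginaryField.isTotallyComplex {K : Type*} [Field K]
    (h : IsTotallyImaginaryField K) : IsTotallyComplex K :=
  ⟨fun _ ↦ InfinitePlace.isComplex_iff.2 (h _)⟩

theorem IsTotallyImaginaryField.of_ringEquiv {K L : Type*} [Field K] [Field L] (e : K ≃+* L)
    (h : IsTotallyImaginaryField K) : IsTotallyImaginaryField L := by
  intro φ hφ
  refine h (φ.comp (e : K →+* L)) ?_
  ext x
  exact congrArg (fun ψ : L →+* ℂ ↦ ψ (e x)) hφ

/-- Let `F` be a totally real number field inside a fixed algebraic closure `ℚ̄` of `ℚ`.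
For every `C > 0`, only finitely many totally imaginary quadratic extensions `K/F`
inside `ℚ̄` have class number at most `C`.  (In particular, class numbers of CM
quadratic extensions of `F` tend to infinity.) -/
theorem finite_CM_ext_of_classNumber_le
    (F : IntermediateField ℚ (AlgebraicClosure ℚ)) [NumberField ↥F]
    (hFreal : IsTotallyRealField ↥F)
    (C : ℝ) (hC : 0 < C) :
    {K : IntermediateField ℚ (AlgebraicClosure ℚ) |
      F ≤ K ∧ IsTotallyImaginaryField ↥K ∧
      finrank ℚ ↥K = 2 * finrank ℚ ↥F ∧
      ∃ h : NumberField ↥K, (@classNumber ↥K _ h : ℝ) ≤ C}.Finite := by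
  have := hFreal.isTotallyReal
  obtain ⟨N, hN⟩ := exists_discr_bound_of_classNumber_le F (AlgebraicClosure ℚ) hC
  refine ((finite_of_discr_bdd (AlgebraicClosure ℚ) ⌈N⌉₊).image Subtype.val).subset ?_
  rintro K ⟨hFK, him, hdeg, hK, hCK⟩
  refine ⟨⟨K, hK.to_finiteDimensional⟩, ?_, rfl⟩
  let e : K ≃+* IntermediateField.extendScalars hFK := RingEquiv.refl K
  have : NumberField (IntermediateField.extendScalars hFK) := NumberField.of_ringEquiv K _ e
  have := (him.of_ringEquiv e).isTotallyComplex
  have hdeg' : finrank ℚ (IntermediateField.extendScalars hFK) = 2 * finrank ℚ F := by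
    rw [← hdeg]
    exact (AlgEquiv.ofRingEquiv (R := ℚ) (f := e) fun r ↦ by simp).toLinearEquiv.finrank_eq.symm
  have h2 : finrank F (IntermediateField.extendScalars hFK) = 2 := by
    have h := finrank_mul_finrank ℚ F (IntermediateField.extendScalars hFK)
    rw [hdeg', mul_comm] at h
    exact Nat.eq_of_mul_eq_mul_right finrank_pos h
  have hdisc := hN (IntermediateField.extendScalars hFK) h2
    (by rwa [← classNumber_eq_of_ringEquiv e])
  rw [← discr_eq_discr_of_ringEquiv K e] at hdisc
  have h3 : ((|discr K| : ℤ) : ℝ) ≤ ((⌈N⌉₊ : ℤ) : ℝ) := by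
    rw [Int.cast_natCast]
    exact hdisc.trans (Nat.le_ceil N)
  exact Int.cast_le.1 h3
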